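/- arXiv:1307.5078 — 2 statements merged into one kernel-verified Lean document; each statement's English description precedes it below -/
import Mathlib

section
/- For every integer n ≥ 2, the Mersenne number 2^n - 1 is not a perfect power: there are no integers m ≥ 2 and k ≥ 2 with 2^n - 1 = m^k. -/
/-- A proper divisor of a power of two still divides it after doubling. -/
theorem two_mul_dvd_two_pow_of_lt {d n : ℕ} (hd : d ∣ 2 ^ n) (hlt : d < 2 ^ n) :
    2 * d ∣ 2 ^ n := by
  obtain ⟨a, -, rfl⟩ := (Nat.dvd_prime_pow Nat.prime_two).1 hd
  rw [← pow_succ']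
  exact pow_dvd_pow 2 ((Nat.pow_lt_pow_iff_right one_lt_two).1 hlt)

/-- For odd `m`, the odd powers of `m` are congruent to `m` modulo `2 * (m + 1)`. -/
theorem two_mul_add_one_dvd_odd_pow_sub {m : ℤ} (hm : Odd m) (j : ℕ) :
    2 * (m + 1) ∣ m ^ (2 * j + 1) - m := by
  have hsq : 2 * (m + 1) ∣ m ^ 2 - 1 := by
    obtain ⟨c, rfl⟩ := hm
    exact ⟨c, by ring⟩
  have hpow : m ^ 2 - 1 ∣ (m ^ 2) ^ j - 1 := by
    simpa using sub_dvd_pow_sub_pow (m ^ 2) 1 j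
  have heq : m ^ (2 * j + 1) - m = ((m ^ 2) ^ j - 1) * m := by ring
  rw [heq]
  exact (hsq.trans hpow).mul_right m

/-- For every `n ≥ 2`, the Mersenne number `2 ^ n - 1` is not a perfect power. -/
theorem mersenne_not_perfect_power (n : ℕ) (hn : 2 ≤ n) :
    ¬ ∃ (m k : ℕ), 2 ≤ m ∧ 2 ≤ k ∧ (2 : ℤ) ^ n - 1 = (m : ℤ) ^ k := by
  rintro ⟨m, k, hm, hk, h⟩
  have h4 : (4 : ℤ) ∣ 2 ^ n := pow_dvd_pow (2 : ℤ) hn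
  have hodd : Odd (m : ℤ) := by
    have hpow : Odd ((m : ℤ) ^ k) := by
      rw [← h, Int.odd_iff]
      omega
    exact (Int.odd_pow' (by omega)).1 hpow
  obtain ⟨j, rfl | rfl⟩ := k.even_or_odd'
  · have hsq : (4 : ℤ) ∣ (m : ℤ) ^ (2 * j) - 1 := by
      have hmod := (Int.sq_mod_four_eq_one_of_odd (hodd.pow (n := j)))
      rw [← pow_mul, mul_comm] at hmod
      omega
    omega
  · have hnat : 2 ^ n = m ^ (2 * j + 1) + 1 := by
      zify
      linarith
    have hdvd : m + 1 ∣ 2 ^ n := by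
      rw [hnat]
      simpa using Odd.nat_add_dvd_pow_add_pow m 1 (odd_two_mul_add_one j)
    have hlt : m + 1 < 2 ^ n := by
      rw [hnat]
      have := Nat.pow_lt_pow_right (a := m) (m := 1) (n := 2 * j + 1) (by omega) (by omega)
      rw [pow_one] at this
      omega
    have hdouble : 2 * ((m : ℤ) + 1) ∣ 2 ^ n := by
      exact_mod_cast two_mul_dvd_two_pow_of_lt hdvd hlt
    have hself : 2 * ((m : ℤ) + 1) ∣ m + 1 := by
      have heq : (m : ℤ) + 1 = 2 ^ n - (m ^ (2 * j + 1) - m) := by linarith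
      have hsub := dvd_sub hdouble (two_mul_add_one_dvd_odd_pow_sub hodd j)
      rwa [← heq] at hsub
    have := Int.le_of_dvd (by omega) hself
    omega
end

section
/- For every integer n ≥ 2, the number 3^n - 2^n is not a perfect power: there are no integers m ≥ 2 and k ≥ 2 with 3^n - 2^n = m^k. -/
open Finset
open scoped NumberTheorySymbols

/-- A determinant whose columns are combinations of the columns of `P`, the one with index `t`
being weighted by `b ^ w t`. -/
theorem pow_dvd_det {n τ : Type*} [Fintype n] [DecidableEq n] [Fintype τ] {b : ℤ} {w : τ → ℕ}
    {P : n → τ → ℤ} {A : τ → n → ℤ} {M : Matrix n n ℤ}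
    (hM : ∀ i j, M i j = ∑ t, b ^ w t * A t j * P i t) {W : ℕ}
    (hW : ∀ c : n → τ, Function.Injective c → W ≤ ∑ j, w (c j)) : b ^ W ∣ M.det := by
  have h1 : M.transpose = fun j => ∑ t, (b ^ w t * A t j) • (fun i => P i t) := by
    ext j i
    simp [hM, Finset.sum_apply]
  rw [← Matrix.det_transpose, h1]
  have h2 := (Matrix.detRowAlternating (n := n) (R := ℤ)).toMultilinearMap.map_sum
    (fun j t => (b ^ w t * A t j) • (fun i => P i t))
  rw [show (Matrix.det fun j => ∑ t, (b ^ w t * A t j) • (fun i => P i t)) = _ from h2]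
  refine Finset.dvd_sum fun c _ => ?_
  rw [MultilinearMap.map_smul_univ, smul_eq_mul]
  by_cases hc : Function.Injective c
  · rw [Finset.prod_mul_distrib, Finset.prod_pow_eq_pow_sum]
    exact Dvd.dvd.mul_right (Dvd.dvd.mul_right (pow_dvd_pow b (hW c hc)) _) _
  · simp only [Function.Injective, not_forall] at hc
    obtain ⟨j, j', h3, h4⟩ := hc
    have h5 : (Matrix.detRowAlternating (n := n) (R := ℤ)) (fun j i => P i (c j)) = 0 :=
      AlternatingMap.map_eq_zero_of_eq _ _ (by simp [h3]) h4
    exact (show _ = (0 : ℤ) from (congrArg _ h5).trans (mul_zero _)) ▸ dvd_zero _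

theorem choose_two_le_sum_elim {n : Type*} [Fintype n] {R : ℕ} (hR : Fintype.card n = R + 1)
    {c : n → Fin R ⊕ n} (hc : Function.Injective c) :
    (R + 1).choose 2 ≤ ∑ j, Sum.elim (fun i : Fin R => (i : ℕ)) (fun _ => R) (c j) := by
  set w : Fin R ⊕ n → ℕ := Sum.elim (fun i => (i : ℕ)) (fun _ => R) with hw
  have hwR : ∀ t, w t ≤ R := by
    rintro (t | t)
    · exact t.2.le
    · exact le_rfl
  have h1 : ∀ t, w t = ∑ i ∈ Finset.range R, if i < w t then 1 else 0 := by
    intro t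
    rw [← Finset.card_filter]
    have : (Finset.range R).filter (fun i => i < w t) = Finset.range (w t) := by
      ext i
      have := hwR t
      simp only [Finset.mem_filter, Finset.mem_range]
      omega
    rw [this, Finset.card_range]
  have h2 : ∀ i ∈ Finset.range R, R - i ≤ ∑ j, if i < w (c j) then 1 else 0 := by
    intro i hi
    rw [Finset.mem_range] at hi
    rw [← Finset.card_filter]
    have h3 : (Finset.univ.filter fun j => ¬ i < w (c j)).card ≤ (Finset.range (i + 1)).card := by
      refine Finset.card_le_card_of_injOn (fun j => w (c j)) (fun j hj => ?_) ?_
      · simp only [Finset.coe_filter, Set.mem_ofPred_eq, Finset.mem_univ, true_and] at hj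
        simp only [Finset.coe_range, Set.mem_Iio]
        omega
      · intro j hj j' hj' hjj
        simp only [Finset.coe_filter, Set.mem_ofPred_eq, Finset.mem_univ, true_and] at hj hj'
        apply hc
        rcases h : c j with t | t <;> rcases h' : c j' with t' | t' <;>
          simp only [h, h', hw, Sum.elim_inl, Sum.elim_inr] at hj hj' hjj
        · rw [Fin.ext hjj]
        all_goals omega
    have h4 := Finset.card_filter_add_card_filter_not (s := (Finset.univ : Finset n))
      (fun j => i < w (c j))
    rw [Finset.card_univ, hR] at h4
    rw [Finset.card_range] at h3
    omega
  calc (R + 1).choose 2 = ∑ i ∈ Finset.range R, (R - i) := by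
        rw [Nat.choose_two_right, ← Finset.sum_range_id_mul_two, Nat.mul_div_cancel _ two_pos,
          ← Finset.sum_range_reflect, Finset.sum_range_succ]
        simp
    _ ≤ ∑ i ∈ Finset.range R, ∑ j, (if i < w (c j) then 1 else 0) := Finset.sum_le_sum h2
    _ = ∑ j, w (c j) := by
        rw [Finset.sum_comm]
        exact Finset.sum_congr rfl fun j _ => (h1 _).symm

/-- The Mahler expansion of `x ↦ C(x, k) * (1 + h) ^ x`. -/
theorem choose_mul_one_add_pow (h : ℤ) (k x T : ℕ) (hT : x < T) :
    (x.choose k : ℤ) * (1 + h) ^ x =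
      (1 + h) ^ k * ∑ j ∈ Finset.range T, (j.choose k : ℤ) * h ^ (j - k) * x.choose j := by
  obtain hxk | ⟨y, rfl⟩ := (lt_or_ge x k).imp_right Nat.exists_eq_add_of_le
  · rw [Nat.choose_eq_zero_of_lt hxk, Finset.sum_eq_zero]
    · simp
    · intro j _
      rcases lt_or_ge j k with h1 | h1
      · simp [Nat.choose_eq_zero_of_lt h1]
      · simp [Nat.choose_eq_zero_of_lt (hxk.trans_le h1)]
  · obtain ⟨z, rfl⟩ := Nat.exists_eq_add_of_lt hT
    rw [show k + y + z + 1 = k + (y + 1 + z) by ring, Finset.sum_range_add, Finset.sum_eq_zero,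
      zero_add, Finset.sum_range_add, add_comm 1 h, pow_add, add_pow h 1 y]
    · rw [Finset.sum_eq_zero (s := Finset.range z), add_zero]
      · rw [Finset.mul_sum, Finset.mul_sum, Finset.mul_sum]
        refine Finset.sum_congr rfl fun j hj => ?_
        have h1 := Nat.choose_mul (n := k + y) (k := k + j) (s := k) (by omega)
        rw [Nat.add_sub_cancel_left, Nat.add_sub_cancel_left] at h1
        have h2 : ((k + y).choose (k + j) : ℤ) * (k + j).choose k
          = (k + y).choose k * y.choose j := by exact_mod_cast h1
        rw [Nat.add_sub_cancel_left, one_pow]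
        linear_combination -(h + 1) ^ k * h ^ j * h2
      · intro j _
        rw [Nat.choose_eq_zero_of_lt (show k + y < k + (y + 1 + j) by omega)]
        simp
    · intro j hj
      rw [Nat.choose_eq_zero_of_lt (Finset.mem_range.1 hj)]
      simp

theorem exists_mahler_coeff {b H : ℤ} (hH : b ∣ H - 1) (k R : ℕ) :
    ∃ a : ℕ → ℤ, ∀ x : ℕ, ∃ e : ℤ,
      b ^ k * ((x.choose k : ℤ) * H ^ x) =
        ∑ t ∈ Finset.range R, b ^ t * a t * x.choose t + b ^ R * e := by
  obtain ⟨c, hc⟩ := hH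
  obtain rfl : H = 1 + b * c := by linarith
  refine ⟨fun j => (1 + b * c) ^ k * (j.choose k * c ^ (j - k)), fun x => ?_⟩
  have h1 : ∀ j : ℕ, b ^ k * ((j.choose k : ℤ) * (b * c) ^ (j - k)) =
      b ^ j * (j.choose k * c ^ (j - k)) := by
    intro j
    rcases lt_or_ge j k with h | h
    · simp [Nat.choose_eq_zero_of_lt h]
    · obtain ⟨i, rfl⟩ := Nat.exists_eq_add_of_le h
      rw [Nat.add_sub_cancel_left, mul_pow, pow_add]
      ring
  refine ⟨∑ i ∈ Finset.range (x + 1), b ^ i * ((1 + b * c) ^ k *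
    ((R + i).choose k * c ^ (R + i - k))) * x.choose (R + i), ?_⟩
  rw [choose_mul_one_add_pow (b * c) k x (R + (x + 1)) (by omega), Finset.sum_range_add, mul_add,
    mul_add, Finset.mul_sum, Finset.mul_sum, Finset.mul_sum, Finset.mul_sum, Finset.mul_sum]
  congr 1
  · refine Finset.sum_congr rfl fun j _ => ?_
    linear_combination (1 + b * c) ^ k * (x.choose j : ℤ) * h1 j
  · refine Finset.sum_congr rfl fun j _ => ?_
    have := h1 (R + j)
    rw [pow_add b R j] at this
    linear_combination (1 + b * c) ^ k * (x.choose (R + j) : ℤ) * this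

theorem pow_choose_two_dvd_det {K L R : ℕ} (hN : K * L = R + 1) {b G : ℤ} (hG : b ∣ G - 1)
    {x : Fin K × Fin L → ℕ} {y : Fin K × Fin L → ℤ} (hy : ∀ i, b ^ R ∣ y i - G ^ x i) :
    b ^ (K * L).choose 2 ∣ b ^ (L * K.choose 2) *
      (Matrix.of fun i j : Fin K × Fin L => ((x i).choose j.1 : ℤ) * y i ^ (j.2 : ℕ)).det := by
  have h1 : b ^ (L * K.choose 2) = ∏ j : Fin K × Fin L, b ^ (j.1 : ℕ) := by
    rw [Finset.prod_pow_eq_pow_sum, Fintype.sum_prod_type]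
    simp only [Finset.sum_const, Finset.card_univ, Fintype.card_fin, smul_eq_mul]
    rw [← Finset.mul_sum, Fin.sum_univ_eq_sum_range (fun i => i), Finset.sum_range_id,
      Nat.choose_two_right]
  rw [h1, ← Matrix.det_mul_row, hN]
  have h2 : ∀ j : Fin K × Fin L, ∃ a : ℕ → ℤ, ∀ i, ∃ e : ℤ,
      b ^ (j.1 : ℕ) * (((x i).choose j.1 : ℤ) * y i ^ (j.2 : ℕ)) =
        ∑ t ∈ Finset.range R, b ^ t * a t * (x i).choose t + b ^ R * e := by
    intro j
    have h3 : b ∣ G ^ (j.2 : ℕ) - 1 := by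
      simpa using hG.trans (sub_dvd_pow_sub_pow G 1 (j.2 : ℕ))
    obtain ⟨a, ha⟩ := exists_mahler_coeff h3 j.1 R
    refine ⟨a, fun i => ?_⟩
    obtain ⟨e, he⟩ := ha (x i)
    obtain ⟨d, hd⟩ := (hy i).trans (sub_dvd_pow_sub_pow (y i) (G ^ x i) (j.2 : ℕ))
    refine ⟨e + b ^ (j.1 : ℕ) * (x i).choose j.1 * d, ?_⟩
    rw [← pow_mul, mul_comm, pow_mul] at hd
    linear_combination he + b ^ (j.1 : ℕ) * ((x i).choose j.1 : ℤ) * hd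
  choose a e he using h2
  refine pow_dvd_det (τ := Fin R ⊕ (Fin K × Fin L))
    (w := Sum.elim (fun i => (i : ℕ)) (fun _ => R))
    (P := fun i => Sum.elim (fun t => ((x i).choose t : ℤ)) (fun j => e j i))
    (A := Sum.elim (fun t j => a j t) (fun j' j => if j' = j then 1 else 0))
    (fun i j => ?_) (fun c hc => choose_two_le_sum_elim (by simp [hN]) hc)
  simp only [Fintype.sum_sum_type, Sum.elim_inl, Sum.elim_inr, Matrix.of_apply, he, mul_ite,
    mul_one, mul_zero, ite_mul, zero_mul, Finset.sum_ite_eq', Finset.mem_univ, if_true]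
  rw [← Fin.sum_univ_eq_sum_range (fun t => b ^ t * a j t * ((x i).choose t : ℤ))]

theorem log_abs_det_le {K L : ℕ} (hK : 0 < K) (hL : 0 < L) {X Y : ℝ} (hX : 0 < X) (hY : 0 < Y)
    {x : Fin K × Fin L → ℕ} {y : Fin K × Fin L → ℤ} (hx : ∀ i, (x i : ℝ) ≤ X)
    (hy : ∀ i, (|y i| : ℝ) ≤ Y) {D : ℤ}
    (hD : D = (Matrix.of fun i j : Fin K × Fin L =>
      ((x i).choose j.1 : ℤ) * y i ^ (j.2 : ℕ)).det) (hD0 : D ≠ 0) :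
    2 * Real.log |D| ≤ K * L * (2 * Real.log (K * L) + (K - 1) * Real.log (2 * X / K) + K +
      (L - 1) * Real.log Y) := by
  have hK' : (0 : ℝ) < K := by exact_mod_cast hK
  have hL' : (0 : ℝ) < L := by exact_mod_cast hL
  set B : Fin K × Fin L → ℝ := fun j =>
    (2 * X / K) ^ (j.1 : ℕ) * Real.exp (K / 2) * Y ^ (j.2 : ℕ) with hB
  have hB0 : ∀ j, 0 < B j := fun j => by positivity
  have h1 : ∀ i j : Fin K × Fin L,
      |((((x i).choose j.1 : ℤ) * y i ^ (j.2 : ℕ) : ℤ) : ℝ)| ≤ B j := by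
    intro i j
    push_cast
    rw [abs_mul, abs_pow, Nat.abs_cast]
    refine mul_le_mul ?_ (pow_le_pow_left₀ (abs_nonneg _) (hy i) _) (by positivity)
      (by positivity)
    refine (Nat.choose_le_pow_div (j.1 : ℕ) (x i)).trans ?_
    have h2 := Real.pow_div_factorial_le_exp (x := K / 2) (by positivity) j.1
    have h3 : X ^ (j.1 : ℕ) / (j.1 : ℕ).factorial =
        (2 * X / K) ^ (j.1 : ℕ) * ((K / 2 : ℝ) ^ (j.1 : ℕ) / (j.1 : ℕ).factorial) := by
      rw [← mul_div_assoc, ← mul_pow]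
      congr 2
      field_simp
    calc (x i : ℝ) ^ (j.1 : ℕ) / (j.1 : ℕ).factorial
        ≤ X ^ (j.1 : ℕ) / (j.1 : ℕ).factorial := by gcongr; exact hx i
      _ ≤ _ := by rw [h3]; gcongr
  have h2 : |(D : ℝ)| ≤ (K * L).factorial * ∏ j, B j := by
    rw [hD, Matrix.det_apply, Int.cast_sum]
    refine (Finset.abs_sum_le_sum_abs _ _).trans ?_
    refine (Finset.sum_le_card_nsmul _ _ (∏ j, B j) fun σ _ => ?_).trans ?_
    · rw [Units.smul_def, smul_eq_mul, Int.cast_mul, abs_mul, ← Int.cast_abs,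
        Int.isUnit_iff_abs_eq.1 (Units.isUnit _), Int.cast_one, one_mul, Int.cast_prod,
        Finset.abs_prod]
      exact Finset.prod_le_prod (fun _ _ => abs_nonneg _) fun j _ => h1 (σ j) j
    · rw [Finset.card_univ, Fintype.card_perm, Fintype.card_prod, Fintype.card_fin,
        Fintype.card_fin, nsmul_eq_mul]
  have hD1 : (0 : ℝ) < |(D : ℝ)| := abs_pos.2 (by exact_mod_cast hD0)
  have h3 := Real.log_le_log hD1 h2
  have h4 : ((K * L).factorial : ℝ) ≤ (K * L : ℝ) ^ (K * L) := by
    exact_mod_cast Nat.factorial_le_pow (K * L)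
  have h5 := Real.log_le_log (by positivity) h4
  rw [Real.log_mul (by positivity) (Finset.prod_pos fun j _ => hB0 j).ne', Real.log_prod
    (fun j _ => (hB0 j).ne')] at h3
  rw [Real.log_pow] at h5
  have h6 : ∀ j, Real.log (B j) = (j.1 : ℕ) * Real.log (2 * X / K) + K / 2 +
      (j.2 : ℕ) * Real.log Y := by
    intro j
    rw [hB, Real.log_mul (by positivity) (by positivity), Real.log_mul (by positivity)
      (by positivity), Real.log_pow, Real.log_pow, Real.log_exp]
  have h7 : ∀ n : ℕ, ∑ i : Fin n, ((i : ℕ) : ℝ) = n * (n - 1) / 2 := by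
    intro n
    rw [Fin.sum_univ_eq_sum_range (fun i => (i : ℝ))]
    induction n with
    | zero => simp
    | succ n ih => rw [Finset.sum_range_succ, ih]; push_cast; ring
  have h8 : ∑ j, Real.log (B j) = L * (K * (K - 1) / 2 * Real.log (2 * X / K)) + K * L * (K / 2) +
      K * (L * (L - 1) / 2 * Real.log Y) := by
    simp only [h6, Fintype.sum_prod_type, Finset.sum_add_distrib, Finset.sum_const,
      Finset.card_univ, Fintype.card_fin, Fintype.card_prod, nsmul_eq_mul, ← Finset.sum_mul,
      ← Finset.mul_sum, h7]
    push_cast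
    ring
  rw [h8] at h3
  push_cast at h5
  linarith

open Polynomial in
/-- A zero estimate: a nonzero polynomial `∑ l, P l (x) * y ^ l` does not vanish on all the
points `(p * a + c s, g ^ a * d s)`. -/
theorem exists_sum_eval_ne_zero {F : Type*} [Field F] {K L A S : ℕ} {P : Fin L → F[X]}
    (hP : ∀ l, (P l).natDegree ≤ K) (hP0 : P ≠ 0) {p g : F} {c d : Fin S → F}
    (hd : ∀ s, d s ≠ 0) (hg0 : g ≠ 0) (hg : ∀ i < L, ∀ j < L, g ^ i = g ^ j → i = j)
    (hinj : Function.Injective fun z : Fin A × Fin S => p * (z.1 : ℕ) + c z.2)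
    (hcard : L * K < A * S) :
    ∃ a < A + L - 1, ∃ s, ∑ l : Fin L, (P l).eval (p * (a : ℕ) + c s) * (g ^ a * d s) ^ (l : ℕ)
      ≠ 0 := by
  classical
  by_contra! hvan
  let T := {l : Fin L // P l ≠ 0}
  obtain ⟨l₀, hl₀⟩ : ∃ l, P l ≠ 0 := Function.ne_iff.1 hP0
  have hn0 : 0 < Fintype.card T := Fintype.card_pos_iff.2 ⟨⟨l₀, hl₀⟩⟩
  have hnL : Fintype.card T ≤ L := (Fintype.card_subtype_le _).trans_eq (Fintype.card_fin L)
  let e : T ≃ Fin (Fintype.card T) := Fintype.equivFin T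
  obtain ⟨E, hE⟩ : ∃ E : Matrix T T F[X], ∀ i l, E i l = X ^ (K - (P l.1).natDegree) *
      (C ((g ^ (l.1 : ℕ)) ^ (e i : ℕ)) * taylor (p * (e i : ℕ)) (P l.1)) :=
    ⟨Matrix.of fun i l => _, fun i l => rfl⟩
  have hEdeg : ∀ i l, (E i l).natDegree ≤ K := by
    intro i l
    rw [hE]
    refine natDegree_mul_le.trans ?_
    rw [natDegree_X_pow]
    have h1 := (natDegree_C_mul_le ((g ^ (l.1 : ℕ)) ^ (e i : ℕ))
      (taylor (p * (e i : ℕ)) (P l.1))).trans_eq (natDegree_taylor _ _)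
    have h2 := hP l.1
    omega
  have hEcoeff : ∀ i l, (E i l).coeff K = (P l.1).leadingCoeff * (g ^ (l.1 : ℕ)) ^ (e i : ℕ) := by
    intro i l
    have h2 : K = (P l.1).natDegree + (K - (P l.1).natDegree) := by have := hP l.1; omega
    rw [hE]
    conv_lhs => rw [h2, Nat.add_sub_cancel_left]
    rw [coeff_X_pow_mul, coeff_C_mul, coeff_taylor_natDegree, mul_comm]
  have hdet : E.det = 0 := by
    by_contra hdet
    have h1 : E.det.natDegree ≤ Fintype.card T * K := by
      rw [Matrix.det_apply]
      refine natDegree_sum_le_of_forall_le _ _ fun σ _ => ?_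
      rw [Units.smul_def, zsmul_eq_mul]
      refine natDegree_mul_le.trans ?_
      rw [natDegree_intCast, zero_add]
      refine (natDegree_prod_le _ _).trans ?_
      refine (Finset.sum_le_card_nsmul _ _ K fun i _ => hEdeg _ _).trans_eq ?_
      rw [Finset.card_univ, smul_eq_mul]
    have h2 : ∀ z : Fin A × Fin S, E.det.IsRoot (p * (z.1 : ℕ) + c z.2) := by
      rintro ⟨a, s⟩
      have hroot : (E.map (eval (p * (a : ℕ) + c s))).det = 0 := by
        by_cases hx : ∃ l : T, (p * (a : ℕ) + c s) ^ (K - (P l.1).natDegree) = 0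
        · obtain ⟨l, hl⟩ := hx
          exact Matrix.det_eq_zero_of_column_eq_zero l fun i => by simp [hE, hl]
        push Not at hx
        refine Matrix.exists_mulVec_eq_zero_iff.1 ⟨fun l =>
          (g ^ (a : ℕ) * d s) ^ (l.1 : ℕ) / (p * (a : ℕ) + c s) ^ (K - (P l.1).natDegree), ?_, ?_⟩
        · intro h
          have h3 := congrFun h ⟨l₀, hl₀⟩
          exact div_ne_zero (pow_ne_zero _ (mul_ne_zero (pow_ne_zero _ hg0) (hd s)))
            (hx ⟨l₀, hl₀⟩) h3
        · ext i
          have hi := (e i).2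
          have h3 := hvan (a + e i) (by have := a.2; omega) s
          rw [← Finset.sum_filter_of_ne (p := fun l => P l ≠ 0) (fun l _ hl hPl => hl (by
            rw [hPl, eval_zero, zero_mul])), Finset.sum_subtype (p := fun l => P l ≠ 0)
            (Finset.univ.filter fun l => P l ≠ 0) (by simp)] at h3
          rw [Pi.zero_apply, ← h3]
          rw [Matrix.mulVec, dotProduct]
          refine Finset.sum_congr rfl fun l _ => ?_
          have h4 := hx l
          simp only [Matrix.map_apply, hE, eval_mul, eval_pow, eval_X, eval_C, taylor_eval]
          rw [Nat.cast_add, mul_add, add_right_comm]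
          field_simp
          ring
      rw [IsRoot, ← coe_evalRingHom, RingHom.map_det]
      exact hroot
    have h3 : (Finset.univ.image fun z : Fin A × Fin S => p * (z.1 : ℕ) + c z.2).card = A * S := by
      rw [Finset.card_image_of_injective _ hinj]; simp
    have h4 := card_le_degree_of_subset_roots (p := E.det)
      (Z := Finset.univ.image fun z : Fin A × Fin S => p * (z.1 : ℕ) + c z.2) (by
        intro x hx
        rw [Finset.mem_val, Finset.mem_image] at hx
        obtain ⟨z, -, rfl⟩ := hx
        exact (mem_roots hdet).2 (h2 z))
    have h5 := Nat.mul_le_mul_right K hnL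
    omega
  have hcoeff : E.det.coeff (Fintype.card T * K) =
      (Matrix.of fun i l : T => (P l.1).leadingCoeff * (g ^ (l.1 : ℕ)) ^ (e i : ℕ)).det := by
    rw [Matrix.det_apply, finsetSum_coeff, Matrix.det_apply]
    refine Finset.sum_congr rfl fun σ _ => ?_
    rw [Units.smul_def, Units.smul_def, coeff_smul]
    congr 1
    have h1 := coeff_prod_of_natDegree_le Finset.univ (fun i => E (σ i) i) K fun i _ => hEdeg _ _
    rw [Finset.card_univ] at h1
    exact h1.trans (Finset.prod_congr rfl fun i _ => hEcoeff _ _)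
  rw [hdet, coeff_zero] at hcoeff
  have h6 : (Matrix.of fun i l : T => (P l.1).leadingCoeff * (g ^ (l.1 : ℕ)) ^ (e i : ℕ)).det =
      (∏ l : T, (P l.1).leadingCoeff) *
        (Matrix.vandermonde fun l : Fin (Fintype.card T) => g ^ ((e.symm l).1 : ℕ)).det := by
    rw [← Matrix.det_transpose (Matrix.vandermonde _), ← Matrix.det_submatrix_equiv_self e,
      ← Matrix.det_mul_row]
    congr 1
    ext i l
    simp [Matrix.vandermonde_apply]
  rw [h6] at hcoeff
  refine mul_ne_zero (Finset.prod_ne_zero_iff.2 fun l _ => leadingCoeff_ne_zero.2 l.2)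
    (Matrix.det_vandermonde_ne_zero_iff.2 fun l l' h => ?_) hcoeff.symm
  have h7 := hg _ (e.symm l).1.2 _ (e.symm l').1.2 h
  exact e.symm.injective (Subtype.ext (Fin.ext h7))

open Polynomial in
theorem exists_det_ne_zero {K L A S : ℕ} {p : ℕ} {g : ℤ} {c : Fin S → ℕ} {d : Fin S → ℤ}
    (hd : ∀ s, d s ≠ 0) (hg : 1 < |g|)
    (hinj : Function.Injective fun z : Fin A × Fin S => p * (z.1 : ℕ) + c z.2)
    (hcard : L * (K - 1) < A * S) :
    ∃ r : Fin K × Fin L → Fin (A + L - 1) × Fin S,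
      (Matrix.of fun i j : Fin K × Fin L => (((p * (r i).1 + c (r i).2).choose j.1 : ℕ) : ℤ) *
        (g ^ ((r i).1 : ℕ) * d (r i).2) ^ (j.2 : ℕ)).det ≠ 0 := by
  have hg0 : g ≠ 0 := by rintro rfl; simp at hg
  let v : Fin (A + L - 1) × Fin S → Fin K × Fin L → ℚ := fun z j =>
    ((p * (z.1 : ℕ) + c z.2).choose j.1 : ℕ) * ((g : ℚ) ^ (z.1 : ℕ) * d z.2) ^ (j.2 : ℕ)
  have hspan : Submodule.span ℚ (Set.range v) = ⊤ := by
    by_contra hne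
    obtain ⟨f, hf0, hf⟩ := Submodule.exists_le_ker_of_lt_top _ (lt_top_iff_ne_top.2 hne)
    let e : Fin K × Fin L → ℚ := fun j => f (Pi.single j 1)
    have hfe : ∀ w, f w = ∑ j, w j * e j := fun w => by
      rw [LinearMap.pi_apply_eq_sum_univ f w]
      refine Finset.sum_congr rfl fun j _ => ?_
      rw [smul_eq_mul]
      congr 2
      ext i
      simp [Pi.single_apply, eq_comm]
    let P : Fin L → ℚ[X] := fun l =>
      ∑ k : Fin K, C (e (k, l) / (k : ℕ).factorial) * descPochhammer ℚ k
    have hPeval : ∀ l (x : ℕ), (P l).eval (x : ℚ) = ∑ k : Fin K, (x.choose k : ℚ) * e (k, l) := by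
      intro l x
      rw [eval_finsetSum]
      refine Finset.sum_congr rfl fun k _ => ?_
      have h0 : ((k : ℕ).factorial : ℚ) ≠ 0 := by exact_mod_cast Nat.factorial_ne_zero _
      rw [eval_C_mul, descPochhammer_eval_eq_descFactorial,
          Nat.descFactorial_eq_factorial_mul_choose]
      push_cast
      field_simp
    have hPdeg : ∀ l, (P l).natDegree ≤ K - 1 := fun l =>
      natDegree_sum_le_of_forall_le _ _ fun k _ =>
        (natDegree_C_mul_le _ _).trans (by rw [descPochhammer_natDegree]; have := k.2; omega)
    have hP0 : P ≠ 0 := by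
      intro h0
      apply hf0
      have he : ∀ n (h : n < K) l, e (⟨n, h⟩, l) = 0 := by
        intro n
        induction n using Nat.strong_induction_on with
        | _ n ih =>
          intro h l
          have h1 := hPeval l n
          rw [h0, Pi.zero_apply, eval_zero, Finset.sum_eq_single ⟨n, h⟩, Nat.choose_self] at h1
          · simpa using h1.symm
          · rintro ⟨k, hk⟩ - hkn
            have hkn' : k ≠ n := fun h => hkn (Fin.ext h)
            rcases lt_or_gt_of_ne hkn' with h2 | h2
            · rw [ih k h2 hk l, mul_zero]
            · rw [Nat.choose_eq_zero_of_lt h2, Nat.cast_zero, zero_mul]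
          · simp
      refine LinearMap.ext fun w => ?_
      rw [hfe, LinearMap.zero_apply]
      exact Finset.sum_eq_zero fun j _ => by rw [show e j = 0 from he j.1 j.1.2 j.2, mul_zero]
    obtain ⟨a, ha, s, has⟩ := exists_sum_eval_ne_zero (A := A) (p := (p : ℚ)) (g := (g : ℚ))
      (c := fun s => (c s : ℚ)) (d := fun s => (d s : ℚ)) hPdeg hP0
      (fun s => by exact_mod_cast hd s) (by exact_mod_cast hg0)
      (fun i _ j _ hij => by
        have h1 : |g| ^ i = |g| ^ j := by
          rw [← abs_pow, ← abs_pow]; congr 1; exact_mod_cast hij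
        exact Int.pow_right_injective (by omega) h1)
      (fun z z' h => hinj (by dsimp only at h ⊢; exact_mod_cast h)) hcard
    apply has
    have h1 : f (v (⟨a, ha⟩, s)) = 0 := hf (Submodule.subset_span ⟨_, rfl⟩)
    rw [hfe, Fintype.sum_prod_type, Finset.sum_comm] at h1
    rw [← h1]
    refine Finset.sum_congr rfl fun l _ => ?_
    have h2 := hPeval l (p * a + c s)
    push_cast at h2
    rw [h2, Finset.sum_mul]
    refine Finset.sum_congr rfl fun k _ => ?_
    simp only [v]
    ring
  obtain ⟨κ, r, -, hr, hli⟩ := exists_linearIndependent' ℚ v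
  rw [hspan] at hr
  let B := Module.Basis.mk hli hr.ge
  let ε : Fin K × Fin L ≃ κ := (Pi.basisFun ℚ (Fin K × Fin L)).indexEquiv B
  refine ⟨fun i => r (ε i), fun hdet => ?_⟩
  have h1 : LinearIndependent ℚ (Matrix.of fun i => v (r (ε i))).row :=
    hli.comp ε ε.injective
  rw [Matrix.linearIndependent_rows_iff_isUnit, Matrix.isUnit_iff_isUnit_det] at h1
  refine h1.ne_zero ?_
  have h2 := congrArg (Int.castRingHom ℚ) hdet
  rw [RingHom.map_det, map_zero] at h2
  rw [← h2]
  congr 1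
  ext i j
  simp [v]

theorem exists_one_add_pow_eq (u : ℤ) (d : ℕ) : ∃ w : ℤ, (1 + u) ^ d = 1 + d * u + u ^ 2 * w := by
  induction d with
  | zero => exact ⟨0, by simp⟩
  | succ d ih =>
    obtain ⟨w, hw⟩ := ih
    refine ⟨d + w + u * w, ?_⟩
    rw [pow_succ, hw]
    push_cast
    ring

theorem geom_sum₂_modEq {n a b : ℤ} (h : a ≡ b [ZMOD n]) (p : ℕ) :
    ∑ i ∈ range p, a ^ i * b ^ (p - 1 - i) ≡ p * b ^ (p - 1) [ZMOD n] := by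
  have h1 : ∀ i ∈ range p, a ^ i * b ^ (p - 1 - i) ≡ b ^ (p - 1) [ZMOD n] := by
    intro i hi
    have hi' : i + (p - 1 - i) = p - 1 := by have := mem_range.1 hi; omega
    calc a ^ i * b ^ (p - 1 - i) ≡ b ^ i * b ^ (p - 1 - i) [ZMOD n] := (h.pow i).mul_right _
      _ = b ^ (p - 1) := by rw [← pow_add, hi']
  have h2 : ∑ i ∈ range p, a ^ i * b ^ (p - 1 - i) ≡ ∑ _i ∈ range p, b ^ (p - 1) [ZMOD n] := by
    rw [Int.modEq_iff_dvd, ← sum_sub_distrib]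
    exact dvd_sum fun i hi => (h1 i hi).dvd
  simpa using h2

theorem sq_modEq_one_of_odd {a : ℤ} (ha : Odd a) : a ^ 2 ≡ 1 [ZMOD 8] := by
  obtain ⟨t, rfl⟩ := ha
  obtain ⟨w, hw⟩ := Int.even_mul_succ_self t
  exact (Int.modEq_iff_dvd.2 ⟨w, by linear_combination 4 * hw⟩).symm

theorem pow_modEq_self_of_odd {a : ℤ} (ha : Odd a) {p : ℕ} (hp : Odd p) : a ^ p ≡ a [ZMOD 8] := by
  obtain ⟨t, rfl⟩ := hp
  have := ((sq_modEq_one_of_odd ha).pow t).mul_right a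
  rw [← pow_mul, ← pow_succ] at this
  simpa using this

/-- If the ratio of the `p`-th powers of two odd integers is `(1 + 2 ^ h X) ^ d` modulo
`2 ^ (h + 3)`, then their difference is `2 ^ h D` with `D` known modulo `8`. -/
theorem exists_sub_eq_two_pow_mul {p h X : ℕ} (hp : Odd p) (hh : 3 ≤ h) {a b : ℤ} (ha : Odd a)
    (hb : Odd b) (d : ℕ) (H : a ^ p ≡ b ^ p * (2 ^ h * X + 1) ^ d [ZMOD 2 ^ (h + 3)]) :
    ∃ D : ℤ, a - b = 2 ^ h * D ∧ D ≡ b * X * p * d [ZMOD 8] := by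
  have hG := (Commute.all a b).geom_sum₂_mul p
  set G := ∑ i ∈ range p, a ^ i * b ^ (p - 1 - i) with hGdef
  have hpz : Odd (p : ℤ) := by exact_mod_cast hp
  have hab2 : a ≡ b [ZMOD 2] := by
    rw [Int.ModEq, Int.odd_iff.1 ha, Int.odd_iff.1 hb]
  have hGodd : Odd G := by
    have h1 := geom_sum₂_modEq hab2 p
    rw [← hGdef] at h1
    have h2 : Odd ((p : ℤ) * b ^ (p - 1)) := hpz.mul hb.pow
    rw [Int.odd_iff] at h2 ⊢
    rw [← h2]; exact h1
  obtain ⟨w, hw⟩ := exists_one_add_pow_eq (2 ^ h * X) d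
  have hmod : G * (a - b) ≡ 2 ^ h * (b ^ p * X * d) [ZMOD 2 ^ (h + 3)] := by
    rw [hG]
    have h3 : a ^ p - b ^ p ≡ b ^ p * (2 ^ h * X + 1) ^ d - b ^ p [ZMOD 2 ^ (h + 3)] :=
      H.sub_right _
    refine h3.trans ?_
    rw [add_comm ((2 : ℤ) ^ h * X) 1, hw, Int.modEq_iff_dvd]
    obtain ⟨g, rfl⟩ := Nat.exists_eq_add_of_le hh
    refine ⟨-(b ^ p * 2 ^ g * X ^ 2 * w), ?_⟩
    ring
  have hdvd : (2 : ℤ) ^ h ∣ a - b := by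
    have h4 : (2 : ℤ) ^ h ∣ G * (a - b) := by
      have h5 := (hmod.of_dvd (pow_dvd_pow 2 (Nat.le_add_right h 3))).dvd
      rw [dvd_sub_right (Dvd.intro _ rfl)] at h5
      exact h5
    refine IsCoprime.dvd_of_dvd_mul_left ?_ h4
    exact IsCoprime.pow_left (Int.isCoprime_two_left.2 hGodd)
  obtain ⟨D, hD⟩ := hdvd
  refine ⟨D, hD, ?_⟩
  have hab8 : a ≡ b [ZMOD 8] := by
    refine (Int.modEq_iff_dvd.2 ?_).symm
    rw [hD]
    exact Dvd.dvd.mul_right ((by norm_num : (8 : ℤ) = 2 ^ 3) ▸ pow_dvd_pow 2 hh) D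
  have hG8 : G ≡ p [ZMOD 8] := by
    have h1 := geom_sum₂_modEq hab8 p
    rw [← hGdef] at h1
    refine h1.trans ?_
    obtain ⟨t, ht⟩ := hp
    have : p - 1 = 2 * t := by omega
    have h2 := ((sq_modEq_one_of_odd hb).pow t).mul_left (p : ℤ)
    rw [← pow_mul, ← this] at h2
    simpa using h2
  have hDG : D * G ≡ b ^ p * X * d [ZMOD 8] := by
    rw [hD, pow_add] at hmod
    have h1 : (2 : ℤ) ^ h * (D * G) ≡ 2 ^ h * (b ^ p * X * d) [ZMOD 2 ^ h * 2 ^ 3] := by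
      convert hmod using 1; ring
    have h2 := Int.ModEq.dvd h1
    rw [← mul_sub] at h2
    exact Int.modEq_iff_dvd.2 ((mul_dvd_mul_iff_left (by positivity)).1 h2)
  have h6 : D * p ≡ b * X * d [ZMOD 8] :=
    ((hG8.mul_left D).symm.trans hDG).trans
      (((pow_modEq_self_of_odd hb hp).mul_right _).mul_right _)
  calc D = D * 1 := (mul_one D).symm
    _ ≡ D * p ^ 2 [ZMOD 8] := (sq_modEq_one_of_odd hpz).symm.mul_left D
    _ = D * p * p := by ring
    _ ≡ b * X * d * p [ZMOD 8] := h6.mul_right _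
    _ = b * X * p * d := by ring

/-- The quadratic reciprocity sign of two odd integers. -/
def recipSign (a b : ℤ) : ℤ := if a % 4 = 3 ∧ b % 4 = 3 then -1 else 1

theorem jacobiSym_neg_left (a : ℤ) {b : ℤ} (hb : Odd b) :
    J(-a | b.natAbs) = (if b.natAbs % 4 = 3 then -1 else 1) * J(a | b.natAbs) := by
  have hb' := Int.natAbs_odd.2 hb
  rw [jacobiSym.neg _ hb', ZMod.χ₄_nat_eq_if_mod_four]
  have h1 : b.natAbs % 2 ≠ 0 := by have := Nat.odd_iff.1 hb'; omega
  rw [if_neg h1]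
  have h2 : b.natAbs % 4 = 1 ∨ b.natAbs % 4 = 3 := by omega
  rcases h2 with h2 | h2 <;> simp [h2]

theorem jacobiSym_natAbs_comm {a b : ℤ} (ha : Odd a) (hb : Odd b) :
    J(a | b.natAbs) =
      (if a < 0 ∧ b < 0 then -1 else 1) * recipSign a b * J(b | a.natAbs) := by
  have ha' := Int.odd_iff.1 ha
  have hb' := Int.odd_iff.1 hb
  have hR := @jacobiSym.quadratic_reciprocity_if a.natAbs b.natAbs (by omega) (by omega)
  have hN1 := jacobiSym_neg_left (a.natAbs : ℤ) hb
  have hN2 := jacobiSym_neg_left (b.natAbs : ℤ) ha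
  unfold recipSign
  rcases lt_or_gt_of_ne (show a ≠ 0 by rintro rfl; simp at ha') with ha0 | ha0 <;>
  rcases lt_or_gt_of_ne (show b ≠ 0 by rintro rfl; simp at hb') with hb0 | hb0
  · obtain ⟨u, hu⟩ : ∃ u : ℕ, a.natAbs = u := ⟨_, rfl⟩
    obtain ⟨v, hv⟩ : ∃ v : ℕ, b.natAbs = v := ⟨_, rfl⟩
    have e1 : a = -(u : ℤ) := by omega
    have e2 : b = -(v : ℤ) := by omega
    rw [hu, hv] at hR hN1 hN2 ⊢
    rw [e1, e2, hN1, hN2, ← hR]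
    split_ifs <;> omega
  · obtain ⟨u, hu⟩ : ∃ u : ℕ, a.natAbs = u := ⟨_, rfl⟩
    obtain ⟨v, hv⟩ : ∃ v : ℕ, b.natAbs = v := ⟨_, rfl⟩
    have e1 : a = -(u : ℤ) := by omega
    have e2 : b = (v : ℤ) := by omega
    rw [hu, hv] at hR hN1 hN2 ⊢
    rw [e1, e2, hN1, ← hR]
    split_ifs <;> omega
  · obtain ⟨u, hu⟩ : ∃ u : ℕ, a.natAbs = u := ⟨_, rfl⟩
    obtain ⟨v, hv⟩ : ∃ v : ℕ, b.natAbs = v := ⟨_, rfl⟩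
    have e1 : a = (u : ℤ) := by omega
    have e2 : b = -(v : ℤ) := by omega
    rw [hu, hv] at hR hN1 hN2 ⊢
    rw [e1, e2, hN2, ← hR]
    split_ifs <;> omega
  · obtain ⟨u, hu⟩ : ∃ u : ℕ, a.natAbs = u := ⟨_, rfl⟩
    obtain ⟨v, hv⟩ : ∃ v : ℕ, b.natAbs = v := ⟨_, rfl⟩
    have e1 : a = (u : ℤ) := by omega
    have e2 : b = (v : ℤ) := by omega
    rw [hu, hv] at hR ⊢
    rw [e1, e2, ← hR]
    split_ifs <;> omega

theorem jacobiSym_mul_comm {a b c d : ℤ} (ha : Odd a) (hb : Odd b) (hc : Odd c) (hd : Odd d)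
    (hac : a < 0 ↔ c < 0) (hbd : b < 0 ↔ d < 0) :
    J(a | b.natAbs) * J(c | d.natAbs) =
      recipSign a b * recipSign c d * (J(b | a.natAbs) * J(d | c.natAbs)) := by
  rw [jacobiSym_natAbs_comm ha hb, jacobiSym_natAbs_comm hc hd]
  simp only [hac, hbd]
  split_ifs <;> ring
/-- A solution of `m ^ p + 2 ^ q = 3 ^ q`, with the parity conditions that are automatic when
`p ≥ 2`, together with an even auxiliary exponent `j` for which `3 ^ j = 2 ^ h * X + 1`. -/
structure LatticeData (p q m j h X : ℕ) : Prop where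
  odd_p : Odd p
  three_le_p : 3 ≤ p
  odd_q : Odd q
  eq : m ^ p + 2 ^ q = 3 ^ q
  m_mod_eight : m % 8 = 3
  m_mod_three : m % 3 = 1
  even_j : Even j
  two_le_j : 2 ≤ j
  pow_j : 3 ^ j = 2 ^ h * X + 1
  odd_X : Odd X
  three_le_h : 3 ≤ h
  h_add_le : h + 3 ≤ q
  mul_lt : j * p < q

/-- The quotient of `3 ^ s - m ^ k` by `2 ^ h`. -/
def cofactor (m h s k : ℕ) : ℤ := (3 ^ s - (m : ℤ) ^ k) / 2 ^ h

/-- The sign of an odd integer modulo four. -/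
def signModFour (a : ℤ) : ℤ := if a % 4 = 3 then -1 else 1

theorem mul_pow_lt_pow {p : ℕ} (hp : 3 ≤ p) : 3 * (p ^ 2 + p) * 4 ^ p < 4 * 9 ^ p := by
  induction p, hp using Nat.le_induction with
  | base => norm_num
  | succ n hn ih =>
    have h1 : 3 * ((n + 1) ^ 2 + (n + 1)) * 4 ≤ 9 * (3 * (n ^ 2 + n)) := by nlinarith
    calc 3 * ((n + 1) ^ 2 + (n + 1)) * 4 ^ (n + 1)
        = 3 * ((n + 1) ^ 2 + (n + 1)) * 4 * 4 ^ n := by ring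
      _ ≤ 9 * (3 * (n ^ 2 + n)) * 4 ^ n := Nat.mul_le_mul_right _ h1
      _ = 9 * (3 * (n ^ 2 + n) * 4 ^ n) := by ring
      _ < 9 * (4 * 9 ^ n) := by omega
      _ = 4 * 9 ^ (n + 1) := by ring

theorem mul_two_pow_lt {p q : ℕ} (hp : 3 ≤ p) (hq : 2 * p + 1 ≤ q) :
    9 * (p ^ 2 + p) * 2 ^ q < 8 * 3 ^ q := by
  obtain ⟨t, rfl⟩ := Nat.exists_eq_add_of_le hq
  have h1 := mul_pow_lt_pow hp
  have e1 : 2 ^ (2 * p + 1 + t) = 4 ^ p * 2 * 2 ^ t := by rw [pow_add, pow_succ, pow_mul]; norm_num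
  have e2 : 3 ^ (2 * p + 1 + t) = 9 ^ p * 3 * 3 ^ t := by rw [pow_add, pow_succ, pow_mul]; norm_num
  rw [e1, e2]
  have h2 : 2 ^ t ≤ 3 ^ t := Nat.pow_le_pow_left (by norm_num) t
  calc 9 * (p ^ 2 + p) * (4 ^ p * 2 * 2 ^ t) = 6 * (3 * (p ^ 2 + p) * 4 ^ p) * 2 ^ t := by ring
    _ < 6 * (4 * 9 ^ p) * 2 ^ t := by
      apply Nat.mul_lt_mul_of_pos_right _ (by positivity); omega
    _ ≤ 6 * (4 * 9 ^ p) * 3 ^ t := Nat.mul_le_mul_left _ h2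
    _ = 8 * (9 ^ p * 3 * 3 ^ t) := by ring

variable {p q m j h X : ℕ}

namespace LatticeData

theorem odd_m (H : LatticeData p q m j h X) : Odd (m : ℤ) := by
  have := H.m_mod_eight
  rw [Int.odd_iff]; omega

theorem two_mul_lt (H : LatticeData p q m j h X) : 2 * p + 1 ≤ q := by
  have h1 := H.mul_lt
  have := Nat.mul_le_mul_right p H.two_le_j
  omega

theorem isCoprime_three_m (H : LatticeData p q m j h X) : IsCoprime (3 : ℤ) m := by
  have := H.m_mod_three
  refine (Int.prime_three.coprime_iff_not_dvd).2 fun hd => ?_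
  omega

theorem pow_lt_pow_of_pos (H : LatticeData p q m j h X) {s k : ℕ} {d : ℤ} (hd : 0 < d)
    (hv : (s : ℤ) * p - k * q = j * d) : m ^ k < 3 ^ s := by
  have hm : m ^ p ≤ 3 ^ q := H.eq ▸ Nat.le_add_right _ _
  have h1 : k * q < s * p := by
    have hj : 0 < (j : ℤ) * d := mul_pos (by have := H.two_le_j; omega) hd
    zify; linarith
  refine lt_of_pow_lt_pow_left₀ p (by positivity) ?_
  calc (m ^ k) ^ p = (m ^ p) ^ k := by rw [← pow_mul, ← pow_mul, mul_comm]
    _ ≤ (3 ^ q) ^ k := Nat.pow_le_pow_left hm k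
    _ = 3 ^ (k * q) := by rw [← pow_mul, mul_comm]
    _ < 3 ^ (s * p) := Nat.pow_lt_pow_right (by norm_num) h1
    _ = (3 ^ s) ^ p := pow_mul _ _ _

theorem three_pow_lt (H : LatticeData p q m j h X) {k : ℕ} (hk : k ≤ p ^ 2 + p) :
    (3 ^ q) ^ k < 9 * (m ^ p) ^ k := by
  have h1 := mul_two_pow_lt H.three_le_p H.two_mul_lt
  have h2 : (9 * k * 2 ^ q : ℝ) < 8 * 3 ^ q := by
    have : 9 * k * 2 ^ q ≤ 9 * (p ^ 2 + p) * 2 ^ q := by gcongr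
    exact_mod_cast this.trans_lt h1
  have h3 : (1 : ℝ) + k * (-(2 ^ q / 3 ^ q)) ≤ (1 + -(2 ^ q / 3 ^ q)) ^ k := by
    apply one_add_mul_le_pow
    have : (2 : ℝ) ^ q / 3 ^ q ≤ 1 := by
      rw [div_le_one (by positivity)]
      exact pow_le_pow_left₀ (by norm_num) (by norm_num) q
    linarith
  have h4 : (m : ℝ) ^ p = 3 ^ q * (1 + -(2 ^ q / 3 ^ q)) := by
    have : (m : ℝ) ^ p + 2 ^ q = 3 ^ q := by exact_mod_cast H.eq
    field_simp
    linarith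
  have h5 : (k : ℝ) * (2 ^ q / 3 ^ q) < 8 / 9 := by
    rw [← mul_div_assoc, div_lt_div_iff₀ (by positivity) (by norm_num)]
    linarith
  have h6 : ((3 : ℝ) ^ q) ^ k < 9 * ((m : ℝ) ^ p) ^ k := by
    rw [h4, mul_pow]
    have h7 : (0 : ℝ) < (3 ^ q) ^ k := by positivity
    nlinarith
  exact_mod_cast h6

theorem pow_lt_pow_of_neg (H : LatticeData p q m j h X) {s k : ℕ} {d : ℤ} (hd : d < 0)
    (hv : (s : ℤ) * p - k * q = j * d) (hk : k ≤ p ^ 2 + p) : 3 ^ s < m ^ k := by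
  have h1 : s * p + 2 ≤ k * q := by
    have hj := H.two_le_j
    have : (j : ℤ) * d ≤ -2 := by nlinarith
    zify; linarith
  refine lt_of_pow_lt_pow_left₀ p (by positivity) ?_
  have h2 := H.three_pow_lt hk
  have h3 : 9 * (3 ^ s) ^ p ≤ (3 ^ q) ^ k := by
    calc 9 * (3 ^ s) ^ p = 3 ^ (s * p + 2) := by rw [← pow_mul, pow_add]; ring
      _ ≤ 3 ^ (k * q) := Nat.pow_le_pow_right (by norm_num) h1
      _ = (3 ^ q) ^ k := by rw [← pow_mul, mul_comm]
  have h4 : (m ^ k) ^ p = (m ^ p) ^ k := by rw [← pow_mul, ← pow_mul, mul_comm]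
  omega

theorem three_pow_modEq (H : LatticeData p q m j h X) :
    (3 : ℤ) ^ q ≡ m ^ p [ZMOD 2 ^ (h + 3)] := by
  have h1 : (m : ℤ) ^ p + 2 ^ q = 3 ^ q := by exact_mod_cast H.eq
  rw [← h1, Int.modEq_iff_dvd]
  have : (2 : ℤ) ^ (h + 3) ∣ 2 ^ q := pow_dvd_pow 2 H.h_add_le
  simpa using this

theorem exists_cofactor (H : LatticeData p q m j h X) {s k : ℕ} {d : ℤ}
    (hv : (s : ℤ) * p - k * q = j * d) :
    ∃ D : ℤ, (3 : ℤ) ^ s - m ^ k = 2 ^ h * D ∧ D ≡ 3 ^ k * X * p * d [ZMOD 8] := by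
  have h3m : (m : ℤ) ≡ 3 [ZMOD 8] := by
    have := H.m_mod_eight
    rw [Int.ModEq]; omega
  have hodd3 : Odd ((3 : ℤ) ^ s) := Odd.pow (by decide)
  have hoddm : Odd ((m : ℤ) ^ k) := H.odd_m.pow
  have hj : (2 : ℤ) ^ h * X + 1 = 3 ^ j := by exact_mod_cast H.pow_j.symm
  have hq3 := H.three_pow_modEq
  rcases le_total 0 d with hd | hd
  · lift d to ℕ using hd
    have hsp : s * p = q * k + j * d := by zify; linarith
    obtain ⟨D, h1, h2⟩ := exists_sub_eq_two_pow_mul (X := X) H.odd_p H.three_le_h hodd3 hoddm d (by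
      rw [hj, ← pow_mul 3 s, ← pow_mul 3 j, hsp, pow_add 3, pow_mul 3 q, ← pow_mul (m : ℤ) k,
        mul_comm k p, pow_mul (m : ℤ)]
      exact (hq3.pow k).mul_right _)
    refine ⟨D, h1, h2.trans ?_⟩
    exact (((h3m.pow k).mul_right _).mul_right _).mul_right _
  · obtain ⟨e, rfl⟩ : ∃ e : ℕ, d = -(e : ℤ) := ⟨d.natAbs, by omega⟩
    have hsp : q * k = s * p + j * e := by zify; linarith
    obtain ⟨D, h1, h2⟩ := exists_sub_eq_two_pow_mul (X := X) H.odd_p H.three_le_h hoddm hodd3 e (by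
      rw [hj, ← pow_mul 3 s, ← pow_mul 3 j, ← pow_add 3, ← hsp, pow_mul 3 q, ← pow_mul (m : ℤ) k,
        mul_comm k p, pow_mul (m : ℤ)]
      exact (hq3.symm.pow k))
    refine ⟨-D, by linarith, ?_⟩
    have h4 : (3 : ℤ) ^ s ≡ 3 ^ k [ZMOD 8] := by
      have h5 : (2 : ℤ) ^ h * D ≡ 0 [ZMOD 8] := by
        rw [Int.modEq_zero_iff_dvd]
        exact Dvd.dvd.mul_right ((by norm_num : (8 : ℤ) = 2 ^ 3) ▸ pow_dvd_pow 2 H.three_le_h) D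
      have h6 : (m : ℤ) ^ k ≡ 3 ^ s [ZMOD 8] := by
        refine (Int.modEq_iff_dvd.2 ?_).symm
        rw [h1]; exact Int.modEq_zero_iff_dvd.1 h5
      exact h6.symm.trans (h3m.pow k)
    have h7 := (h2.trans (((h4.mul_right _).mul_right _).mul_right _)).neg
    convert h7 using 1
    ring

theorem two_pow_mul_cofactor (H : LatticeData p q m j h X) {s k : ℕ} {d : ℤ}
    (hv : (s : ℤ) * p - k * q = j * d) :
    2 ^ h * cofactor m h s k = 3 ^ s - (m : ℤ) ^ k := by
  obtain ⟨D, h1, -⟩ := H.exists_cofactor hv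
  rw [cofactor, Int.mul_ediv_cancel' ⟨D, h1⟩]

theorem cofactor_modEq (H : LatticeData p q m j h X) {s k : ℕ} {d : ℤ}
    (hv : (s : ℤ) * p - k * q = j * d) :
    cofactor m h s k ≡ 3 ^ k * X * p * d [ZMOD 8] := by
  obtain ⟨D, h1, h2⟩ := H.exists_cofactor hv
  rwa [cofactor, h1, Int.mul_ediv_cancel_left _ (by positivity)]

theorem cofactor_odd (H : LatticeData p q m j h X) {s k : ℕ} {d : ℤ}
    (hv : (s : ℤ) * p - k * q = j * d) (hd : Odd d) : Odd (cofactor m h s k) := by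
  have h1 := (H.cofactor_modEq hv).of_dvd (by norm_num : (2 : ℤ) ∣ 8)
  have h2 : Odd ((3 : ℤ) ^ k * X * p * d) :=
    (((Odd.pow (by decide)).mul (by exact_mod_cast H.odd_X)).mul (by exact_mod_cast H.odd_p)).mul hd
  rw [Int.odd_iff] at h2 ⊢
  rw [← h2]; exact h1

theorem cofactor_neg_iff (H : LatticeData p q m j h X) {s k : ℕ} {d : ℤ}
    (hv : (s : ℤ) * p - k * q = j * d) (hd : Odd d) (hk : k ≤ p ^ 2 + p) :
    cofactor m h s k < 0 ↔ d < 0 := by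
  have h1 := H.two_pow_mul_cofactor hv
  have h2 : (0 : ℤ) < 2 ^ h := by positivity
  rcases lt_or_gt_of_ne (show d ≠ 0 by rintro rfl; simp at hd) with h0 | h0
  · have h3 : (3 : ℤ) ^ s < m ^ k := by exact_mod_cast H.pow_lt_pow_of_neg h0 hv hk
    have : cofactor m h s k < 0 := by
      by_contra hc
      have := mul_nonneg h2.le (not_lt.1 hc)
      linarith
    simp [h0, this]
  · have h3 : (m : ℤ) ^ k < 3 ^ s := by exact_mod_cast H.pow_lt_pow_of_pos h0 hv
    have : 0 < cofactor m h s k := by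
      by_contra hc
      have := mul_nonpos_of_nonneg_of_nonpos h2.le (not_lt.1 hc)
      linarith
    constructor <;> intro <;> omega

end LatticeData

theorem jacobiSym_congr {a b c : ℤ} (hc : c ∣ a - b) : J(a | c.natAbs) = J(b | c.natAbs) := by
  exact jacobiSym.mod_left' (Int.modEq_iff_dvd.2 (Int.natAbs_dvd.2 hc)).symm

theorem jacobiSym_even_pow_mul {a b c : ℤ} {n : ℕ} (hn : Even n) (hac : IsCoprime a c) :
    J(a ^ n * b | c.natAbs) = J(b | c.natAbs) := by
  have h1 : a.gcd (c.natAbs : ℤ) = 1 := by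
    have := Int.isCoprime_iff_gcd_eq_one.1 hac
    simpa [Int.gcd_eq_natAbs, Int.natAbs_abs] using this
  obtain ⟨t, rfl⟩ := hn
  rw [jacobiSym.mul_left, ← two_mul, pow_mul, jacobiSym.pow_left, jacobiSym.sq_one' h1, one_pow,
    one_mul]

theorem jacobiSym_odd_pow_mul {a b c : ℤ} {n : ℕ} (hn : Odd n) (hac : IsCoprime a c) :
    J(a ^ n * b | c.natAbs) = J(a * b | c.natAbs) := by
  obtain ⟨t, rfl⟩ := hn
  rw [pow_succ, mul_assoc, jacobiSym_even_pow_mul (even_two_mul t) hac]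

namespace LatticeData

theorem isCoprime_three_cofactor (H : LatticeData p q m j h X) {s k : ℕ} {d : ℤ}
    (hv : (s : ℤ) * p - k * q = j * d) (hs : s ≠ 0) : IsCoprime 3 (cofactor m h s k) := by
  have h1 : IsCoprime (3 : ℤ) (2 ^ h * cofactor m h s k) := by
    rw [H.two_pow_mul_cofactor hv, sub_eq_neg_add]
    obtain ⟨t, rfl⟩ := Nat.exists_eq_succ_of_ne_zero hs
    rw [pow_succ']
    exact (IsCoprime.pow_right H.isCoprime_three_m).neg_right.add_mul_left_right _
  exact h1.of_mul_right_right

theorem isCoprime_m_cofactor (H : LatticeData p q m j h X) {s k : ℕ} {d : ℤ}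
    (hv : (s : ℤ) * p - k * q = j * d) (hk : k ≠ 0) : IsCoprime (m : ℤ) (cofactor m h s k) := by
  have h1 : IsCoprime (m : ℤ) (2 ^ h * cofactor m h s k) := by
    rw [H.two_pow_mul_cofactor hv, sub_eq_add_neg]
    obtain ⟨t, rfl⟩ := Nat.exists_eq_succ_of_ne_zero hk
    rw [pow_succ', ← mul_neg]
    exact (IsCoprime.pow_right H.isCoprime_three_m.symm).add_mul_left_right _
  exact h1.of_mul_right_right

theorem cofactor_dvd_of_two_pow_mul (H : LatticeData p q m j h X) {s k : ℕ} {d x : ℤ}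
    (hv : (s : ℤ) * p - k * q = j * d) (hx : (3 : ℤ) ^ s - (m : ℤ) ^ k ∣ 2 ^ h * x) :
    cofactor m h s k ∣ x := by
  rw [← H.two_pow_mul_cofactor hv] at hx
  exact (mul_dvd_mul_iff_left (by positivity)).1 hx

theorem jacobiSym_cofactor_add (H : LatticeData p q m j h X) {s k s' k' : ℕ} {d d' : ℤ}
    (hv : (s : ℤ) * p - k * q = j * d) (hv' : (s' : ℤ) * p - k' * q = j * d') (hs : s ≠ 0) :
    J(cofactor m h (s' + 2 * s) (k' + 2 * k) | (cofactor m h s k).natAbs) =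
      J(cofactor m h s' k' | (cofactor m h s k).natAbs) := by
  rw [← jacobiSym_even_pow_mul (b := cofactor m h s' k') (even_two_mul s)
    (H.isCoprime_three_cofactor hv hs)]
  refine jacobiSym_congr (H.cofactor_dvd_of_two_pow_mul hv ?_)
  have hw : ((s' + 2 * s : ℕ) : ℤ) * p - (k' + 2 * k : ℕ) * q = j * (d' + 2 * d) := by
    push_cast; linear_combination hv' + 2 * hv
  have h1 := H.two_pow_mul_cofactor hv'
  have h2 := H.two_pow_mul_cofactor hw
  refine ⟨(m : ℤ) ^ k' * (3 ^ s + m ^ k), ?_⟩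
  rw [mul_comm 2 s, mul_comm 2 k, pow_add, pow_add, pow_mul, pow_mul] at h2
  rw [mul_sub, mul_comm 2 s, mul_comm 2 k, pow_mul]
  linear_combination h2 - (3 ^ s) ^ 2 * h1

theorem jacobiSym_cofactor_reflect (H : LatticeData p q m j h X) {s k s' k' s'' k'' : ℕ}
    {d d' : ℤ} (hv : (s : ℤ) * p - k * q = j * d) (hv' : (s' : ℤ) * p - k' * q = j * d')
    (hs : s ≠ 0) (hss : s'' + s' = 2 * s) (hkk : k'' + k' = 2 * k) :
    J((3 : ℤ) ^ s' * ((m : ℤ) ^ k' * cofactor m h s'' k'') | (cofactor m h s k).natAbs) =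
      J(-cofactor m h s' k' | (cofactor m h s k).natAbs) := by
  rw [← jacobiSym_even_pow_mul (b := -cofactor m h s' k') (even_two_mul s)
    (H.isCoprime_three_cofactor hv hs)]
  refine jacobiSym_congr (H.cofactor_dvd_of_two_pow_mul hv ?_)
  have hw : (s'' : ℤ) * p - k'' * q = j * (2 * d - d') := by
    have e1 : (s'' : ℤ) = 2 * s - s' := by omega
    have e2 : (k'' : ℤ) = 2 * k - k' := by omega
    rw [e1, e2]; linear_combination 2 * hv - hv'
  have h1 := H.two_pow_mul_cofactor hv'
  have h2 := H.two_pow_mul_cofactor hw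
  have h3 : (3 : ℤ) ^ s'' * 3 ^ s' = (3 ^ s) ^ 2 := by rw [← pow_add, hss, mul_comm, pow_mul]
  have h4 : (m : ℤ) ^ k'' * m ^ k' = (m ^ k) ^ 2 := by rw [← pow_add, hkk, mul_comm, pow_mul]
  refine ⟨(3 : ℤ) ^ s' * (3 ^ s + m ^ k), ?_⟩
  rw [mul_comm 2 s, pow_mul]
  linear_combination 3 ^ s' * (m : ℤ) ^ k' * h2 + (3 ^ s) ^ 2 * h1 + (m : ℤ) ^ k' * h3
    - 3 ^ s' * h4

/-- The symbol of `3 * m` modulo the cofactor of a pair of positive even exponents. -/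
theorem jacobiSym_three_mul_m (H : LatticeData p q m j h X) {s k : ℕ} {d : ℤ}
    (hv : (s : ℤ) * p - k * q = j * d) (hd : Odd d) (hse : Even s) (hs : s ≠ 0) (hk : k ≠ 0) :
    J(3 * m | (cofactor m h s k).natAbs) = -1 := by
  have hm8 := H.m_mod_eight
  have hm3 := H.m_mod_three
  set D := cofactor m h s k with hD
  have hDo : Odd D := H.cofactor_odd hv hd
  have hodd := Int.natAbs_odd.2 hDo
  have hmod : (3 * m) % 4 = 1 := by omega
  have hodd3m : Odd (3 * m) := by rw [Nat.odd_iff]; omega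
  have h0 : J((3 * m : ℕ) | D.natAbs) = J((D.natAbs : ℤ) | 3 * m) :=
    jacobiSym.quadratic_reciprocity_one_mod_four hmod hodd
  have hneg : J(-1 | 3 * m) = 1 := by
    rw [jacobiSym.at_neg_one hodd3m, ZMod.χ₄_nat_one_mod_four hmod]
  have h1 : J((D.natAbs : ℤ) | 3 * m) = J(D | 3 * m) := by
    rcases Int.natAbs_eq D with e | e
    · rw [← e]
    · conv_rhs => rw [e, ← neg_one_mul, jacobiSym.mul_left, hneg, one_mul]
  have h2m : J(2 | m) = -1 := by
    rw [jacobiSym.at_two (by rw [Nat.odd_iff]; omega), ZMod.χ₈_nat_eq_if_mod_eight]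
    have a1 : ¬ m % 2 = 0 := by omega
    have a2 : ¬ (m % 8 = 1 ∨ m % 8 = 7) := by omega
    simp [a1, a2]
  have : NeZero m := ⟨by omega⟩
  have h3 : J((2 : ℤ) ^ h | 3 * m) = 1 := by
    rw [jacobiSym.pow_left, jacobiSym.mul_right, h2m]
    have : J(2 | 3) = -1 := by norm_num
    rw [this]; norm_num
  have h4 : J(D | 3 * m) = J((3 : ℤ) ^ s - m ^ k | 3 * m) := by
    rw [← H.two_pow_mul_cofactor hv, jacobiSym.mul_left, h3, one_mul]
  have h5 : J((3 : ℤ) ^ s - m ^ k | 3) = -1 := by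
    have e1 : J((3 : ℤ) ^ s - m ^ k | 3) = J(-1 | 3) := by
      refine jacobiSym.mod_left' ?_
      have a1 : (3 : ℤ) ^ s ≡ 0 [ZMOD 3] := Int.modEq_zero_iff_dvd.2 (dvd_pow_self 3 hs)
      have a2 : (m : ℤ) ≡ 1 [ZMOD 3] := by rw [Int.ModEq]; omega
      have a3 := a1.sub (a2.pow k)
      rw [zero_sub, one_pow] at a3
      exact a3
    rw [e1]; norm_num
  have h6 : J((3 : ℤ) ^ s - m ^ k | m) = 1 := by
    have e1 : J((3 : ℤ) ^ s - m ^ k | m) = J((3 : ℤ) ^ s | m) := by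
      refine jacobiSym.mod_left' ?_
      have a1 : (m : ℤ) ^ k ≡ 0 [ZMOD m] := Int.modEq_zero_iff_dvd.2 (dvd_pow_self _ hk)
      have a2 := (Int.ModEq.refl ((3 : ℤ) ^ s)).sub a1
      rw [sub_zero] at a2
      exact a2
    obtain ⟨t, rfl⟩ := hse
    rw [e1, ← two_mul, mul_comm, pow_mul, jacobiSym.pow_left, jacobiSym.pow_left, ← pow_mul,
      mul_comm, pow_mul, jacobiSym.sq_one, one_pow]
    exact Int.isCoprime_iff_gcd_eq_one.1 H.isCoprime_three_m
  rw [show (3 * (m : ℤ)) = ((3 * m : ℕ) : ℤ) by push_cast; ring, h0, h1, h4,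
    jacobiSym.mul_right, h5, h6]
  norm_num

end LatticeData

/-- A point `(s, k)` of the lattice `s * p ≡ k * q` modulo `j`, together with its level. -/
structure LatticePoint where
  s : ℕ
  k : ℕ
  d : ℤ

/-- A positively or negatively oriented pair of lattice points of minimal determinant,
with odd coprime levels. -/
structure LatticePair (p q j : ℕ) (v w : LatticePoint) (δ : ℤ) : Prop where
  level_v : (v.s : ℤ) * p - v.k * q = j * v.d
  level_w : (w.s : ℤ) * p - w.k * q = j * w.d
  det : v.d * w.k - w.d * v.k = δ * p
  delta : δ = 1 ∨ δ = -1
  odd_v : Odd v.d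
  odd_w : Odd w.d
  coprime : IsCoprime v.d w.d
  abs_v : |v.d| ≤ p
  abs_w : |w.d| ≤ p
  k_v : v.k ≤ p ^ 2 + p
  k_w : w.k ≤ p ^ 2 + p
  k_v_of_lt : |v.d| < |w.d| → v.k ≤ p
  k_w_of_lt : |w.d| < |v.d| → w.k ≤ p

namespace LatticePair

variable {v w : LatticePoint} {δ : ℤ}

theorem symm (P : LatticePair p q j v w δ) : LatticePair p q j w v (-δ) where
  level_v := P.level_w
  level_w := P.level_v
  det := by linear_combination -P.det
  delta := by rcases P.delta with h | h <;> simp [h]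
  odd_v := P.odd_w
  odd_w := P.odd_v
  coprime := P.coprime.symm
  abs_v := P.abs_w
  abs_w := P.abs_v
  k_v := P.k_w
  k_w := P.k_v
  k_v_of_lt := P.k_w_of_lt
  k_w_of_lt := P.k_v_of_lt

theorem ne_zero_w (P : LatticePair p q j v w δ) : w.d ≠ 0 := by
  intro h
  have := P.odd_w
  simp [h] at this

theorem s_w_ne_zero (P : LatticePair p q j v w δ) (hj : 0 < j) (hlt : j * p < q) : w.s ≠ 0 := by
  intro h
  have h1 := P.level_w
  have h2 := P.abs_w
  have h3 : (j : ℤ) * p < q := by exact_mod_cast hlt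
  have h4 := P.ne_zero_w
  rw [h] at h1
  have hj' : (0 : ℤ) < j := by exact_mod_cast hj
  have h5 : (w.k : ℤ) * q = j * (-w.d) := by push_cast at h1; linarith
  have h6 : (w.k : ℤ) * q < 1 * q := by
    rw [h5]
    have := neg_abs_le w.d
    nlinarith
  have h7 : (w.k : ℤ) < 1 := lt_of_mul_lt_mul_right h6 (by positivity)
  have h8 : (w.k : ℤ) = 0 := by omega
  rw [h8, zero_mul] at h5
  rcases mul_eq_zero.1 h5.symm with h9 | h9 <;> omega

/-- Changing the first point of a pair by twice the second one. -/
theorem of_step (P : LatticePair p q j v w δ) (hlt : |w.d| < |v.d|) {u : LatticePoint} {σ c : ℤ}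
    (hσ : σ = 1 ∨ σ = -1) (hs : (u.s : ℤ) = σ * (v.s + 2 * c * w.s))
    (hk : (u.k : ℤ) = σ * (v.k + 2 * c * w.k)) (hd : u.d = σ * (v.d + 2 * c * w.d))
    (hu : |u.d| < |v.d|) : LatticePair p q j u w (σ * δ) := by
  have hw := P.k_w_of_lt hlt
  have hup : |u.d| ≤ p := hu.le.trans P.abs_v
  have hwk : (w.k : ℤ) ≤ p := by exact_mod_cast hw
  have hdet : u.d * w.k - w.d * u.k = σ * δ * p := by
    rw [hd, hk]; linear_combination σ * P.det
  have hδ : |σ * δ * (p : ℤ)| = p := by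
    rcases hσ with rfl | rfl <;> rcases P.delta with h | h <;> simp [h]
  have hw0 : 0 < |w.d| := abs_pos.2 P.ne_zero_w
  have hbound : |w.d| * u.k ≤ p + |u.d| * w.k := by
    have h1 : w.d * u.k = u.d * w.k - σ * δ * p := by linarith
    have h2 := abs_sub (u.d * w.k) (σ * δ * p)
    rw [← h1, hδ, abs_mul, abs_mul, Nat.abs_cast, Nat.abs_cast] at h2
    linarith
  have hp0 : (0 : ℤ) ≤ p := by positivity
  refine ⟨?_, P.level_w, hdet, ?_, ?_, P.odd_w, ?_, hup, P.abs_w, ?_, P.k_w, ?_, fun _ => hw⟩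
  · rw [hs, hk, hd]; linear_combination σ * P.level_v + 2 * σ * c * P.level_w
  · rcases hσ with rfl | rfl <;> rcases P.delta with h | h <;> simp [h]
  · have h1 : Odd (v.d + 2 * c * w.d) := by
      rw [mul_assoc]; exact P.odd_v.add_even (even_two_mul _)
    rw [hd]; rcases hσ with rfl | rfl
    · simpa using h1
    · simpa using h1.neg
  · have h1 : IsCoprime (v.d + 2 * c * w.d) w.d := P.coprime.add_mul_right_left _
    rw [hd]; rcases hσ with rfl | rfl
    · simpa using h1
    · simpa using h1.neg_left
  · have h1 : (u.k : ℤ) ≤ p ^ 2 + p := by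
      have : (u.k : ℤ) ≤ |w.d| * u.k := le_mul_of_one_le_left (by positivity) hw0
      nlinarith [mul_le_mul hup hwk (by positivity) hp0]
    exact_mod_cast h1
  · intro h1
    have h2 : |w.d| * u.k ≤ |w.d| * p := by
      have := mul_le_mul (show |u.d| ≤ |w.d| - 1 by omega) hwk (by positivity) (by omega)
      linarith
    exact_mod_cast le_of_mul_le_mul_left h2 hw0

/-- One step of the Euclidean algorithm with even quotients. -/
theorem exists_step (P : LatticePair p q j v w δ) (hlt : |w.d| < |v.d|) (hjp : j * p < q) :
    ∃ u : LatticePoint, |u.d| < |v.d| ∧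
      ((LatticePair p q j u w δ ∧ u.s = v.s + 2 * w.s ∧ u.k = v.k + 2 * w.k ∧
          u.d = v.d + 2 * w.d) ∨
        (LatticePair p q j u w δ ∧ v.s = u.s + 2 * w.s ∧ v.k = u.k + 2 * w.k ∧
          v.d = u.d + 2 * w.d) ∨
        (LatticePair p q j u w (-δ) ∧ u.s + v.s = 2 * w.s ∧ u.k + v.k = 2 * w.k ∧
          u.d + v.d = 2 * w.d)) := by
  have hw0 := P.ne_zero_w
  by_cases hsign : (0 < v.d ∧ w.d < 0) ∨ (v.d < 0 ∧ 0 < w.d)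
  · have hu : |v.d + 2 * w.d| < |v.d| := by
      rw [abs_lt] at hlt ⊢
      rcases hsign with ⟨h1, h2⟩ | ⟨h1, h2⟩
      · rw [abs_of_pos h1] at hlt ⊢; omega
      · rw [abs_of_neg h1] at hlt ⊢; omega
    refine ⟨⟨v.s + 2 * w.s, v.k + 2 * w.k, v.d + 2 * w.d⟩, hu, Or.inl ⟨?_, rfl, rfl, rfl⟩⟩
    have := P.of_step (u := ⟨v.s + 2 * w.s, v.k + 2 * w.k, v.d + 2 * w.d⟩) (σ := 1) (c := 1) hlt
      (Or.inl rfl) (by push_cast; ring) (by push_cast; ring) (by ring) hu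
    simpa using this
  · have hu : |v.d - 2 * w.d| < |v.d| := by
      rcases lt_trichotomy v.d 0 with h1 | h1 | h1
      · rw [abs_lt] at hlt ⊢; rw [abs_of_neg h1] at hlt ⊢; omega
      · rw [h1, abs_zero] at hlt; exact absurd hlt (not_lt.2 (abs_nonneg _))
      · rw [abs_lt] at hlt ⊢; rw [abs_of_pos h1] at hlt ⊢; omega
    have hlev : ((v.s : ℤ) - 2 * w.s) * p - (v.k - 2 * w.k) * q = j * (v.d - 2 * w.d) := by
      linear_combination P.level_v - 2 * P.level_w
    have habs : |(j : ℤ) * (v.d - 2 * w.d)| < q := by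
      rw [abs_mul, Nat.abs_cast]
      have h1 : |v.d - 2 * w.d| ≤ p := hu.le.trans P.abs_v
      have h2 : (j : ℤ) * p < q := by exact_mod_cast hjp
      have h3 : (j : ℤ) * |v.d - 2 * w.d| ≤ j * p := mul_le_mul_of_nonneg_left h1 (by positivity)
      linarith
    rw [← hlev, abs_lt] at habs
    obtain ⟨ha, hb⟩ := habs
    have hp0 : (0 : ℤ) ≤ p := by positivity
    have hq0 : (0 : ℤ) ≤ q := by positivity
    have hcase : (2 * w.s ≤ v.s ∧ 2 * w.k ≤ v.k) ∨ (v.s ≤ 2 * w.s ∧ v.k ≤ 2 * w.k) := by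
      by_contra hc
      have : (2 * w.s < v.s ∧ v.k < 2 * w.k) ∨ (v.s < 2 * w.s ∧ 2 * w.k < v.k) := by omega
      rcases this with ⟨h1, h2⟩ | ⟨h1, h2⟩
      · have e1 : (1 : ℤ) ≤ v.s - 2 * w.s := by omega
        have e2 : (v.k : ℤ) - 2 * w.k ≤ -1 := by omega
        nlinarith
      · have e1 : (v.s : ℤ) - 2 * w.s ≤ -1 := by omega
        have e2 : (1 : ℤ) ≤ (v.k : ℤ) - 2 * w.k := by omega
        nlinarith
    rcases hcase with ⟨h1, h2⟩ | ⟨h1, h2⟩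
    · refine ⟨⟨v.s - 2 * w.s, v.k - 2 * w.k, v.d - 2 * w.d⟩, hu, Or.inr (Or.inl ⟨?_, ?_, ?_, ?_⟩)⟩
      · have := P.of_step (u := ⟨v.s - 2 * w.s, v.k - 2 * w.k, v.d - 2 * w.d⟩) (σ := 1) (c := -1)
          hlt (Or.inl rfl) (by push_cast [Nat.cast_sub h1]; ring)
          (by push_cast [Nat.cast_sub h2]; ring) (by ring) hu
        simpa using this
      all_goals simp; try omega
    · have hu' : |2 * w.d - v.d| < |v.d| := by rwa [abs_sub_comm]
      refine ⟨⟨2 * w.s - v.s, 2 * w.k - v.k, 2 * w.d - v.d⟩, hu', Or.inr (Or.inr ⟨?_, ?_, ?_, ?_⟩)⟩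
      · have := P.of_step (u := ⟨2 * w.s - v.s, 2 * w.k - v.k, 2 * w.d - v.d⟩) (σ := -1) (c := -1)
          hlt (Or.inr rfl) (by push_cast [Nat.cast_sub h1]; ring)
          (by push_cast [Nat.cast_sub h2]; ring) (by ring) hu'
        simpa using this
      all_goals simp; try omega

end LatticePair

namespace LatticeData

variable {v w u : LatticePoint} {δ : ℤ}

/-- The quadratic residue symbol attached to an even and an odd lattice point. -/
def pairSymbol (m h : ℕ) (v w : LatticePoint) : ℤ :=
  J(cofactor m h w.s w.k | (cofactor m h v.s v.k).natAbs) * J(w.d | v.d.natAbs)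

theorem emod_four_of_modEq {a b : ℤ} (hab : a ≡ b [ZMOD 8]) : a % 4 = b % 4 :=
  hab.of_dvd (by norm_num)

theorem cofactor_mod_even (H : LatticeData p q m j h X)
    (hv : (v.s : ℤ) * p - v.k * q = j * v.d) (hk : Even v.k) :
    cofactor m h v.s v.k ≡ (X * p : ℕ) * v.d [ZMOD 8] := by
  have h1 := H.cofactor_modEq hv
  obtain ⟨t, ht⟩ := hk
  have h2 : (3 : ℤ) ^ v.k ≡ 1 [ZMOD 8] := by
    rw [ht, ← two_mul, pow_mul]
    simpa using (show (3 : ℤ) ^ 2 ≡ 1 [ZMOD 8] by decide).pow t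
  refine h1.trans ?_
  have h3 := ((h2.mul_right (X : ℤ)).mul_right (p : ℤ)).mul_right v.d
  push_cast
  simpa using h3

theorem cofactor_mod_odd (H : LatticeData p q m j h X)
    (hv : (w.s : ℤ) * p - w.k * q = j * w.d) (hk : Odd w.k) :
    cofactor m h w.s w.k ≡ 3 * (X * p : ℕ) * w.d [ZMOD 8] := by
  have h1 := H.cofactor_modEq hv
  refine h1.trans ?_
  have h2 := (((pow_modEq_self_of_odd (a := 3) (by decide) hk).mul_right (X : ℤ)).mul_right
    (p : ℤ)).mul_right w.d
  push_cast
  simpa [mul_assoc] using h2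

theorem odd_mul (H : LatticeData p q m j h X) : Odd (X * p) := H.odd_X.mul H.odd_p

theorem mod_four_mul (H : LatticeData p q m j h X) : (X * p) % 4 = 1 ∨ (X * p) % 4 = 3 := by
  have := Nat.odd_iff.1 H.odd_mul
  omega

theorem recipSign_mul (H : LatticeData p q m j h X) (P : LatticePair p q j v w δ)
    (hvk : Even v.k) (hwk : Odd w.k) :
    recipSign (cofactor m h w.s w.k) (cofactor m h v.s v.k) * recipSign w.d v.d =
      if (X * p) % 4 = 1 then signModFour v.d else signModFour w.d := by
  have h1 := emod_four_of_modEq (H.cofactor_mod_even P.level_v hvk)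
  have h2 := emod_four_of_modEq (H.cofactor_mod_odd P.level_w hwk)
  have hv := Int.odd_iff.1 P.odd_v
  have hw := Int.odd_iff.1 P.odd_w
  have h3 : v.d % 4 = 1 ∨ v.d % 4 = 3 := by omega
  have h4 : w.d % 4 = 1 ∨ w.d % 4 = 3 := by omega
  have h5 : ((X * p : ℕ) : ℤ) % 4 = 1 ∨ ((X * p : ℕ) : ℤ) % 4 = 3 := by
    rcases H.mod_four_mul with h | h <;> omega
  have h6 : ((X * p) % 4 = 1) = (((X * p : ℕ) : ℤ) % 4 = 1) := by
    apply propext; omega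
  unfold recipSign signModFour
  simp only [h6]
  generalize ((X * p : ℕ) : ℤ) = f at *
  rw [mul_assoc, Int.mul_emod, Int.mul_emod _ w.d] at h2
  rw [Int.mul_emod] at h1
  rcases h3 with h3 | h3 <;> rcases h4 with h4 | h4 <;> rcases h5 with h5 | h5 <;>
    simp [h1, h2, h3, h4, h5]

theorem signModFour_delta_mul {d : ℤ} (hd : Odd d) (hδ : δ = 1 ∨ δ = -1) :
    signModFour d * signModFour (δ * d) = δ := by
  have hv := Int.odd_iff.1 hd
  unfold signModFour
  rcases hδ with rfl | rfl
  · split_ifs <;> omega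
  · split_ifs <;> omega

theorem signModFour_mul_self (d : ℤ) : signModFour d * signModFour d = 1 := by
  unfold signModFour; split_ifs <;> rfl

theorem pairSymbol_swap (H : LatticeData p q m j h X) (P : LatticePair p q j v w δ)
    (hvk : Even v.k) (hwk : Odd w.k) (C : ℤ) :
    pairSymbol m h v w = C * (if (X * p) % 4 = 1 then signModFour (δ * v.d) else 1) ↔
      pairSymbol m h w v = C * (if (X * p) % 4 = 1 then δ else signModFour w.d) := by
  have h1 := jacobiSym_mul_comm (H.cofactor_odd P.level_w P.odd_w)
    (H.cofactor_odd P.level_v P.odd_v) P.odd_w P.odd_v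
    (H.cofactor_neg_iff P.level_w P.odd_w P.k_w) (H.cofactor_neg_iff P.level_v P.odd_v P.k_v)
  rw [H.recipSign_mul P hvk hwk] at h1
  have h2 : pairSymbol m h v w =
      (if (X * p) % 4 = 1 then signModFour v.d else signModFour w.d) * pairSymbol m h w v := h1
  have h3 := signModFour_delta_mul P.odd_v P.delta
  have h4 := signModFour_mul_self v.d
  have h5 := signModFour_mul_self w.d
  rw [h2]
  split_ifs
  · constructor <;> intro h6
    · linear_combination signModFour v.d * h6 - pairSymbol m h w v * h4 + C * h3
    · have h7 : signModFour v.d * δ = signModFour (δ * v.d) := by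
        linear_combination signModFour (δ * v.d) * h4 - signModFour v.d * h3
      rw [h6, ← h7]; ring
  · constructor <;> intro h6
    · linear_combination signModFour w.d * h6 - pairSymbol m h w v * h5
    · rw [h6]; linear_combination C * h5

theorem natAbs_sign_mul {c d : ℤ} {f : ℤ} (hcd : c % 4 = (f * d) % 4) (hf : f % 4 = 1 ∨ f % 4 = 3)
    (hd : Odd d) (hsign : c < 0 ↔ d < 0) :
    (if c.natAbs % 4 = 3 then (-1 : ℤ) else 1) * (if d.natAbs % 4 = 3 then -1 else 1) =
      if f % 4 = 3 then -1 else 1 := by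
  have hv := Int.odd_iff.1 hd
  rw [Int.mul_emod] at hcd
  have h3 : d % 4 = 1 ∨ d % 4 = 3 := by omega
  rcases h3 with h3 | h3 <;> rcases hf with h5 | h5 <;> rw [h3, h5] at hcd <;>
    norm_num at hcd <;> split_ifs <;> omega

theorem pairSymbol_of_add (H : LatticeData p q m j h X) (P : LatticePair p q j v w δ)
    (hu : (u.s : ℤ) * p - u.k * q = j * u.d) (h1 : v.s = u.s + 2 * w.s)
    (h2 : v.k = u.k + 2 * w.k) (h3 : v.d = u.d + 2 * w.d) :
    pairSymbol m h w v = pairSymbol m h w u := by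
  have hj : 0 < j := by have := H.two_le_j; omega
  unfold pairSymbol
  rw [h1, h2, H.jacobiSym_cofactor_add P.level_w hu (P.s_w_ne_zero hj H.mul_lt), h3,
    jacobiSym_congr (show w.d ∣ u.d + 2 * w.d - u.d from ⟨2, by ring⟩)]

theorem step_even (H : LatticeData p q m j h X) (P : LatticePair p q j v w δ)
    (hvk : Even v.k) (hvs : Even v.s) (hwk : Odd w.k)
    (h1 : u.s + v.s = 2 * w.s) (h2 : u.k + v.k = 2 * w.k) (h3 : u.d + v.d = 2 * w.d) :
    pairSymbol m h w u = (if (X * p) % 4 = 1 then -1 else 1) * pairSymbol m h w v := by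
  have hj : 0 < j := by have := H.two_le_j; omega
  have hws := P.s_w_ne_zero hj H.mul_lt
  have hwk0 : w.k ≠ 0 := by rintro h; simp [h] at hwk
  have hr := H.jacobiSym_cofactor_reflect P.level_w P.level_v hws h1 h2
  rw [jacobiSym_even_pow_mul hvs (H.isCoprime_three_cofactor P.level_w hws),
    jacobiSym_even_pow_mul hvk (H.isCoprime_m_cofactor P.level_w hwk0),
    jacobiSym_neg_left _ (H.cofactor_odd P.level_w P.odd_w)] at hr
  have hd : J(u.d | w.d.natAbs) = J(-v.d | w.d.natAbs) :=
    jacobiSym_congr ⟨2, by linear_combination h3⟩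
  rw [jacobiSym_neg_left _ P.odd_w] at hd
  have hmod := emod_four_of_modEq (H.cofactor_mod_odd P.level_w hwk)
  have hf : (3 * ((X * p : ℕ) : ℤ)) % 4 = 1 ∨ (3 * ((X * p : ℕ) : ℤ)) % 4 = 3 := by
    have := H.mod_four_mul; omega
  have hs := natAbs_sign_mul hmod hf P.odd_w (H.cofactor_neg_iff P.level_w P.odd_w P.k_w)
  have hf' : ((3 * ((X * p : ℕ) : ℤ)) % 4 = 3) = ((X * p) % 4 = 1) := by
    apply propext; have := H.mod_four_mul; omega
  simp only [hf'] at hs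
  unfold pairSymbol
  rw [hr, hd, ← hs]
  ring

theorem step_odd (H : LatticeData p q m j h X) (P : LatticePair p q j w v δ)
    (hvk : Even v.k) (hvs : Even v.s) (hwk : Odd w.k)
    (hws : Odd w.s) (h1 : u.s + w.s = 2 * v.s) (h2 : u.k + w.k = 2 * v.k)
    (h3 : u.d + w.d = 2 * v.d) :
    pairSymbol m h v u = (if (X * p) % 4 = 1 then -1 else 1) * pairSymbol m h v w := by
  have hj : 0 < j := by have := H.two_le_j; omega
  have hvs0 := P.s_w_ne_zero hj H.mul_lt
  have hvk0 : v.k ≠ 0 := by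
    have : w.k ≠ 0 := by rintro h; simp [h] at hwk
    omega
  have hr := H.jacobiSym_cofactor_reflect P.level_w P.level_v hvs0 h1 h2
  rw [jacobiSym_odd_pow_mul hws (H.isCoprime_three_cofactor P.level_w hvs0), mul_left_comm,
    jacobiSym_odd_pow_mul hwk (H.isCoprime_m_cofactor P.level_w hvk0), ← mul_assoc,
    mul_comm (m : ℤ) 3, jacobiSym.mul_left, H.jacobiSym_three_mul_m P.level_w P.odd_w hvs hvs0 hvk0,
    jacobiSym_neg_left _ (H.cofactor_odd P.level_w P.odd_w)] at hr
  have hd : J(u.d | v.d.natAbs) = J(-w.d | v.d.natAbs) :=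
    jacobiSym_congr ⟨2, by linear_combination h3⟩
  rw [jacobiSym_neg_left _ P.odd_w] at hd
  have hmod := emod_four_of_modEq (H.cofactor_mod_even P.level_w hvk)
  have hf : ((X * p : ℕ) : ℤ) % 4 = 1 ∨ ((X * p : ℕ) : ℤ) % 4 = 3 := by
    have := H.mod_four_mul; omega
  have hs := natAbs_sign_mul hmod hf P.odd_w (H.cofactor_neg_iff P.level_w P.odd_w P.k_w)
  have hf' : (if (X * p) % 4 = 1 then (-1 : ℤ) else 1) =
      -(if ((X * p : ℕ) : ℤ) % 4 = 3 then -1 else 1) := by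
    rcases H.mod_four_mul with h | h
    · have : ¬ ((X * p : ℕ) : ℤ) % 4 = 3 := by omega
      rw [if_pos h, if_neg this]
    · have : ((X * p : ℕ) : ℤ) % 4 = 3 := by omega
      rw [if_neg (by omega), if_pos this]; norm_num
  have hr' : J(cofactor m h u.s u.k | (cofactor m h v.s v.k).natAbs) =
      -((if (cofactor m h v.s v.k).natAbs % 4 = 3 then -1 else 1) *
        J(cofactor m h w.s w.k | (cofactor m h v.s v.k).natAbs)) := by
    linear_combination -hr
  rw [hf', ← hs]
  unfold pairSymbol
  rw [hr', hd]
  ring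

end LatticeData

theorem jacobiSym_two_sq {n : ℕ} (hn : Odd n) : J(2 | n) * J(2 | n) = 1 := by
  rw [← sq]
  apply jacobiSym.sq_one
  rw [Int.gcd_eq_natAbs]
  exact Nat.coprime_two_left.2 hn

theorem jacobiSym_two_congr {a b : ℕ} (ha : Odd a) (hab : a % 8 = b % 8) :
    J(2 | a) = J(2 | b) := by
  have hb : Odd b := by rw [Nat.odd_iff] at ha ⊢; omega
  rw [jacobiSym.at_two ha, jacobiSym.at_two hb, ZMod.χ₈_nat_mod_eight, hab,
    ← ZMod.χ₈_nat_mod_eight]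

namespace LatticeData

variable {v w u : LatticePoint} {δ : ℤ}

theorem natAbs_cofactor_mod (H : LatticeData p q m j h X)
    (hv : (v.s : ℤ) * p - v.k * q = j * v.d) (hk : Even v.k) (hk' : v.k ≤ p ^ 2 + p)
    (hd : v.d = 1 ∨ v.d = -1) : (cofactor m h v.s v.k).natAbs % 8 = (X * p) % 8 := by
  have h1 := H.cofactor_mod_even hv hk
  have h2 := H.cofactor_neg_iff hv (by rcases hd with h | h <;> simp [h]) hk'
  rw [Int.ModEq] at h1
  generalize hf : X * p = f at *
  rcases hd with h | h <;> rw [h] at h1 h2 <;> norm_num at h2 <;> omega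

theorem pairSymbol_of_jacobiSym (H : LatticeData p q m j h X)
    (hv : (v.s : ℤ) * p - v.k * q = j * v.d) (hk : Even v.k) (hk' : v.k ≤ p ^ 2 + p)
    (hd : v.d = 1 ∨ v.d = -1) {ε : ℤ}
    (hJ : J(2 ^ h * cofactor m h w.s w.k | (cofactor m h v.s v.k).natAbs) =
      ε * J(2 ^ q | (cofactor m h v.s v.k).natAbs)) :
    pairSymbol m h v w = J(2 | X * p) ^ (h + 1) * ε := by
  have hd1 : v.d.natAbs = 1 := by omega
  have hodd := Int.natAbs_odd.2 (H.cofactor_odd hv (by rcases hd with h | h <;> simp [h]))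
  have h2 := jacobiSym_two_congr hodd (H.natAbs_cofactor_mod hv hk hk' hd)
  have h3 := jacobiSym_two_sq H.odd_mul
  rw [jacobiSym.mul_left, jacobiSym.pow_left, jacobiSym.pow_left, h2] at hJ
  generalize J(2 | X * p) = a at *
  have ha : a ^ q = a := by
    obtain ⟨t, ht⟩ := H.odd_q
    rw [ht, pow_succ, pow_mul, sq, h3, one_pow, one_mul]
  have hb : a ^ h * a ^ h = 1 := by rw [← mul_pow, h3, one_pow]
  unfold pairSymbol
  rw [hd1, jacobiSym.one_right, mul_one]
  rw [ha] at hJ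
  linear_combination a ^ h * hJ - J(cofactor m h w.s w.k | (cofactor m h v.s v.k).natAbs) * hb

theorem cofactor_dvd_sub (H : LatticeData p q m j h X)
    (hv : (v.s : ℤ) * p - v.k * q = j * v.d) : cofactor m h v.s v.k ∣ 3 ^ v.s - (m : ℤ) ^ v.k :=
  Dvd.intro_left _ (H.two_pow_mul_cofactor hv)

theorem pairSymbol_of_add_eq (H : LatticeData p q m j h X) (P : LatticePair p q j v w δ)
    (hvk : Even v.k) (hvs : Even v.s) (hd : v.d = 1 ∨ v.d = -1) (hs : v.s + w.s = q)
    (hk : v.k + w.k = p) : pairSymbol m h v w = J(2 | X * p) ^ (h + 1) := by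
  have hj : 0 < j := by have := H.two_le_j; omega
  rw [← mul_one (J(2 | X * p) ^ (h + 1))]
  refine H.pairSymbol_of_jacobiSym P.level_v hvk P.k_v hd ?_
  rw [one_mul, ← jacobiSym_even_pow_mul hvs
    (H.isCoprime_three_cofactor P.level_v (P.symm.s_w_ne_zero hj H.mul_lt))]
  refine jacobiSym_congr ((H.cofactor_dvd_sub P.level_v).trans ⟨-(m : ℤ) ^ w.k, ?_⟩)
  have h1 : (m : ℤ) ^ p + 2 ^ q = 3 ^ q := by exact_mod_cast H.eq
  have e1 : (3 : ℤ) ^ q = 3 ^ v.s * 3 ^ w.s := by rw [← pow_add, hs]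
  have e2 : (m : ℤ) ^ p = m ^ v.k * m ^ w.k := by rw [← pow_add, hk]
  rw [H.two_pow_mul_cofactor P.level_w]
  linear_combination -h1 - e1 + e2

theorem pairSymbol_of_eq_add (H : LatticeData p q m j h X) (P : LatticePair p q j v w δ)
    (hvk : Even v.k) (hvs : Even v.s) (hd : v.d = 1 ∨ v.d = -1) (hs : w.s = v.s + q)
    (hk : w.k = v.k + p) : pairSymbol m h v w = J(2 | X * p) ^ (h + 1) := by
  have hj : 0 < j := by have := H.two_le_j; omega
  rw [← mul_one (J(2 | X * p) ^ (h + 1))]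
  refine H.pairSymbol_of_jacobiSym P.level_v hvk P.k_v hd ?_
  rw [one_mul, ← jacobiSym_even_pow_mul (b := 2 ^ q) hvs
    (H.isCoprime_three_cofactor P.level_v (P.symm.s_w_ne_zero hj H.mul_lt))]
  refine jacobiSym_congr ((H.cofactor_dvd_sub P.level_v).trans ⟨(m : ℤ) ^ p, ?_⟩)
  have h1 : (m : ℤ) ^ p + 2 ^ q = 3 ^ q := by exact_mod_cast H.eq
  rw [H.two_pow_mul_cofactor P.level_w, hs, hk, pow_add, pow_add]
  linear_combination -3 ^ v.s * h1

theorem pairSymbol_of_add_eq' (H : LatticeData p q m j h X) (P : LatticePair p q j v w δ)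
    (hvk : Even v.k) (hvs : Even v.s) (hwk : Odd w.k) (hd : v.d = 1 ∨ v.d = -1)
    (hs : v.s = w.s + q) (hk : v.k = w.k + p) :
    pairSymbol m h v w = J(2 | X * p) ^ (h + 1) * if (X * p) % 4 = 1 then -1 else 1 := by
  have hj : 0 < j := by have := H.two_le_j; omega
  have hvs0 := P.symm.s_w_ne_zero hj H.mul_lt
  have hvk0 : v.k ≠ 0 := by have := H.three_le_p; omega
  have hodd := Int.natAbs_odd.2 (H.cofactor_odd P.level_v P.odd_v)
  have hmod := H.natAbs_cofactor_mod P.level_v hvk P.k_v hd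
  refine H.pairSymbol_of_jacobiSym P.level_v hvk P.k_v hd ?_
  have h3 := H.isCoprime_three_cofactor P.level_v hvs0
  have hm := H.isCoprime_m_cofactor P.level_v hvk0
  have h3m := H.jacobiSym_three_mul_m P.level_v P.odd_v hvs hvs0 hvk0
  have key : J(3 ^ q * (2 ^ h * cofactor m h w.s w.k) | (cofactor m h v.s v.k).natAbs) =
      J((m : ℤ) ^ w.k * (-2 ^ q) | (cofactor m h v.s v.k).natAbs) := by
    refine jacobiSym_congr ((H.cofactor_dvd_sub P.level_v).trans ⟨1, ?_⟩)
    have h1 : (m : ℤ) ^ p + 2 ^ q = 3 ^ q := by exact_mod_cast H.eq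
    rw [H.two_pow_mul_cofactor P.level_w, hs, hk, pow_add, pow_add]
    linear_combination (m : ℤ) ^ w.k * h1
  rw [jacobiSym_odd_pow_mul H.odd_q h3, jacobiSym_odd_pow_mul hwk hm, jacobiSym.mul_left,
    jacobiSym.mul_left (m : ℤ), jacobiSym_neg_left _ (H.cofactor_odd P.level_v P.odd_v)] at key
  rw [jacobiSym.mul_left] at h3m
  have hsgn : (if (cofactor m h v.s v.k).natAbs % 4 = 3 then (-1 : ℤ) else 1) =
      -(if (X * p) % 4 = 1 then -1 else 1) := by
    have := H.mod_four_mul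
    split_ifs <;> omega
  rw [hsgn] at key
  have hJ3 : J((3 : ℤ) | (cofactor m h v.s v.k).natAbs) ^ 2 = 1 := by
    apply jacobiSym.sq_one
    have := Int.isCoprime_iff_gcd_eq_one.1 h3
    simpa [Int.gcd_eq_natAbs, Int.natAbs_abs] using this
  generalize J((3 : ℤ) | (cofactor m h v.s v.k).natAbs) = a at *
  linear_combination a * key - J(2 ^ h * cofactor m h w.s w.k | (cofactor m h v.s v.k).natAbs) *
    hJ3 - (if (X * p) % 4 = 1 then -1 else 1) * J(2 ^ q | (cofactor m h v.s v.k).natAbs) * h3m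

theorem pairSymbol_of_abs_eq (H : LatticeData p q m j h X) (P : LatticePair p q j v w δ)
    (hvk : Even v.k) (hvs : Even v.s) (hwk : Odd w.k) (habs : |v.d| = |w.d|) :
    pairSymbol m h v w = J(2 | X * p) ^ (h + 1) *
      if (X * p) % 4 = 1 then signModFour (δ * v.d) else 1 := by
  have hp : (0 : ℤ) < p := by have := H.three_le_p; omega
  have h1 : signModFour 1 = 1 := rfl
  have h2 : signModFour (-1) = -1 := rfl
  have hd : v.d = 1 ∨ v.d = -1 := by
    rw [← Int.isUnit_iff]
    have : v.d ∣ w.d := by rw [← abs_dvd, habs, abs_dvd]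
    exact P.coprime.isUnit_of_dvd' dvd_rfl this
  have hdet := P.det
  have hlv := P.level_v
  have hlw := P.level_w
  rcases abs_eq_abs.1 habs with he | he
  · have hk : δ * p = v.d * (w.k - v.k) := by rw [← hdet, ← he]; ring
    have hs : ((w.s : ℤ) - v.s) * p = (w.k - v.k) * q := by
      rw [← he] at hlw; linear_combination hlw - hlv
    by_cases hδ : δ = v.d
    · have hk' : (w.k : ℤ) - v.k = p := by
        rcases hd with h | h <;> rw [hδ, h] at hk <;> linarith
      rw [hk', mul_comm] at hs
      have hs' := mul_left_cancel₀ hp.ne' hs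
      rw [H.pairSymbol_of_eq_add P hvk hvs hd (by omega) (by omega)]
      rcases hd with h | h <;> simp [hδ, h, h1]
    · have hδ' : δ = -v.d := by rcases hd with h | h <;> rcases P.delta with h' | h' <;> omega
      have hk' : (w.k : ℤ) - v.k = -p := by
        rcases hd with h | h <;> rw [hδ', h] at hk <;> linarith
      rw [hk', neg_mul, ← mul_neg, mul_comm] at hs
      have hs' := mul_left_cancel₀ hp.ne' hs
      rw [H.pairSymbol_of_add_eq' P hvk hvs hwk hd (by omega) (by omega)]
      rcases hd with h | h <;> simp [hδ', h, h2]
  · have hw : w.d = -v.d := by rw [he, neg_neg]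
    have hk : δ * p = v.d * (w.k + v.k) := by rw [← hdet, hw]; ring
    have hs : ((w.s : ℤ) + v.s) * p = (w.k + v.k) * q := by
      rw [hw] at hlw; linear_combination hlw + hlv
    have hδ : δ = v.d := by
      rcases hd with h | h <;> rcases P.delta with h' | h' <;> rw [h, h'] at hk ⊢ <;> omega
    have hk' : (w.k : ℤ) + v.k = p := by
      rcases hd with h | h <;> rw [hδ, h] at hk <;> linarith
    rw [hk', mul_comm] at hs
    have hs' := mul_left_cancel₀ hp.ne' hs
    rw [H.pairSymbol_of_add_eq P hvk hvs hd (by omega) (by omega)]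
    rcases hd with h | h <;> simp [hδ, h, h1]

theorem signModFour_neg {a : ℤ} (ha : Odd a) : signModFour (-a) = -signModFour a := by
  have := Int.odd_iff.1 ha
  unfold signModFour
  split_ifs <;> omega

theorem pairSymbol_eq (H : LatticeData p q m j h X) (N : ℕ) :
    ∀ {v w : LatticePoint} {δ : ℤ}, LatticePair p q j v w δ → |v.d| + |w.d| ≤ N → Even v.k →
      Even v.s → Odd w.k → Odd w.s → pairSymbol m h v w = J(2 | X * p) ^ (h + 1) *
        if (X * p) % 4 = 1 then signModFour (δ * v.d) else 1 := by
  induction N with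
  | zero =>
    intro v w δ P hN
    have := abs_pos.2 P.ne_zero_w
    have := abs_nonneg v.d
    push_cast at hN
    omega
  | succ N ih =>
    intro v w δ P hN hvk hvs hwk hws
    push_cast at hN
    rcases lt_trichotomy |w.d| |v.d| with hlt | heq | hlt
    · obtain ⟨u, hu, ⟨Q, hs, hk, hd⟩ | ⟨Q, hs, hk, hd⟩ | ⟨Q, hs, hk, hd⟩⟩ :=
        P.exists_step hlt H.mul_lt
      all_goals
        have huk : Even u.k := by rw [Nat.even_iff] at hvk ⊢; omega
        have hus : Even u.s := by rw [Nat.even_iff] at hvs ⊢; omega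
        have IH := (H.pairSymbol_swap Q huk hwk _).1 (ih Q (by omega) huk hus hwk hws)
        rw [H.pairSymbol_swap P hvk hwk]
      · rw [← H.pairSymbol_of_add Q P.level_v hs hk hd, IH]
      · rw [H.pairSymbol_of_add P Q.level_v hs hk hd, IH]
      · rw [H.step_even P hvk hvs hwk hs hk hd] at IH
        split_ifs at IH ⊢ <;> linarith
    · exact H.pairSymbol_of_abs_eq P hvk hvs hwk heq.symm
    · obtain ⟨u, hu, ⟨Q, hs, hk, hd⟩ | ⟨Q, hs, hk, hd⟩ | ⟨Q, hs, hk, hd⟩⟩ :=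
        P.symm.exists_step hlt H.mul_lt
      all_goals
        have huk : Odd u.k := by rw [Nat.odd_iff] at hwk ⊢; omega
        have hus : Odd u.s := by rw [Nat.odd_iff] at hws ⊢; omega
        have IH := ih Q.symm (by omega) hvk hvs huk hus
      · rw [← H.pairSymbol_of_add Q P.level_w hs hk hd, IH, neg_neg]
      · rw [H.pairSymbol_of_add P.symm Q.level_v hs hk hd, IH, neg_neg]
      · rw [H.step_odd P.symm hvk hvs hwk hws hs hk hd, neg_neg, neg_mul, signModFour_neg] at IH
        · split_ifs at IH ⊢ <;> linarith
        · rcases P.delta with h | h <;> simp [h, P.odd_v]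

end LatticeData

/-- A solution of `m ^ p + 2 ^ q = 3 ^ q` with `p` an odd prime and `q > 2 * p` odd and prime to `p`. -/
structure PowerSolution (p q m : ℕ) : Prop where
  prime : p.Prime
  odd_p : Odd p
  odd_q : Odd q
  coprime : Nat.Coprime p q
  lt : 2 * p < q
  eq : m ^ p + 2 ^ q = 3 ^ q

namespace PowerSolution

theorem three_le (S : PowerSolution p q m) : 3 ≤ p := by
  have := S.prime.two_le
  have := Nat.odd_iff.1 S.odd_p
  omega

theorem eq_int (S : PowerSolution p q m) : (m : ℤ) ^ p + 2 ^ q = 3 ^ q := by exact_mod_cast S.eq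

theorem m_mod_eight (S : PowerSolution p q m) : m % 8 = 3 := by
  have h1 := S.eq_int
  have hq := S.lt
  have hp := S.three_le
  have h2 : (3 : ℤ) ^ q ≡ 3 [ZMOD 8] := pow_modEq_self_of_odd (by decide) S.odd_q
  have h3 : (2 : ℤ) ^ q ≡ 0 [ZMOD 8] :=
    Int.modEq_zero_iff_dvd.2 ((by norm_num : (8 : ℤ) = 2 ^ 3) ▸ pow_dvd_pow 2 (by omega))
  have hm : Odd (m : ℤ) := by
    by_contra hc
    rw [Int.not_odd_iff_even] at hc
    have h4 : Even ((m : ℤ) ^ p + 2 ^ q) :=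
      (hc.pow_of_ne_zero (by omega)).add ((by decide : Even (2 : ℤ)).pow_of_ne_zero (by omega))
    rw [h1] at h4
    exact (Int.not_even_iff_odd.2 (Odd.pow (by decide))) h4
  have h4 := (pow_modEq_self_of_odd hm S.odd_p).add h3
  rw [h1, add_zero] at h4
  have h5 := h4.symm.trans h2
  rw [Int.ModEq] at h5
  omega

theorem m_mod_three (S : PowerSolution p q m) : m % 3 = 1 := by
  have h1 := S.eq_int
  have hq := S.lt
  have h2 : (3 : ℤ) ^ q ≡ 0 [ZMOD 3] :=
    Int.modEq_zero_iff_dvd.2 (dvd_pow_self 3 (by omega))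
  have h3 : (2 : ℤ) ^ q ≡ -1 [ZMOD 3] := by
    have := (show (2 : ℤ) ≡ -1 [ZMOD 3] by decide).pow q
    rwa [S.odd_q.neg_one_pow] at this
  have h4 : (m : ℤ) ^ p ≡ 1 [ZMOD 3] := by
    have := h2.sub h3
    rw [← h1] at this
    simpa using this
  obtain ⟨t, ht⟩ := S.odd_p
  have h5 : (m : ℤ) % 3 = 0 ∨ (m : ℤ) % 3 = 1 ∨ (m : ℤ) % 3 = 2 := by omega
  rcases h5 with h5 | h5 | h5
  · have h6 := (show (m : ℤ) ≡ 0 [ZMOD 3] from h5).pow p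
    rw [zero_pow S.prime.ne_zero] at h6
    exact absurd (h6.symm.trans h4) (by decide)
  · omega
  · have h6 := (show (m : ℤ) ≡ -1 [ZMOD 3] from h5).pow p
    rw [S.odd_p.neg_one_pow] at h6
    exact absurd (h6.symm.trans h4) (by decide)

theorem latticeData (S : PowerSolution p q m) (hj : Even j) (hj2 : 2 ≤ j)
    (hpow : 3 ^ j = 2 ^ h * X + 1) (hX : Odd X) (hh : 3 ≤ h) (hhq : h + 3 ≤ q) (hlt : j * p < q) :
    LatticeData p q m j h X :=
  ⟨S.odd_p, S.three_le, S.odd_q, S.eq, S.m_mod_eight, S.m_mod_three, hj, hj2, hpow, hX, hh, hhq,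
    hlt⟩

end PowerSolution

theorem exists_odd_window {p q j : ℕ} (hp : 0 < p) (hj : 0 < j) (hpj : Nat.Coprime p (2 * j))
    (hlt : j * p < q) : ∃ s : ℕ, ∃ d : ℤ, (s : ℤ) * p - q = j * d ∧ Odd d ∧ |d| ≤ p := by
  obtain ⟨a, b, hab⟩ := Nat.isCoprime_iff_coprime.2 hpj
  push_cast at hab
  set t : ℤ := a * (q + j) with ht
  have hM : (0 : ℤ) < 2 * j * p := by positivity
  obtain ⟨c, e, hce, he1, he2⟩ : ∃ c e : ℤ, t * p - q = e + 2 * j * p * c ∧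
      -(j * p : ℤ) ≤ e ∧ e ≤ j * p := by
    refine ⟨(t * p - q + j * p) / (2 * j * p),
      (t * p - q + j * p) % (2 * j * p) - j * p, ?_, ?_, ?_⟩
    · linear_combination -Int.emod_add_mul_ediv (t * p - q + j * p) (2 * j * p)
    · linarith [Int.emod_nonneg (t * p - q + j * p) hM.ne']
    · linarith [Int.emod_lt_of_pos (t * p - q + j * p) hM]
  have hs : (t - 2 * j * c) * p - q = e := by linear_combination hce
  have hjp : (j : ℤ) * p < q := by exact_mod_cast hlt
  have hs0 : 0 ≤ t - 2 * j * c := by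
    have h1 : 0 < (t - 2 * j * c) * p := by linarith
    exact (pos_of_mul_pos_left h1 (by positivity)).le
  have hd : e = j * (1 - 2 * b * (q + j) - 2 * p * c) := by
    rw [← hs, ht]; linear_combination (q + j) * hab
  refine ⟨(t - 2 * j * c).toNat, 1 - 2 * b * (q + j) - 2 * p * c, ?_, ?_, ?_⟩
  · rw [Int.toNat_of_nonneg hs0, ← hd, hs]
  · exact ⟨-b * (q + j) - p * c, by ring⟩
  · have hj' : (0 : ℤ) < j := by exact_mod_cast hj
    rw [hd] at he1 he2
    rw [abs_le]
    constructor
    · refine le_of_mul_le_mul_left ?_ hj'; linarith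
    · exact le_of_mul_le_mul_left he2 hj'

namespace LatticeData

theorem exists_jacobiSym (H : LatticeData p q m j h X) (hpq : Nat.Coprime p q)
    (hpj : Nat.Coprime p j) : ∃ s : ℕ, ∃ d : ℤ, (s : ℤ) * p - q = j * d ∧ IsCoprime d p ∧
      J(2 ^ h * (3 ^ s - m) | X) * J(d | p) = J(2 | X * p) ^ (h + 1) *
        if (X * p) % 4 = 1 then signModFour p else 1 := by
  have hj : 0 < j := by have := H.two_le_j; omega
  have hp : 0 < p := by have := H.three_le_p; omega
  have hp2 : Nat.Coprime p (2 * j) :=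
    Nat.Coprime.mul_right (Nat.coprime_two_right.2 H.odd_p) hpj
  obtain ⟨s, d, hs, hd, hdp⟩ := exists_odd_window hp hj hp2 H.mul_lt
  have hsodd : Odd s := by
    by_contra hc
    rw [Nat.not_odd_iff_even] at hc
    have h1 : Even ((s : ℤ) * p - j * d) :=
      ((show Even (s : ℤ) by exact_mod_cast hc).mul_right _).sub
        ((show Even (j : ℤ) by exact_mod_cast H.even_j).mul_right _)
    have h2 : (s : ℤ) * p - j * d = q := by linarith
    rw [h2] at h1
    exact Nat.not_even_iff_odd.2 H.odd_q (by exact_mod_cast h1)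
  have hcop : IsCoprime d (p : ℤ) := by
    have h1 : IsCoprime ((j : ℤ) * d) p := by
      rw [← hs, sub_eq_neg_add]
      exact (Nat.isCoprime_iff_coprime.2 hpq.symm).neg_left.add_mul_right_left _
    exact h1.of_mul_left_right
  have P : LatticePair p q j ⟨j, 0, p⟩ ⟨s, 1, d⟩ 1 := by
    refine ⟨by simp, by simpa using hs, by simp, Or.inl rfl, (Int.odd_coe_nat p).2 H.odd_p, hd,
      hcop.symm, by simp, hdp, by simp, ?_, by simp, fun _ => hp⟩
    show 1 ≤ p ^ 2 + p
    omega
  have h1 := H.pairSymbol_eq (|(p : ℤ)| + |d|).toNat P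
    (by rw [Int.toNat_of_nonneg (by positivity)]) (by simp) H.even_j (by simp) hsodd
  have h2 : cofactor m h j 0 = X := by
    have h3 : (3 : ℤ) ^ j = 2 ^ h * X + 1 := by exact_mod_cast H.pow_j
    rw [cofactor, h3, pow_zero, add_sub_cancel_right, Int.mul_ediv_cancel_left _ (by positivity)]
  have h4 : 2 ^ h * cofactor m h s 1 = 3 ^ s - (m : ℤ) := by
    simpa using H.two_pow_mul_cofactor P.level_w
  have h5 := jacobiSym_two_sq H.odd_X
  have h6 : J(2 | X) ^ h * J(2 | X) ^ h = 1 := by rw [← mul_pow, h5, one_pow]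
  refine ⟨s, d, hs, hcop, ?_⟩
  simp only [pairSymbol, h2, Int.natAbs_natCast, one_mul] at h1
  rw [← h1, ← h4, jacobiSym.mul_left, jacobiSym.mul_left, jacobiSym.pow_left]
  linear_combination J(cofactor m h s 1 | X) * J(d | p) * h6

end LatticeData

namespace PowerSolution

theorem jacobiSym_neg_two_mul (S : PowerSolution p q m) (hq : 6 ≤ q) : J(-2 * q | p) = 1 := by
  have H := S.latticeData (j := 2) (h := 3) (X := 1) (by decide) le_rfl (by norm_num) (by decide)
    le_rfl hq S.lt
  obtain ⟨s, d, hs, hd, hJ⟩ := H.exists_jacobiSym S.coprime (Nat.coprime_two_right.2 S.odd_p)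
  have h1 : J(2 | p) * J(2 | p) = 1 := jacobiSym_two_sq S.odd_p
  have h2 : J(d | p) = 1 := by
    rw [jacobiSym.one_right, one_mul, one_mul] at hJ
    rw [hJ]
    have h3 : J(2 | p) ^ (3 + 1) = 1 := by linear_combination (J(2 | p) * J(2 | p) + 1) * h1
    rw [h3]
    unfold signModFour
    split_ifs <;> omega
  have h4 : J(-2 * q | p) = J(2 ^ 2 * d | p) := by
    apply jacobiSym.mod_left'
    refine Int.modEq_iff_dvd.2 ⟨2 * s, ?_⟩
    push_cast at hs
    linear_combination (-2) * hs
  rw [h4, jacobiSym.mul_left, jacobiSym.pow_left, h2, sq, h1, one_mul]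

theorem p_mod_four (S : PowerSolution p q m) (hq : 4 * p < q) : p % 4 = 1 := by
  by_contra hp4
  have hp3 := S.three_le
  have hp : p % 4 = 3 := by have := Nat.odd_iff.1 S.odd_p; omega
  have H := S.latticeData (j := 4) (h := 4) (X := 5) (by decide) (by norm_num) (by norm_num)
    (by decide) (by norm_num) (by omega) hq
  obtain ⟨s, d, hs, hd, hJ⟩ := H.exists_jacobiSym S.coprime
    (show Nat.Coprime p (2 ^ 2) from (Nat.coprime_two_right.2 S.odd_p).pow_right 2)
  have h2 : J(2 | p) * J(2 | p) = 1 := jacobiSym_two_sq S.odd_p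
  have h5 : J(2 | 5) = -1 := by norm_num
  have hdJ : J(d | p) = J(-q | p) := by
    have h3 : J((2 : ℤ) ^ 2 * d | p) = J(-q | p) := by
      apply jacobiSym.mod_left'
      refine Int.modEq_iff_dvd.2 ⟨-s, ?_⟩
      push_cast at hs
      linear_combination hs
    rwa [jacobiSym.mul_left, jacobiSym.pow_left, sq, h2, one_mul] at h3
  have h6 := S.jacobiSym_neg_two_mul (by omega)
  rw [show (-2 * q : ℤ) = 2 * -q by ring, jacobiSym.mul_left] at h6
  have h7 : J(2 | 5 * p) = -J(2 | p) := by
    rw [jacobiSym.mul_right' _ (by norm_num) (by omega), h5, neg_one_mul]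
  have h8 : (if (5 * p) % 4 = 1 then signModFour p else 1) = 1 := if_neg (by omega)
  rw [h8, mul_one, h7, hdJ, jacobiSym.mul_left, jacobiSym.pow_left, h5] at hJ
  have key : J(3 ^ s - m | 5) = -1 := by
    generalize J(2 | p) = a at *
    generalize J(-q | p) = b at *
    have ha : a = 1 ∨ a = -1 := mul_self_eq_one_iff.1 h2
    rcases ha with rfl | rfl
    · have : b = 1 := by linarith
      subst this; norm_num at hJ; exact hJ
    · have : b = -1 := by linarith
      subst this; norm_num at hJ; linarith
  have hsp : s * p % 4 = q % 4 := by omega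
  have hs4 : s % 4 = (3 * (q % 4)) % 4 := by
    rw [Nat.mul_mod, hp] at hsp; omega
  have hpow : ∀ (a : ℤ) (n r : ℕ), a ^ 4 ≡ 1 [ZMOD 5] → n % 4 = r → a ^ n ≡ a ^ r [ZMOD 5] := by
    intro a n r ha hn
    subst hn
    have := (ha.pow (n / 4)).mul_right (a ^ (n % 4))
    rwa [← pow_mul, ← pow_add, one_pow, one_mul, Nat.div_add_mod] at this
  have hm0 : (m : ℤ) ^ p = 3 ^ q - 2 ^ q := by linarith [S.eq_int]
  have hq4 : q % 4 = 1 ∨ q % 4 = 3 := by have := Nat.odd_iff.1 S.odd_q; omega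
  have hcases : (m : ℤ) % 5 = 0 ∨ (m : ℤ) ^ 4 ≡ 1 [ZMOD 5] := by
    have : (m : ℤ) % 5 = 0 ∨ (m : ℤ) % 5 = 1 ∨ (m : ℤ) % 5 = 2 ∨ (m : ℤ) % 5 = 3 ∨
      (m : ℤ) % 5 = 4 := by omega
    rcases this with h | h | h | h | h
    · exact Or.inl h
    · exact Or.inr ((show (m : ℤ) ≡ 1 [ZMOD 5] from h).pow 4)
    · exact Or.inr ((show (m : ℤ) ≡ 2 [ZMOD 5] from h).pow 4)
    · exact Or.inr ((show (m : ℤ) ≡ 3 [ZMOD 5] from h).pow 4)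
    · exact Or.inr ((show (m : ℤ) ≡ 4 [ZMOD 5] from h).pow 4)
  have h34 : (3 : ℤ) ^ 4 ≡ 1 [ZMOD 5] := by decide
  have h24 : (2 : ℤ) ^ 4 ≡ 1 [ZMOD 5] := by decide
  rcases hq4 with hq4 | hq4
  all_goals
    have e := (hpow 3 q _ h34 hq4).sub (hpow 2 q _ h24 hq4)
    rw [← hm0] at e
    rw [hq4] at hs4
    have hs3 := hpow 3 s _ h34 hs4
    rcases hcases with h0 | h0
    · have h9 := (show (m : ℤ) ≡ 0 [ZMOD 5] from h0).pow p
      rw [zero_pow (by omega)] at h9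
      exact absurd (h9.symm.trans e) (by decide)
    have h9 := ((hpow m p _ h0 hp).symm.trans e).mul_right (m : ℤ)
    rw [← pow_succ] at h9
    have h10 := h0.symm.trans h9
    norm_num at h10 hs3
  · have h11 : (3 : ℤ) ^ s - m ≡ 1 [ZMOD 5] := by
      rw [Int.ModEq] at h10 hs3 ⊢; omega
    rw [jacobiSym.mod_left' (show ((3 : ℤ) ^ s - m) % (5 : ℕ) = 1 % (5 : ℕ) from h11)] at key
    norm_num at key
  · have h11 : (3 : ℤ) ^ s - m ≡ 4 [ZMOD 5] := by
      rw [Int.ModEq] at h10 hs3 ⊢; omega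
    rw [jacobiSym.mod_left' (show ((3 : ℤ) ^ s - m) % (5 : ℕ) = 4 % (5 : ℕ) from h11)] at key
    norm_num at key

end PowerSolution

theorem jacobiSym_eq_mod {p n : ℕ} (hp4 : p % 4 = 1) (hn : Odd n) :
    J(n | p) = J((p % n : ℕ) | n) := by
  rw [← jacobiSym.quadratic_reciprocity_one_mod_four hp4 hn, jacobiSym.mod_left]
  push_cast
  rfl

namespace PowerSolution

theorem m_modEq_one (S : PowerSolution p q m) {r l : ℕ} (hr : Nat.Coprime 6 r)
    (hl : Nat.totient r ∣ l) (hq : q ≡ 1 [MOD l]) (hp : Nat.Coprime p l) : m ≡ 1 [MOD r] := by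
  have hpow : ∀ a : ℕ, Nat.Coprime a r → a ^ q ≡ a [MOD r] := by
    intro a ha
    obtain ⟨t, ht⟩ := (Nat.modEq_iff_dvd' (by have := S.lt; omega)).1 (hq.symm.of_dvd hl)
    have hq1 : q = Nat.totient r * t + 1 := by have := S.lt; omega
    rw [hq1, pow_succ, pow_mul]
    simpa using ((Nat.ModEq.pow_totient ha).pow t).mul_right a
  have h2 : Nat.Coprime 2 r := Nat.Coprime.coprime_dvd_left (by norm_num) hr
  have h3 : Nat.Coprime 3 r := Nat.Coprime.coprime_dvd_left (by norm_num) hr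
  have h1 : m ^ p ≡ 1 [MOD r] := by
    have h4 := (hpow 2 h2).symm.add_left (m ^ p)
    rw [S.eq] at h4
    exact Nat.ModEq.add_right_cancel' 2 (h4.trans (hpow 3 h3))
  have hm : Nat.Coprime m r := by
    have h4 : Nat.Coprime (m ^ p) r := by rw [Nat.Coprime, h1.gcd_eq, Nat.gcd_one_left]
    exact Nat.Coprime.coprime_dvd_left (dvd_pow_self m S.prime.ne_zero) h4
  have h5 := Nat.ModEq.pow_totient hm
  rw [← ZMod.natCast_eq_natCast_iff] at h1 h5 ⊢
  push_cast at h1 h5 ⊢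
  have h6 : orderOf (m : ZMod r) ∣ 1 := by
    rw [← Nat.Coprime.coprime_dvd_right hl hp]
    exact Nat.dvd_gcd (orderOf_dvd_of_pow_eq_one h1) (orderOf_dvd_of_pow_eq_one h5)
  rwa [Nat.dvd_one, orderOf_eq_one_iff] at h6

theorem false_of_jacobiSym_eq_neg_one (S : PowerSolution p q m) {n l : ℕ} (hp8 : p % 8 = 1)
    (hpow : 3 ^ (2 * n) = 2 ^ 3 * X + 1) (hX : Odd X) (hn : J(n | p) = -1) (hn2 : 2 ≤ n)
    (hnl : 2 * n ∣ l) (hl : 0 < l) (hpl : Nat.Coprime p l) (hqp : q ≡ 1 [MOD p])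
    (hql : q ≡ 1 [MOD l]) (hm : m ≡ 1 [MOD X])
    (hres : ∀ r < 2 * n, Nat.Coprime r (2 * n) → J(2 ^ 3 * (3 ^ r - 1) | X) = 1) : False := by
  have hq0 := S.lt
  have hp3 := S.three_le
  have hlt : 2 * n * p < q := by
    have h1 := (Nat.modEq_and_modEq_iff_modEq_mul hpl).1 ⟨hqp, hql⟩
    obtain ⟨t, ht⟩ := (Nat.modEq_iff_dvd' (by omega)).1 h1.symm
    have ht0 : 0 < t := by
      rcases Nat.eq_zero_or_pos t with h | h
      · rw [h, mul_zero] at ht; omega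
      · exact h
    have h2 : p * (2 * n) ≤ p * l := Nat.mul_le_mul_left p (Nat.le_of_dvd hl hnl)
    have h3 : p * l ≤ p * l * t := Nat.le_mul_of_pos_right _ ht0
    have h4 : 2 * n * p = p * (2 * n) := mul_comm _ _
    omega
  have hpn : Nat.Coprime p (2 * n) := Nat.Coprime.coprime_dvd_right hnl hpl
  have H := S.latticeData (j := 2 * n) (even_two_mul n) (by omega) hpow hX le_rfl (by omega) hlt
  obtain ⟨s, d, hs, hd, hJ⟩ := H.exists_jacobiSym S.coprime hpn
  have hsq : s * p ≡ 1 [MOD 2 * n] := by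
    have h1 : s * p ≡ q [MOD 2 * n] := by
      rw [← Int.natCast_modEq_iff]
      refine (Int.modEq_iff_dvd.2 ⟨d, ?_⟩).symm
      push_cast at hs ⊢
      linear_combination hs
    exact h1.trans (hql.of_dvd hnl)
  have hscop : Nat.Coprime s (2 * n) := by
    have h1 : Nat.Coprime (s * p) (2 * n) := by
      rw [Nat.Coprime, hsq.gcd_eq, Nat.gcd_one_left]
    exact Nat.Coprime.coprime_dvd_left (dvd_mul_right s p) h1
  have h1 : J(2 ^ 3 * (3 ^ s - (m : ℤ)) | X) = 1 := by
    rw [← hres (s % (2 * n)) (Nat.mod_lt _ (by omega))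
      (by rwa [Nat.Coprime, (Nat.mod_modEq s (2 * n)).gcd_eq])]
    apply jacobiSym.mod_left'
    refine Int.ModEq.mul_left _ (Int.ModEq.sub ?_ ?_)
    · have h2 : (3 : ℤ) ^ (2 * n) ≡ 1 [ZMOD X] := by
        have : (3 : ℤ) ^ (2 * n) = 2 ^ 3 * X + 1 := by exact_mod_cast hpow
        rw [this]
        exact (Int.modEq_iff_dvd.2 ⟨-2 ^ 3, by ring⟩)
      have h3 := (h2.pow (s / (2 * n))).mul_right (3 ^ (s % (2 * n)))
      rwa [← pow_mul, ← pow_add, one_pow, one_mul, Nat.div_add_mod] at h3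
    · exact_mod_cast (Int.natCast_modEq_iff.2 hm)
  have h2p : J(2 | p) = 1 := by
    rw [jacobiSym_two_congr (b := 1) S.odd_p (by omega), jacobiSym.one_right]
  have hdp : J(d | p) = 1 := by
    have h2 : (if (X * p) % 4 = 1 then signModFour p else 1) = 1 := by
      unfold signModFour
      split_ifs <;> omega
    have h3 := jacobiSym_two_sq H.odd_mul
    rw [h1, h2, one_mul, mul_one] at hJ
    rw [hJ]
    linear_combination (J(2 | X * p) * J(2 | X * p) + 1) * h3
  have h3 : J(2 * n * d | p) = J(-1 | p) := by
    apply jacobiSym.mod_left'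
    have h4 : (q : ℤ) ≡ 1 [ZMOD p] := by exact_mod_cast Int.natCast_modEq_iff.2 hqp
    have h5 : (2 * n * d : ℤ) ≡ -q [ZMOD p] :=
      Int.modEq_iff_dvd.2 ⟨-s, by push_cast at hs; linear_combination hs⟩
    exact h5.trans h4.neg
  rw [jacobiSym.mul_left, jacobiSym.mul_left, h2p, hn, hdp, jacobiSym.at_neg_one S.odd_p,
    ZMod.χ₄_nat_one_mod_four (by omega)] at h3
  norm_num at h3

theorem false_of_three (S : PowerSolution p q m) (hp8 : p % 8 = 1) (hp : p % 3 = 2)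
    (hpl : Nat.Coprime p 12) (hqp : q ≡ 1 [MOD p]) (hql : q ≡ 1 [MOD 12]) : False := by
  refine S.false_of_jacobiSym_eq_neg_one (n := 3) (X := 91) (l := 12) hp8 (by norm_num) (by decide)
    ?_ (by norm_num) (by norm_num) (by norm_num) hpl hqp hql ?_ ?_
  · rw [jacobiSym_eq_mod (by omega) (by decide), hp]; norm_num
  · have h1 := S.m_modEq_one (r := 7) (by norm_num) (by decide) hql hpl
    have h2 := S.m_modEq_one (r := 13) (by norm_num) (by decide) hql hpl
    exact (Nat.modEq_and_modEq_iff_modEq_mul (by norm_num)).1 ⟨h1, h2⟩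
  · intro r hr hc
    interval_cases r <;> first | (norm_num; done) | (exact absurd hc (by norm_num))

theorem false_of_five (S : PowerSolution p q m) (hp8 : p % 8 = 1) (hp : p % 5 = 2 ∨ p % 5 = 3)
    (hpl : Nat.Coprime p 660) (hqp : q ≡ 1 [MOD p]) (hql : q ≡ 1 [MOD 660]) : False := by
  refine S.false_of_jacobiSym_eq_neg_one (n := 5) (X := 7381) (l := 660) hp8 (by norm_num)
    (by decide) ?_ (by norm_num) (by norm_num) (by norm_num) hpl hqp hql ?_ ?_
  · rw [jacobiSym_eq_mod (by omega) (by decide)]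
    rcases hp with h | h <;> rw [h] <;> norm_num
  · have h1 := S.m_modEq_one (r := 121) (by norm_num) (by decide +kernel) hql hpl
    have h2 := S.m_modEq_one (r := 61) (by norm_num) (by decide +kernel) hql hpl
    exact (Nat.modEq_and_modEq_iff_modEq_mul (by norm_num)).1 ⟨h1, h2⟩
  · intro r hr hc
    interval_cases r <;> first | (norm_num; done) | (exact absurd hc (by norm_num))

theorem false_of_seven (S : PowerSolution p q m) (hp8 : p % 8 = 1)
    (hp : p % 7 = 3 ∨ p % 7 = 5 ∨ p % 7 = 6)
    (hpl : Nat.Coprime p 1092) (hqp : q ≡ 1 [MOD p]) (hql : q ≡ 1 [MOD 1092]) : False := by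
  refine S.false_of_jacobiSym_eq_neg_one (n := 7) (X := 597871) (l := 1092) hp8 (by norm_num)
    (by decide) ?_ (by norm_num) (by norm_num) (by norm_num) hpl hqp hql ?_ ?_
  · rw [jacobiSym_eq_mod (by omega) (by decide)]
    rcases hp with h | h | h <;> rw [h] <;> norm_num
  · have h1 := S.m_modEq_one (r := 1093) (by norm_num)
      (by rw [Nat.totient_prime (by norm_num)]) hql hpl
    have h2 := S.m_modEq_one (r := 547) (by norm_num)
      (by rw [Nat.totient_prime (by norm_num)]; norm_num) hql hpl
    exact (Nat.modEq_and_modEq_iff_modEq_mul (by norm_num)).1 ⟨h1, h2⟩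
  · intro r hr hc
    interval_cases r <;> first | (norm_num; done) | (exact absurd hc (by norm_num))

theorem false_of_eleven (S : PowerSolution p q m) (hp8 : p % 8 = 1)
    (hp : p % 11 = 2 ∨ p % 11 = 6 ∨ p % 11 = 7 ∨ p % 11 = 8 ∨ p % 11 = 10)
    (hpl : Nat.Coprime p 23100) (hqp : q ≡ 1 [MOD p]) (hql : q ≡ 1 [MOD 23100]) : False := by
  refine S.false_of_jacobiSym_eq_neg_one (n := 11) (X := 23 * 67 * 661 * 3851) (l := 23100) hp8
    (by norm_num) (by decide +kernel) ?_ (by norm_num) (by norm_num) (by norm_num) hpl hqp hql ?_ ?_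
  · rw [jacobiSym_eq_mod (by omega) (by decide)]
    rcases hp with h | h | h | h | h <;> rw [h] <;> norm_num
  · have h1 := S.m_modEq_one (r := 23) (by norm_num)
      (by rw [Nat.totient_prime (by norm_num)]; norm_num) hql hpl
    have h2 := S.m_modEq_one (r := 67) (by norm_num)
      (by rw [Nat.totient_prime (by norm_num)]; norm_num) hql hpl
    have h3 := S.m_modEq_one (r := 661) (by norm_num)
      (by rw [Nat.totient_prime (by norm_num)]; norm_num) hql hpl
    have h4 := S.m_modEq_one (r := 3851) (by norm_num)
      (by rw [Nat.totient_prime (by norm_num)]; norm_num) hql hpl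
    have h5 := (Nat.modEq_and_modEq_iff_modEq_mul (by norm_num)).1 ⟨h1, h2⟩
    have h6 := (Nat.modEq_and_modEq_iff_modEq_mul (by norm_num)).1 ⟨h5, h3⟩
    exact (Nat.modEq_and_modEq_iff_modEq_mul (by norm_num)).1 ⟨h6, h4⟩
  · intro r hr hc
    interval_cases r <;> first | (norm_num; done) | (exact absurd hc (by norm_num))

end PowerSolution

/-- The conjunction of `f i` over `i < n`. -/
noncomputable def allBelow (f : ℕ → Bool) (n : ℕ) : Bool :=
  Nat.rec true (fun i b => f i && b) n

theorem allBelow_spec {f : ℕ → Bool} {n : ℕ} (hf : allBelow f n = true) {i : ℕ} (hi : i < n) :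
    f i = true := by
  induction n with
  | zero => omega
  | succ n ih =>
    simp only [allBelow, Bool.and_eq_true] at hf
    rcases Nat.lt_succ_iff_lt_or_eq.1 hi with h | rfl
    · exact ih hf.2 h
    · exact hf.1

/-- Trial division for odd numbers below `1211 ^ 2`. -/
noncomputable def trialDivision (r : ℕ) : Bool :=
  Nat.blt 1 r && Nat.blt r 1466521 &&
    allBelow (fun i => Nat.ble r (2 * i + 3) || !Nat.beq (r % (2 * i + 3)) 0) 605

theorem prime_of_trialDivision {r : ℕ} (hr : Odd r) (hc : trialDivision r = true) : r.Prime := by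
  simp only [trialDivision, Bool.and_eq_true, Nat.blt_eq] at hc
  obtain ⟨⟨h1, h2⟩, h3⟩ := hc
  by_contra hp
  have h4 := Nat.minFac_sq_le_self (by omega) hp
  have h5 := (Nat.not_prime_iff_minFac_lt h1).1 hp
  have h6 : r.minFac < 1211 := by nlinarith
  have h7 := Nat.minFac_prime (n := r) (by omega)
  have h8 : Odd r.minFac := hr.of_dvd_nat (Nat.minFac_dvd r)
  obtain ⟨t, ht⟩ := h8
  have h9 := h7.two_le
  have h10 := allBelow_spec h3 (i := t - 1) (by omega)
  have h11 : 2 * (t - 1) + 3 = r.minFac := by omega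
  have h12 := Nat.mod_eq_zero_of_dvd (Nat.minFac_dvd r)
  simp only [h11, h12, Bool.or_eq_true, Nat.ble_eq] at h10
  rcases h10 with h | h
  · omega
  · simp at h

/-- Whether `3 ^ a - 2 ^ a` fails to be a `p`-th power residue modulo `2 * k * p + 1`. -/
def isNonresidue (p k a : ℕ) : Bool :=
  (fun r c => !Nat.beq c 0 && !Nat.beq (Nat.mod (Nat.pow c (Nat.mul 2 k)) r) 1) (2 * k * p + 1)
    (Nat.mod (Nat.add (Nat.pow 3 a)
      (Nat.sub (2 * k * p + 1) (Nat.mod (Nat.pow 2 a) (2 * k * p + 1)))) (2 * k * p + 1))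

/-- Refine the congruence `q ≡ a` modulo `M` by the primes `2 * k * p + 1` of the list, and
check that the property `final` holds for all surviving residue classes. -/
noncomputable def sieve (p : ℕ) (final : ℕ → ℕ → Bool) : List (ℕ × ℕ) → ℕ → ℕ → Bool
  | [], M, a => final M a
  | (k, f) :: L, M, a =>
    Nat.beq (M * f % (2 * k * p)) 0 && allBelow (fun i =>
      isNonresidue p k ((a + M * i) % (2 * k * p)) || sieve p final L (M * f) (a + M * i)) f

/-- Check that the list `L` yields primes `2 * k * p + 1`. -/
noncomputable def checkPrimes (p : ℕ) (L : List (ℕ × ℕ)) : Bool :=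
  L.all fun x => Nat.blt 0 x.1 && Nat.blt 0 x.2 && trialDivision (2 * x.1 * p + 1)

theorem exists_lift {q a M f : ℕ} (hf : 0 < f) (hq : q ≡ a [MOD M]) :
    ∃ i < f, q ≡ a + M * i [MOD M * f] := by
  obtain ⟨t, ht⟩ := (Int.modEq_iff_dvd.1 (Int.natCast_modEq_iff.2 hq.symm))
  have h1 := Int.emod_nonneg t (show (f : ℤ) ≠ 0 by omega)
  have h2 := Int.emod_lt_of_pos t (show (0 : ℤ) < f by omega)
  refine ⟨(t % f).toNat, by omega, ?_⟩
  rw [← Int.natCast_modEq_iff]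
  refine (Int.modEq_iff_dvd.2 ⟨t / f, ?_⟩).symm
  push_cast
  rw [Int.toNat_of_nonneg h1]
  linear_combination ht - M * Int.emod_add_mul_ediv t f

namespace PowerSolution

theorem isNonresidue_eq_false (S : PowerSolution p q m) {k a : ℕ} (hr : (2 * k * p + 1).Prime)
    (hk : 0 < k) (hqa : q ≡ a [MOD 2 * k * p]) : isNonresidue p k a = false := by
  have hp := S.three_le
  have hkp : 3 ≤ k * p := by nlinarith
  have hunf : isNonresidue p k a = (fun r c => !Nat.beq c 0 && !Nat.beq (c ^ (2 * k) % r) 1)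
      (2 * k * p + 1) ((3 ^ a + (2 * k * p + 1 - 2 ^ a % (2 * k * p + 1))) % (2 * k * p + 1)) := rfl
  rw [hunf]
  obtain ⟨r, hrdef⟩ : ∃ r, r = 2 * k * p + 1 := ⟨_, rfl⟩
  rw [← hrdef] at hr ⊢
  have hr1 : r - 1 = 2 * k * p := by omega
  have := Fact.mk hr
  have hr7 : 7 ≤ r := by rw [hrdef, mul_assoc]; omega
  have hpow : ∀ b : ℕ, 0 < b → b < r → (b : ZMod r) ^ q = (b : ZMod r) ^ a := by
    intro b hb0 hbr
    have hb : (b : ZMod r) ≠ 0 := by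
      rw [Ne, ZMod.natCast_eq_zero_iff]
      exact fun hd => absurd (Nat.le_of_dvd hb0 hd) (by omega)
    have h1 : orderOf (b : ZMod r) ∣ 2 * k * p :=
      hr1 ▸ orderOf_dvd_of_pow_eq_one (ZMod.pow_card_sub_one_eq_one hb)
    rw [← pow_mod_orderOf (b : ZMod r) q, hqa.of_dvd h1, pow_mod_orderOf]
  obtain ⟨c, hcdef⟩ : ∃ c, c = (3 ^ a + (r - 2 ^ a % r)) % r := ⟨_, rfl⟩
  have hc : (c : ZMod r) = (m : ZMod r) ^ p := by
    have h2 : 2 ^ a % r ≤ r := (Nat.mod_lt _ (by omega)).le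
    have h3 : (m : ZMod r) ^ p + 2 ^ q = 3 ^ q := by exact_mod_cast congrArg (Nat.cast) S.eq
    have h4 := hpow 3 (by norm_num) (by omega)
    have h5 := hpow 2 (by norm_num) (by omega)
    push_cast at h4 h5
    rw [hcdef, ZMod.natCast_mod, Nat.cast_add, Nat.cast_sub h2, ZMod.natCast_mod,
      ZMod.natCast_self]
    push_cast
    linear_combination h5 - h4 - h3
  have hcr : c < r := hcdef ▸ Nat.mod_lt _ (by omega)
  simp only [← hcdef]
  by_cases hm : (m : ZMod r) = 0
  · have h1 : c = 0 := by
      rw [hm, zero_pow (by omega), ZMod.natCast_eq_zero_iff] at hc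
      exact Nat.eq_zero_of_dvd_of_lt hc hcr
    simp [h1]
  · have h1 : c ^ (2 * k) % r = 1 := by
      have h2 : ((c ^ (2 * k) : ℕ) : ZMod r) = ((1 : ℕ) : ZMod r) := by
        rw [Nat.cast_pow, hc, ← pow_mul, mul_comm p, ← hr1, ZMod.pow_card_sub_one_eq_one hm,
          Nat.cast_one]
      have h3 := (ZMod.natCast_eq_natCast_iff _ _ _).1 h2
      rw [h3, Nat.mod_eq_of_lt (by omega)]
    simp [h1]

theorem exists_final_of_sieve (S : PowerSolution p q m) {final : ℕ → ℕ → Bool}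
    {L : List (ℕ × ℕ)} (hL : checkPrimes p L = true) : ∀ {M a : ℕ}, q ≡ a [MOD M] →
      sieve p final L M a = true → ∃ M' a', q ≡ a' [MOD M'] ∧ final M' a' = true := by
  induction L with
  | nil => exact fun {M a} hq hs => ⟨M, a, hq, hs⟩
  | cons x L ih =>
    obtain ⟨k, f⟩ := x
    intro M a hq hs
    simp only [checkPrimes, List.all_cons, Bool.and_eq_true, Nat.blt_eq] at hL
    obtain ⟨⟨⟨hk, hf⟩, hr⟩, hL⟩ := hL
    simp only [sieve, Bool.and_eq_true, Nat.beq_eq] at hs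
    obtain ⟨hd, hall⟩ := hs
    obtain ⟨i, hi, hqi⟩ := exists_lift hf hq
    have h1 := allBelow_spec hall hi
    have h2 := S.isNonresidue_eq_false
      (prime_of_trialDivision ⟨k * p, by ring⟩ hr) hk
      ((hqi.of_dvd (Nat.dvd_of_mod_eq_zero hd)).trans (Nat.mod_modEq _ _).symm)
    rw [h2, Bool.false_or] at h1
    exact ih hL hqi h1

end PowerSolution

/-- Sieving data for an exponent `p`: the primes excluding most residue classes of `q` modulo
`p`, and for `p ≡ 1` modulo `8` a list of moduli `l`, with the primes showing that `q ≡ 1`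
modulo `l`. -/
structure SieveData where
  p : ℕ
  primes : List (ℕ × ℕ)
  moduli : List (ℕ × List (ℕ × ℕ))

namespace SieveData

/-- Check that `q` is a quadratic nonresidue or `1` modulo `p`, according to the class of `p`. -/
noncomputable def checkResidue (D : SieveData) : Bool :=
  checkPrimes D.p D.primes && allBelow (fun a => Nat.beq (a % 2) 0 || Nat.beq (a % D.p) 0 ||
    sieve D.p (fun M a => Nat.beq (M % D.p) 0 &&
      bif Nat.beq (D.p % 8) 1 then Nat.beq (a % D.p) 1
      else Nat.beq ((2 * a) ^ (D.p / 2) % D.p) (D.p - 1)) D.primes (2 * D.p) a) (2 * D.p)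

/-- Check that `q ≡ 1` modulo all the moduli. -/
noncomputable def checkModuli (D : SieveData) : List (ℕ × List (ℕ × ℕ)) → Bool
  | [] => true
  | (l, L) :: T =>
    checkPrimes D.p L && sieve D.p (fun M a => Nat.beq (M % l) 0 && Nat.beq (a % l) 1) L
      (2 * D.p) 1 && checkModuli D T

/-- The least common multiple of the moduli. -/
def level : List (ℕ × List (ℕ × ℕ)) → ℕ
  | [] => 1
  | (l, _) :: T => Nat.lcm l (level T)

/-- Check that `p` is excluded by one of the auxiliary exponents `6`, `10`, `14`, `22`. -/
def checkLevel (p l : ℕ) : Bool :=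
  Nat.beq (Nat.gcd p l) 1 &&
    (Nat.beq l 12 && Nat.beq (p % 3) 2 ||
      Nat.beq l 660 && (Nat.beq (p % 5) 2 || Nat.beq (p % 5) 3) ||
      Nat.beq l 1092 && (Nat.beq (p % 7) 3 || Nat.beq (p % 7) 5 || Nat.beq (p % 7) 6) ||
      Nat.beq l 23100 && (Nat.beq (p % 11) 2 || Nat.beq (p % 11) 6 || Nat.beq (p % 11) 7 ||
        Nat.beq (p % 11) 8 || Nat.beq (p % 11) 10))

/-- The complete check for one exponent. -/
noncomputable def check (D : SieveData) : Bool :=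
  D.checkResidue && (Nat.beq (D.p % 8) 5 ||
    Nat.beq (D.p % 8) 1 && D.checkModuli D.moduli && checkLevel D.p (level D.moduli))

theorem level_dvd (D : SieveData) {m : ℕ} (S : PowerSolution D.p q m) (hq : q ≡ 1 [MOD 2 * D.p])
    (T : List (ℕ × List (ℕ × ℕ))) (hT : D.checkModuli T = true) : level T ∣ q - 1 := by
  induction T with
  | nil => exact one_dvd _
  | cons x T ih =>
    obtain ⟨l, L⟩ := x
    simp only [checkModuli, Bool.and_eq_true] at hT
    refine Nat.lcm_dvd ?_ (ih hT.2)
    obtain ⟨M, a, hqa, hfin⟩ := S.exists_final_of_sieve hT.1.1 hq hT.1.2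
    simp only [Bool.and_eq_true, Nat.beq_eq] at hfin
    have h1 := hqa.of_dvd (Nat.dvd_of_mod_eq_zero hfin.1)
    have h2 : q ≡ 1 [MOD l] := by
      refine h1.trans ?_
      rw [← hfin.2]
      exact (Nat.mod_modEq a l).symm
    exact (Nat.modEq_iff_dvd' (by have := S.lt; omega)).1 h2.symm

theorem false_of_check (D : SieveData) {m : ℕ} (S : PowerSolution D.p q m) (hq6 : 6 ≤ q)
    (hD : D.check = true) : False := by
  have hp3 := S.three_le
  have hlt := S.lt
  obtain ⟨hres, hrest⟩ := Bool.and_eq_true_iff.1 hD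
  rw [checkResidue, Bool.and_eq_true] at hres
  have h1 := allBelow_spec hres.2 (i := q % (2 * D.p)) (Nat.mod_lt _ (by omega))
  have h2 : q % (2 * D.p) % 2 = 1 := by
    rw [Nat.mod_mod_of_dvd _ (dvd_mul_right 2 _)]; exact Nat.odd_iff.1 S.odd_q
  have h3 : q % (2 * D.p) % D.p ≠ 0 := by
    rw [Nat.mod_mod_of_dvd _ (dvd_mul_left _ 2)]
    intro h
    exact (Nat.Prime.coprime_iff_not_dvd S.prime).1 S.coprime (Nat.dvd_of_mod_eq_zero h)
  simp only [Bool.or_eq_true, Nat.beq_eq, h2, h3, one_ne_zero, false_or] at h1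
  obtain ⟨M, a, hqa, hfin⟩ := S.exists_final_of_sieve hres.1
    (Nat.mod_modEq q (2 * D.p)).symm h1
  simp only [Bool.and_eq_true, Nat.beq_eq] at hfin
  have h4 := hqa.of_dvd (Nat.dvd_of_mod_eq_zero hfin.1)
  simp only [Bool.or_eq_true, Bool.and_eq_true, Nat.beq_eq] at hrest
  rcases hrest with h5 | ⟨⟨h5, h6⟩, h7⟩
  · have h8 : Nat.beq (D.p % 8) 1 = false := by rw [h5]; rfl
    rw [h8] at hfin
    have h9 : (2 * a) ^ (D.p / 2) % D.p = D.p - 1 := by simpa using hfin.2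
    have := Fact.mk S.prime
    have h10 := S.jacobiSym_neg_two_mul hq6
    rw [show (-2 * q : ℤ) = -1 * (2 * q : ℕ) by push_cast; ring, jacobiSym.mul_left,
      jacobiSym.at_neg_one S.odd_p, ZMod.χ₄_nat_one_mod_four (by omega), one_mul,
      ← jacobiSym.legendreSym.to_jacobiSym] at h10
    have h11 := legendreSym.eq_pow D.p (2 * q : ℕ)
    rw [h10] at h11
    have h12 : ((2 * q : ℕ) : ZMod D.p) = ((2 * a : ℕ) : ZMod D.p) :=
      (ZMod.natCast_eq_natCast_iff _ _ _).2 (h4.mul_left 2)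
    have h13 : (((2 * a) ^ (D.p / 2) : ℕ) : ZMod D.p) = -1 := by
      rw [← ZMod.natCast_mod, h9, Nat.cast_sub (by omega), ZMod.natCast_self]; simp
    rw [Int.cast_natCast, h12, ← Nat.cast_pow, h13] at h11
    have := Fact.mk (show 2 < D.p by omega)
    exact ZMod.neg_one_ne_one (by simpa using h11.symm)
  · rw [h5] at hfin
    have h8 : a % D.p = 1 := by simpa using hfin.2
    have hqp : q ≡ 1 [MOD D.p] := by
      refine h4.trans ?_
      rw [← h8]
      exact (Nat.mod_modEq a D.p).symm
    have hq2 : q ≡ 1 [MOD 2] := Nat.odd_iff.1 S.odd_q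
    have hq2p : q ≡ 1 [MOD 2 * D.p] :=
      (Nat.modEq_and_modEq_iff_modEq_mul (Nat.coprime_two_left.2 S.odd_p)).1 ⟨hq2, hqp⟩
    have hl : q ≡ 1 [MOD level D.moduli] :=
      ((Nat.modEq_iff_dvd' (by omega)).2 (D.level_dvd S hq2p D.moduli h6)).symm
    simp only [checkLevel, Bool.or_eq_true, Bool.and_eq_true, Nat.beq_eq] at h7
    obtain ⟨hg, ((⟨e, h⟩ | ⟨e, h⟩) | ⟨e, h⟩) | ⟨e, h⟩⟩ := h7 <;> rw [e] at hg hl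
    · exact S.false_of_three h5 h hg hqp hl
    · exact S.false_of_five h5 h hg hqp hl
    · exact S.false_of_seven h5 (by omega) hg hqp hl
    · exact S.false_of_eleven h5 (by omega) hg hqp hl

end SieveData

/-- Sieving data for the primes `p ≡ 1` modulo `4` below `1361`. -/
def sieveTable : List SieveData := [
  ⟨5, [(1, 1)], []⟩, ⟨13, [(2, 2), (3, 3)], []⟩, ⟨17, [(3, 3), (12, 4)], [(4, [(4, 4)]),
  (3, [(3, 3)])]⟩, ⟨29, [(1, 1)], []⟩, ⟨37, [(2, 2), (3, 3)], []⟩, ⟨41, [(1, 1),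
  (9, 9)], [(4, [(28, 28)]), (3, [(9, 9)])]⟩, ⟨53, [(1, 1)], []⟩, ⟨61, [(3, 3), (6, 2)], []⟩,
  ⟨73, [(2, 2)], [(4, [(6, 6)]), (3, [(6, 6)]), (5, [(21, 21), (105, 5)]), (11, [(11, 11)])]⟩,
  ⟨89, [(1, 1), (6, 6)], [(4, [(6, 6)]), (3, [(6, 6)])]⟩, ⟨97, [(2, 2), (8, 4)], [(4, [(8, 8)]),
  (3, [(9, 9)]), (5, [(5, 5)]), (11, [(9, 9), (99, 11)])]⟩, ⟨101, [(3, 3)], []⟩, ⟨109, [(5, 5),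
  (15, 3)], []⟩, ⟨113, [(1, 1), (7, 7)], [(4, [(16, 16)]), (3, [(15, 15)])]⟩, ⟨137, [(3, 3),
  (9, 3)], [(4, [(4, 4)]), (3, [(9, 9)])]⟩, ⟨149, [(4, 4), (6, 3)], []⟩, ⟨157, [(5, 5),
  (30, 6)], []⟩, ⟨173, [(1, 1)], []⟩, ⟨181, [(3, 3)], []⟩, ⟨193, [(2, 2), (8, 4)], [(4, [(8, 8)]),
  (3, [(5, 5), (15, 3)]), (5, [(5, 5)]), (11, [(33, 33)])]⟩, ⟨197, [(9, 9), (27, 3)], []⟩,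
  ⟨229, [(6, 6), (15, 5)], []⟩, ⟨233, [(1, 1), (3, 3)], [(4, [(6, 6)]), (3, [(15, 15)])]⟩,
  ⟨241, [(3, 3), (9, 3)], [(4, [(3, 3), (18, 6)]), (3, [(3, 3)]), (7, [(5, 5), (35, 7)]),
  (13, [(11, 11), (143, 13)])]⟩, ⟨257, [(3, 3)], [(4, [(3, 3), (42, 14)]), (3, [(3, 3)])]⟩,
  ⟨269, [(4, 4), (16, 4)], []⟩, ⟨277, [(2, 2)], []⟩, ⟨281, [(1, 1)], [(4, [(6, 6)]),
  (3, [(9, 9)])]⟩, ⟨293, [(1, 1), (3, 3)], []⟩, ⟨313, [(3, 3), (15, 5)], [(4, [(8, 8)]),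
  (3, [(3, 3)]), (5, [(3, 3), (15, 5)]), (11, [(3, 3), (132, 44)])]⟩, ⟨317, [(13, 13),
  (52, 4)], []⟩, ⟨337, [(5, 5)], [(4, [(8, 8)]), (3, [(9, 9)]), (5, [(15, 15)]),
  (11, [(77, 77)])]⟩, ⟨349, [(5, 5), (12, 12)], []⟩, ⟨353, [(7, 7)], [(4, [(48, 48)]),
  (3, [(21, 21)])]⟩, ⟨373, [(2, 2)], []⟩, ⟨389, [(12, 12)], []⟩, ⟨397, [(3, 3)], []⟩,
  ⟨401, [(4, 4), (6, 3)], [(4, [(4, 4)]), (3, [(9, 9)])]⟩, ⟨409, [(2, 2), (6, 3)], [(4, [(6, 6)]),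
  (3, [(6, 6)]), (7, [(5, 5), (35, 7)]), (13, [(5, 5), (65, 13)])]⟩, ⟨421, [(5, 5), (30, 6)], []⟩,
  ⟨433, [(2, 2)], [(4, [(6, 6)]), (3, [(33, 33)]), (5, [(20, 20)]), (11, [(77, 77)])]⟩,
  ⟨449, [(4, 4), (16, 4)], [(4, [(4, 4)]), (3, [(27, 27)])]⟩, ⟨457, [(15, 15),
  (45, 3)], [(4, [(18, 18)]), (3, [(15, 15)]), (5, [(15, 15)]), (11, [(77, 77)])]⟩, ⟨461, [(3, 3),
  (15, 5)], []⟩, ⟨509, [(1, 1)], []⟩, ⟨521, [(16, 16), (40, 5)], [(4, [(16, 16)]),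
  (3, [(63, 63)])]⟩, ⟨541, [(9, 9), (18, 2)], []⟩, ⟨557, [(3, 3)], []⟩,
  ⟨569, [(6, 6)], [(4, [(6, 6)]), (3, [(21, 21)])]⟩, ⟨577, [(2, 2)], [(4, [(3, 3), (18, 6)]),
  (3, [(3, 3)]), (5, [(20, 20)]), (11, [(3, 3), (33, 11)])]⟩, ⟨593, [(1, 1),
  (3, 3)], [(4, [(40, 40)]), (3, [(3, 3)])]⟩, ⟨601, [(3, 3)], [(4, [(6, 6)]), (3, [(21, 21)]),
  (7, [(21, 21)]), (13, [(26, 26)])]⟩, ⟨613, [(5, 5), (30, 6)], []⟩, ⟨617, [(4, 4),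
  (48, 12)], [(4, [(4, 4)]), (3, [(30, 30)])]⟩, ⟨641, [(1, 1)], [(4, [(28, 28)]), (3, [(3, 3)])]⟩,
  ⟨653, [(1, 1)], []⟩, ⟨661, [(3, 3)], []⟩, ⟨673, [(2, 2)], [(4, [(18, 18)]), (3, [(27, 27)]),
  (5, [(65, 65)]), (11, [(77, 77)])]⟩, ⟨677, [(4, 4), (12, 3)], []⟩, ⟨701, [(9, 9), (18, 2)], []⟩,
  ⟨709, [(2, 2), (14, 7)], []⟩, ⟨733, [(5, 5), (15, 3)], []⟩, ⟨757, [(8, 8), (12, 3)], []⟩,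
  ⟨761, [(1, 1), (3, 3)], [(4, [(4, 4)]), (3, [(3, 3)])]⟩, ⟨769, [(5, 5),
  (15, 3)], [(4, [(12, 12)]), (3, [(5, 5), (15, 3)]), (7, [(21, 21)]), (13, [(26, 26)])]⟩,
  ⟨773, [(3, 3), (6, 2)], []⟩, ⟨797, [(3, 3), (9, 3)], []⟩, ⟨809, [(1, 1),
  (4, 4)], [(4, [(4, 4)]), (3, [(9, 9)])]⟩, ⟨821, [(4, 4), (10, 5)], []⟩, ⟨829, [(5, 5),
  (20, 4)], []⟩, ⟨853, [(2, 2), (3, 3)], []⟩, ⟨857, [(4, 4), (9, 9)], [(4, [(4, 4)]),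
  (3, [(9, 9)])]⟩, ⟨877, [(8, 8), (20, 5)], []⟩, ⟨881, [(9, 9), (15, 5)], [(4, [(15, 15),
  (30, 2)]), (3, [(9, 9)])]⟩, ⟨929, [(4, 4), (6, 3)], [(4, [(4, 4)]), (3, [(7, 7), (21, 3)])]⟩,
  ⟨937, [(3, 3), (5, 5)], [(4, [(44, 44)]), (3, [(3, 3)]), (5, [(5, 5)]), (11, [(3, 3),
  (33, 11)])]⟩, ⟨941, [(3, 3)], []⟩, ⟨953, [(1, 1), (6, 6)], [(4, [(6, 6)]), (3, [(6, 6)])]⟩,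
  ⟨977, [(4, 4), (10, 5)], [(4, [(4, 4)]), (3, [(15, 15)])]⟩, ⟨997, [(2, 2)], []⟩, ⟨1009, [(5, 5),
  (15, 3)], [(4, [(6, 6)]), (3, [(6, 6)]), (25, [(5, 5), (575, 115)]), (7, [(21, 21)]),
  (11, [(77, 77)])]⟩, ⟨1013, [(1, 1)], []⟩, ⟨1021, [(5, 5), (15, 3)], []⟩, ⟨1033, [(2, 2),
  (3, 3)], [(4, [(8, 8)]), (3, [(12, 12)]), (5, [(30, 30)]), (11, [(143, 143)])]⟩,
  ⟨1049, [(1, 1)], [(4, [(6, 6)]), (3, [(6, 6)])]⟩, ⟨1061, [(3, 3)], []⟩, ⟨1069, [(5, 5),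
  (6, 6)], []⟩, ⟨1093, [(2, 2)], []⟩, ⟨1097, [(7, 7), (49, 7)], [(4, [(52, 52)]),
  (3, [(27, 27)])]⟩, ⟨1109, [(6, 6), (9, 3)], []⟩, ⟨1117, [(3, 3), (9, 3)], []⟩, ⟨1129, [(2, 2),
  (9, 9)], [(4, [(20, 20)]), (3, [(9, 9)]), (25, [(15, 15), (375, 25)]), (7, [(21, 21)]),
  (11, [(77, 77)])]⟩, ⟨1153, [(11, 11), (33, 3), (66, 2)], [(4, [(12, 12)]), (3, [(12, 12)]),
  (5, [(15, 15)]), (11, [(33, 33)])]⟩, ⟨1181, [(6, 6), (21, 7)], []⟩, ⟨1193, [(3, 3),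
  (7, 7)], [(4, [(16, 16)]), (3, [(3, 3)])]⟩, ⟨1201, [(3, 3), (5, 5)], [(4, [(18, 18)]),
  (3, [(24, 24)]), (25, [(375, 375)]), (7, [(14, 14)]), (11, [(11, 11)])]⟩, ⟨1213, [(6, 6),
  (18, 3)], []⟩, ⟨1217, [(12, 12), (24, 2)], [(4, [(12, 12), (24, 2)]), (3, [(12, 12)])]⟩,
  ⟨1229, [(1, 1)], []⟩, ⟨1237, [(8, 8), (24, 3)], []⟩, ⟨1249, [(5, 5)], [(4, [(30, 30)]),
  (3, [(9, 9)]), (7, [(11, 11), (77, 7)]), (13, [(39, 39)])]⟩, ⟨1277, [(10, 10), (40, 4)], []⟩,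
  ⟨1289, [(1, 1), (4, 4)], [(4, [(4, 4)]), (3, [(9, 9)])]⟩, ⟨1297, [(2, 2),
  (8, 4)], [(4, [(8, 8)]), (3, [(27, 27)]), (5, [(45, 45)]), (11, [(77, 77)])]⟩,
  ⟨1301, [(10, 10)], []⟩, ⟨1321, [(3, 3), (15, 5)], [(4, [(3, 3), (24, 8)]), (3, [(3, 3)]),
  (7, [(3, 3), (105, 35)]), (13, [(3, 3), (78, 26)])]⟩]

theorem sieveTable_check : sieveTable.all SieveData.check = true := by decide +kernel

/-- `sieveTable` covers all primes below `1361` congruent to `1` modulo `4`. -/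
theorem sieveTable_complete {p : ℕ} (hp : p.Prime) (hp4 : p % 4 = 1) (hlt : p < 1361) :
    ∃ D ∈ sieveTable, D.p = p := by
  have h : ∀ i < 340, i = 0 ∨
      (∃ d ∈ [3, 5, 7, 11, 13, 17, 19, 23, 29, 31], d < 4 * i + 1 ∧ (4 * i + 1) % d = 0) ∨
      ∃ D ∈ sieveTable, D.p = 4 * i + 1 := by decide +kernel
  have hi : 4 * (p / 4) + 1 = p := by omega
  have h1 := hp.two_le
  rcases h (p / 4) (by omega) with h2 | ⟨d, hd, h2, h3⟩ | h2
  · omega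
  · rw [hi] at h2 h3
    rcases (Nat.dvd_prime hp).1 (Nat.dvd_of_mod_eq_zero h3) with rfl | rfl
    · simp at hd
    · omega
  · rwa [hi] at h2

theorem PowerSolution.le_of_mod_four (S : PowerSolution p q m) (hq : 6 ≤ q) (hp4 : p % 4 = 1) :
    1361 ≤ p := by
  by_contra! hlt
  obtain ⟨D, hD, rfl⟩ := sieveTable_complete S.prime hp4 hlt
  exact D.false_of_check S hq (List.all_eq_true.1 sieveTable_check D hD)

namespace PowerSolution

/-- A common `p`-th root of `-2` and `q`-th root of `m`, raised to the ninth power. -/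
theorem exists_ninth_power (S : PowerSolution p q m) (hp : p ≠ 3) :
    ∃ G : ℤ, 27 ∣ G - 1 ∧ ∀ r s x : ℕ, p * r + q * s = 9 * x →
      (3 : ℤ) ^ q ∣ (-2) ^ r * (m : ℤ) ^ s - G ^ x := by
  have hm := S.m_mod_three
  have hq : 3 ≤ q := by have := S.three_le; have := S.lt; omega
  have : NeZero (3 ^ q) := ⟨by positivity⟩
  have hcard : (Nat.card (ZMod (3 ^ q))ˣ).Coprime p := by
    rw [Nat.card_eq_fintype_card, ZMod.card_units_eq_totient,
      Nat.totient_prime_pow Nat.prime_three (by omega)]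
    refine Nat.Coprime.mul_left (Nat.Coprime.pow_left _ ?_) ?_
    · exact (Nat.coprime_primes Nat.prime_three S.prime).2 (Ne.symm hp)
    · exact Nat.coprime_two_left.2 S.odd_p
  let u : (ZMod (3 ^ q))ˣ := -ZMod.unitOfCoprime 2 (Nat.Coprime.pow_right _ (by norm_num))
  let v : (ZMod (3 ^ q))ˣ := ZMod.unitOfCoprime m (Nat.Coprime.pow_right _
    (Nat.coprime_comm.1 ((Nat.Prime.coprime_iff_not_dvd Nat.prime_three).2 (by omega))))
  have hu : (u : ZMod (3 ^ q)) = -2 := by simp [u]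
  have hv : (v : ZMod (3 ^ q)) = m := by simp [v]
  obtain ⟨γ, hγ⟩ : ∃ γ : (ZMod (3 ^ q))ˣ, γ ^ p = u := (powCoprime hcard).surjective u
  have hγq : γ ^ q = v := by
    apply (powCoprime hcard).injective
    simp only [powCoprime_apply]
    rw [← pow_mul, mul_comm, pow_mul, hγ]
    ext
    push_cast
    rw [hu, hv, S.odd_q.neg_pow]
    have h1 : (m : ZMod (3 ^ q)) ^ p + 2 ^ q = 0 := by
      have h2 := congrArg (Nat.cast (R := ZMod (3 ^ q))) S.eq
      rw [ZMod.natCast_self] at h2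
      exact_mod_cast h2
    linear_combination -h1
  refine ⟨(((γ ^ 9 : (ZMod (3 ^ q))ˣ) : ZMod (3 ^ q)).val : ℤ), ?_, fun r s x h => ?_⟩
  · have h27 : 27 ∣ 3 ^ q := pow_dvd_pow 3 hq
    set φ := ZMod.castHom h27 (ZMod 27)
    have h1 := congrArg (fun z : (ZMod (3 ^ q))ˣ => φ z) hγ
    simp only [Units.val_pow_eq_pow_val, map_pow, hu, map_neg, map_ofNat] at h1
    have h2 : ∀ z : ZMod 27, z ^ 9 = 0 ∨ z ^ 9 = 1 ∨ z ^ 9 = -1 := by decide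
    have h3 : (φ γ ^ 9) ^ p = 1 := by
      rw [← pow_mul, mul_comm, pow_mul, h1]; decide
    have h4 : φ γ ^ 9 = 1 := by
      rcases h2 (φ γ) with h | h | h
      · rw [h, zero_pow S.prime.ne_zero] at h3
        exact absurd h3 (by decide)
      · exact h
      · rw [h, S.odd_p.neg_one_pow] at h3
        exact absurd h3 (by decide)
    refine (ZMod.intCast_zmod_eq_zero_iff_dvd _ 27).1 ?_
    rw [Int.cast_sub, Int.cast_natCast, Int.cast_one, sub_eq_zero, ← h4, ← map_pow,
      Units.val_pow_eq_pow_val]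
    exact ZMod.natCast_val _
  · have h1 : u ^ r * v ^ s = (γ ^ 9) ^ x := by
      rw [← hγ, ← hγq, ← pow_mul, ← pow_mul, ← pow_mul, ← pow_add, h]
    have h2 := congrArg (Units.val) h1
    push_cast at h2
    rw [hu, hv] at h2
    have h3 := (ZMod.intCast_zmod_eq_zero_iff_dvd
      ((-2) ^ r * (m : ℤ) ^ s - (((γ ^ 9 : (ZMod (3 ^ q))ˣ) : ZMod (3 ^ q)).val : ℤ) ^ x)
      (3 ^ q)).1 (by
        push_cast
        rw [ZMod.natCast_val, ZMod.cast_id, h2, sub_self])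
    exact_mod_cast h3

end PowerSolution

theorem exists_lt_nine_dvd {p : ℕ} (hp : p % 3 ≠ 0) (b : ℕ) : ∃ r < 9, 9 ∣ p * r + b := by
  have h : ∀ i < 9, i % 3 ≠ 0 → ∀ j < 9, ∃ r < 9, (i * r + j) % 9 = 0 := by decide
  obtain ⟨r, hr, h1⟩ := h (p % 9) (Nat.mod_lt _ (by norm_num)) (by omega) (b % 9)
    (Nat.mod_lt _ (by norm_num))
  refine ⟨r, hr, Nat.dvd_of_mod_eq_zero ?_⟩
  rw [← h1]
  exact ((Nat.mod_modEq p 9).symm.mul_right r).add (Nat.mod_modEq b 9).symm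

namespace PowerSolution

/-- The main inequality, obtained by comparing the 3-adic and the archimedean absolute values of
an interpolation determinant. -/
theorem interpolation_inequality (S : PowerSolution p q m) (hp : p ≠ 3) {K L A s : ℕ}
    (hK : 0 < K) (hL : 0 < L) (hA : 0 < A) (hs : 0 < s) (hsp : s ≤ p)
    (hq : 3 * (K * L - 1) ≤ q) (hcard : L * (K - 1) < A * s) :
    (K * (L - 1) * Real.log 27 : ℝ) ≤ 2 * Real.log (K * L) +
      (K - 1) * Real.log (2 * (p * (A + L - 1) + q * s / 9) / K) + K +
      (L - 1) * (9 * (A + L - 1) * Real.log 2 + s * Real.log m) := by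
  have hp3 := S.three_le
  have hm0 : 0 < m := by have := S.m_mod_three; omega
  have hpmod : p % 3 ≠ 0 := fun h => hp
    ((Nat.prime_dvd_prime_iff_eq Nat.prime_three S.prime).1 (Nat.dvd_of_mod_eq_zero h)).symm
  obtain ⟨G, hG, hGm⟩ := S.exists_ninth_power hp
  have hρ : ∀ t : Fin s, ∃ ρ c, ρ < 9 ∧ p * ρ + q * t = 9 * c := fun t => by
    obtain ⟨r, hr, c, hc⟩ := exists_lt_nine_dvd hpmod (q * t)
    exact ⟨r, c, hr, hc⟩
  choose ρ c hρ9 hc using hρ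
  have hinj : Function.Injective fun z : Fin A × Fin s => p * (z.1 : ℕ) + c z.2 := by
    rintro ⟨a, t⟩ ⟨a', t'⟩ h
    have h1 := hc t
    have h2 := hc t'
    have h3 : p * (9 * (a : ℕ) + ρ t) + q * t = p * (9 * (a' : ℕ) + ρ t') + q * t' := by
      dsimp only at h
      linarith
    have h4 : q * t ≡ q * t' [MOD p] := by
      have h5 : p * (9 * (a : ℕ) + ρ t) + q * t ≡ p * (9 * (a' : ℕ) + ρ t') + q * t' [MOD p] := by
        rw [h3]
      simpa [Nat.ModEq] using h5
    have h5 : t = t' := Fin.ext <| Nat.ModEq.eq_of_lt_of_lt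
      (Nat.ModEq.cancel_left_of_coprime S.coprime h4) (t.2.trans_le hsp) (t'.2.trans_le hsp)
    subst h5
    have h6 : (a : ℕ) = a' := Nat.eq_of_mul_eq_mul_left S.prime.pos (by simpa using h)
    rw [Fin.ext h6]
  obtain ⟨r, hr⟩ := exists_det_ne_zero (K := K) (L := L) (A := A) (p := p) (g := -512) (c := c)
    (d := fun t => (-2) ^ ρ t * (m : ℤ) ^ (t : ℕ)) (fun t => by positivity) (by norm_num)
    hinj hcard
  obtain ⟨R, hR⟩ := Nat.exists_eq_add_of_le' (Nat.mul_pos hK hL)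
  set x : Fin K × Fin L → ℕ := fun i => p * ((r i).1 : ℕ) + c (r i).2 with hx
  set y : Fin K × Fin L → ℤ := fun i =>
    (-512) ^ ((r i).1 : ℕ) * ((-2) ^ ρ (r i).2 * (m : ℤ) ^ ((r i).2 : ℕ)) with hy
  have hyG : ∀ i, (27 : ℤ) ^ R ∣ y i - G ^ x i := by
    intro i
    have h1 := hGm (9 * (r i).1 + ρ (r i).2) (r i).2 (x i) (by
      have := hc (r i).2
      rw [hx]
      dsimp only
      linarith)
    have h2 : y i = (-2) ^ (9 * ((r i).1 : ℕ) + ρ (r i).2) * (m : ℤ) ^ ((r i).2 : ℕ) := by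
      rw [hy, pow_add, pow_mul]
      norm_num [mul_assoc]
    rw [← h2] at h1
    refine Dvd.dvd.trans ?_ h1
    rw [show (27 : ℤ) = 3 ^ 3 by norm_num, ← pow_mul]
    exact pow_dvd_pow 3 (by omega)
  obtain ⟨D, hD⟩ : ∃ D, D = (Matrix.of fun i j : Fin K × Fin L =>
    ((x i).choose j.1 : ℤ) * y i ^ (j.2 : ℕ)).det := ⟨_, rfl⟩
  have hD0 : D ≠ 0 := by rw [hD]; exact hr
  have hdvd := pow_choose_two_dvd_det hR hG hyG
  rw [← hD] at hdvd
  have hA' : (1 : ℝ) ≤ A := by exact_mod_cast hA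
  have hL' : (1 : ℝ) ≤ L := by exact_mod_cast hL
  have hK' : (1 : ℝ) ≤ K := by exact_mod_cast hK
  have hs' : (1 : ℝ) ≤ s := by exact_mod_cast hs
  have hm' : (1 : ℝ) ≤ m := by exact_mod_cast hm0
  have hp' : (3 : ℝ) ≤ p := by exact_mod_cast hp3
  have ha : ∀ i, ((r i).1 : ℝ) ≤ A + L - 2 := by
    intro i
    have h1 : ((r i).1 : ℕ) + 2 ≤ A + L := by have := (r i).1.2; omega
    have h2 : (((r i).1 : ℕ) : ℝ) + 2 ≤ A + L := by exact_mod_cast h1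
    linarith
  have hupper := log_abs_det_le hK hL (X := p * (A + L - 1) + q * s / 9)
    (Y := 2 ^ (9 * (A + L - 1)) * (m : ℝ) ^ s) (by
      have : (0 : ℝ) < p * (A + L - 1) := by apply mul_pos <;> linarith
      positivity) (by positivity) (x := x) (y := y) (fun i => by
      have h1 : (p * ρ (r i).2 + q * ((r i).2 : ℕ) : ℝ) = 9 * c (r i).2 := by
        exact_mod_cast hc (r i).2
      have h2 : (ρ (r i).2 : ℝ) ≤ 9 := by exact_mod_cast (hρ9 _).le
      have h3 : (((r i).2 : ℕ) : ℝ) ≤ s := by exact_mod_cast (r i).2.2.le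
      have h4 : (p : ℝ) * ρ (r i).2 ≤ p * 9 := by gcongr
      have h5 : (q : ℝ) * ((r i).2 : ℕ) ≤ q * s := by gcongr
      have h6 : (p : ℝ) * ((r i).1 : ℕ) ≤ p * (A + L - 2) := by gcongr; exact ha i
      rw [hx]
      push_cast
      linarith) (fun i => by
      have h1 : |((y i : ℤ) : ℝ)| =
          2 ^ (9 * ((r i).1 : ℕ) + ρ (r i).2) * (m : ℝ) ^ ((r i).2 : ℕ) := by
        rw [hy]
        push_cast
        rw [abs_mul, abs_mul, abs_pow, abs_pow, abs_pow, Nat.abs_cast, pow_add, pow_mul]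
        norm_num [mul_assoc]
      rw [h1]
      gcongr
      · norm_num
      · have := (r i).1.2
        have := hρ9 (r i).2
        omega
      · exact (r i).2.2.le) hD hD0
  have hlower : ((K * L).choose 2 : ℝ) * Real.log 27 ≤
      ((L * K.choose 2 : ℕ) : ℝ) * Real.log 27 + Real.log |D| := by
    have h1 := Int.le_of_dvd (by positivity) ((dvd_abs _ _).2 hdvd)
    rw [abs_mul, abs_pow, show |(27 : ℤ)| = 27 from rfl] at h1
    have h2 : (27 : ℝ) ^ (K * L).choose 2 ≤ 27 ^ (L * K.choose 2) * |(D : ℝ)| := by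
      exact_mod_cast h1
    have h3 := Real.log_le_log (by positivity) h2
    rwa [Real.log_mul (by positivity) (abs_ne_zero.2 (by exact_mod_cast hD0)), Real.log_pow,
      Real.log_pow] at h3
  have hYlog : Real.log (2 ^ (9 * (A + L - 1)) * (m : ℝ) ^ s) =
      9 * (A + L - 1) * Real.log 2 + s * Real.log m := by
    rw [Real.log_mul (by positivity) (by positivity), Real.log_pow, Real.log_pow]
    rw [Nat.cast_mul, Nat.cast_sub (by omega)]
    push_cast
    ring
  rw [hYlog] at hupper
  rw [Nat.cast_choose_two, Nat.cast_mul, Nat.cast_mul, Nat.cast_choose_two] at hlower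
  have hKL : (0 : ℝ) < K * L := by positivity
  refine le_of_mul_le_mul_left ?_ hKL
  refine le_trans ?_ hupper
  linarith

end PowerSolution

/-- The parameters chosen in `PowerSolution.lt_of_p_mod_four` violate the inequality of
`PowerSolution.interpolation_inequality`. -/
theorem interpolation_parameters_bound {p q K L A s M : ℝ} (hL : 6 ≤ L) (hs : s = L * (L + 2))
    (hp : L ^ 4 ≤ p) (hps : p ≤ s * (s + 2)) (hpq : 4 * p ≤ q) (hKq : q + 3 ≤ 3 * K * L + 3 * L)
    (hA : (A - 1) * (L + 2) ≤ K - 1) (hA1 : 1 ≤ A) (hM : p * M ≤ q * Real.log 3) :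
    2 * Real.log (K * L) + (K - 1) * Real.log (2 * (p * (A + L - 1) + q * s / 9) / K) + K +
      (L - 1) * (9 * (A + L - 1) * Real.log 2 + s * M) < K * (L - 1) * Real.log 27 := by
  have l2 := Real.log_two_lt_d9
  have l2' := Real.log_two_gt_d9
  have l3 := Real.log_three_lt_d9
  have l3' := Real.log_three_gt_d9
  have hL0 : 0 < L := by linarith
  have hp0 : 0 < p := lt_of_lt_of_le (by positivity) hp
  have hL3 : 216 ≤ L ^ 3 := by
    calc (216 : ℝ) = 6 ^ 3 := by norm_num
      _ ≤ L ^ 3 := by gcongr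
  have hK : 4 * L ^ 3 - 3 ≤ 3 * K := by
    refine le_of_mul_le_mul_right ?_ hL0
    linarith [show (4 * L ^ 3 - 3) * L = 4 * L ^ 4 - 3 * L by ring]
  have hK0 : 287 ≤ K := by linarith
  have hLlog : Real.log L ≤ Real.log 2 + Real.log 3 + (L - 6) / 6 := by
    have h := Real.log_le_sub_one_of_pos (show 0 < L / 6 by positivity)
    rw [Real.log_div (by positivity) (by norm_num), show (6 : ℝ) = 2 * 3 by norm_num,
      Real.log_mul (by norm_num) (by norm_num)] at h
    linarith
  have hKlog : Real.log K ≤ 5 * Real.log 2 + 2 * Real.log 3 + (K - 288) / 288 := by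
    have h := Real.log_le_sub_one_of_pos (show 0 < K / 288 by positivity)
    rw [Real.log_div (by positivity) (by norm_num), show (288 : ℝ) = 2 ^ 5 * 3 ^ 2 by norm_num,
      Real.log_mul (by norm_num) (by norm_num), Real.log_pow, Real.log_pow] at h
    push_cast at h
    linarith
  have hLK : 3 * Real.log L ≤ Real.log K := by
    have h := Real.log_le_log (by positivity) (show L ^ 3 ≤ K by linarith)
    rw [Real.log_pow] at h
    exact_mod_cast h
  have e1 : 2 * Real.log (K * L) ≤ 0.053 * K := by
    rw [Real.log_mul (by positivity) (by positivity)]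
    linarith
  have e2 : Real.log (2 * (p * (A + L - 1) + q * s / 9) / K) ≤
      5 * Real.log 2 + 3 * Real.log 3 + (L - 6) / 2 := by
    have hX : 2 * (p * (A + L - 1) + q * s / 9) / K ≤ 4 * L ^ 3 := by
      rw [div_le_iff₀ (by positivity)]
      have h1 : p * (A - 1) ≤ L * (s + 2) * K := by
        have h2 : (A - 1) * (L + 2) ≤ K := by linarith
        calc p * (A - 1) ≤ s * (s + 2) * (A - 1) :=
              mul_le_mul_of_nonneg_right hps (by linarith)
          _ = L * (s + 2) * ((A - 1) * (L + 2)) := by rw [hs]; ring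
          _ ≤ _ := by
            have : 0 ≤ s := by rw [hs]; positivity
            gcongr
      have h2 : q ≤ 3 * L * (K + 1) := by linarith
      have h3 : p * L ≤ 3 * L ^ 2 * (K + 1) / 4 := by
        have : p ≤ 3 * L * (K + 1) / 4 := by linarith
        calc p * L ≤ 3 * L * (K + 1) / 4 * L := by gcongr
          _ = _ := by ring
      have h4 : q * s ≤ 3 * L * (K + 1) * (L * (L + 2)) := by rw [hs]; gcongr
      rw [hs] at h1
      have h5 : K + 1 ≤ 1.01 * K := by linarith
      have h6 : 3 * L ^ 2 * (K + 1) / 4 ≤ 3 * L ^ 2 * (1.01 * K) / 4 := by gcongr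
      have h7 : 3 * L * (K + 1) * (L * (L + 2)) ≤ 3 * L * (1.01 * K) * (L * (L + 2)) := by gcongr
      have h8 : L * (L * (L + 2) + 2) + 3 * L ^ 2 * 1.01 / 4 + 3 * L * 1.01 * (L * (L + 2)) / 9
          ≤ 2 * L ^ 3 := by
        nlinarith [mul_nonneg (sub_nonneg.2 hL) (sq_nonneg L),
          mul_nonneg (sub_nonneg.2 hL) hL0.le]
      have h9 := mul_le_mul_of_nonneg_right h8 (show 0 ≤ K by linarith)
      linarith
    have hX0 : 0 < 2 * (p * (A + L - 1) + q * s / 9) / K := by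
      have : 0 < A + L - 1 := by linarith
      have : 0 < q := by linarith
      have : 0 < s := by rw [hs]; positivity
      positivity
    have h := Real.log_le_log hX0 hX
    rw [show 4 * L ^ 3 = 2 ^ 2 * L ^ 3 by norm_num, Real.log_mul (by norm_num) (by positivity),
      Real.log_pow, Real.log_pow] at h
    push_cast at h
    linarith
  have e2' : (K - 1) * Real.log (2 * (p * (A + L - 1) + q * s / 9) / K) ≤
      K * (6.762 + (L - 6) / 2) := by
    calc _ ≤ (K - 1) * (6.762 + (L - 6) / 2) :=
          mul_le_mul_of_nonneg_left (by linarith) (by linarith)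
      _ ≤ _ := mul_le_mul_of_nonneg_right (by linarith) (by linarith)
  have e3 : (L - 1) * (9 * (A + L - 1)) * Real.log 2 ≤
      K * (0.73 + (L - 6) * (3 / 64)) * 9 * 0.6932 := by
    have h1 : (L - 1) * (A - 1) ≤ K * (5 / 8 + (L - 6) * (3 / 64)) := by
      have h2 : (L - 1) ≤ (5 / 8 + (L - 6) * (3 / 64)) * (L + 2) := by
        nlinarith [sq_nonneg (L - 6)]
      calc (L - 1) * (A - 1) ≤ (5 / 8 + (L - 6) * (3 / 64)) * (L + 2) * (A - 1) :=
            mul_le_mul_of_nonneg_right h2 (by linarith)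
        _ = (5 / 8 + (L - 6) * (3 / 64)) * ((A - 1) * (L + 2)) := by ring
        _ ≤ (5 / 8 + (L - 6) * (3 / 64)) * K :=
            mul_le_mul_of_nonneg_left (by linarith) (by linarith)
        _ = _ := mul_comm _ _
    have h2 : (L - 1) * L ≤ 0.105 * K := by
      nlinarith [mul_nonneg (sub_nonneg.2 hL) (sq_nonneg L),
            mul_nonneg (sub_nonneg.2 hL) hL0.le]
    have h3 : (L - 1) * (9 * (A + L - 1)) ≤ K * (0.73 + (L - 6) * (3 / 64)) * 9 := by linarith
    have h4 : 0 ≤ K * (0.73 + (L - 6) * (3 / 64)) * 9 := by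
      have : 0 ≤ L - 6 := by linarith
      positivity
    exact mul_le_mul h3 (by linarith) (by linarith) h4
  have e4 : (L - 1) * (s * M) ≤ 3.73 * K := by
    have h1 : q * Real.log 3 ≤ 3 * L * (K + 1) * 1.0987 := by
      have : 0 < q := by linarith
      exact mul_le_mul (by linarith) (by linarith) (by linarith) (by positivity)
    have h2 : L ^ 4 * M ≤ 3 * L * (K + 1) * 1.0987 := by
      rcases le_total M 0 with h | h
      · exact (mul_nonpos_of_nonneg_of_nonpos (by positivity) h).trans (by positivity)
      · exact (mul_le_mul_of_nonneg_right hp h).trans (hM.trans h1)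
    have h3 : (L - 1) * (L + 2) ≤ 1.125 * L ^ 2 := by nlinarith [sq_nonneg (L - 4)]
    refine le_of_mul_le_mul_left ?_ (pow_pos hL0 3)
    calc L ^ 3 * ((L - 1) * (s * M)) = (L - 1) * (L + 2) * (L ^ 4 * M) := by rw [hs]; ring
      _ ≤ (L - 1) * (L + 2) * (3 * L * (K + 1) * 1.0987) := by
        refine mul_le_mul_of_nonneg_left h2 (mul_nonneg (by linarith) (by linarith))
      _ ≤ 1.125 * L ^ 2 * (3 * L * (K + 1) * 1.0987) := by gcongr
      _ = L ^ 3 * (1.125 * 3 * 1.0987 * (K + 1)) := by ring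
      _ ≤ L ^ 3 * (3.73 * K) := mul_le_mul_of_nonneg_left (by linarith) (by positivity)
  have e5 : K * (L - 1) * (3 * 1.0986) ≤ K * (L - 1) * Real.log 27 := by
    rw [show (27 : ℝ) = 3 ^ 3 by norm_num, Real.log_pow]
    push_cast
    exact mul_le_mul_of_nonneg_left (by linarith) (mul_nonneg (by linarith) (by linarith))
  have e6 : 0 ≤ K * (L - 6) := mul_nonneg (by linarith) (by linarith)
  linarith

/-- Every exponent congruent to `1` modulo `4` of a `PowerSolution` is less than `1361`. -/
theorem PowerSolution.lt_of_four_mul_lt (S : PowerSolution p q m) (hq : 4 * p < q) :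
    p < 1361 := by
  by_contra! hp
  obtain ⟨L, hL, hL'⟩ : ∃ L, L ^ 4 ≤ p ∧ p < (L + 1) ^ 4 := by
    have hex : ∃ n, p < (n + 1) ^ 4 :=
      ⟨p, Nat.lt_of_succ_le (Nat.le_self_pow (by norm_num) (p + 1))⟩
    classical
    refine ⟨Nat.find hex, ?_, Nat.find_spec hex⟩
    rcases Nat.eq_zero_or_pos (Nat.find hex) with h0 | h0
    · rw [h0]; simp
    · have := Nat.find_min hex (Nat.sub_lt h0 one_pos)
      rw [show Nat.find hex - 1 + 1 = Nat.find hex from Nat.sub_add_cancel h0] at this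
      omega
  have hL6 : 6 ≤ L := by
    by_contra! h
    have : (L + 1) ^ 4 ≤ 6 ^ 4 := Nat.pow_le_pow_left (by omega) 4
    omega
  obtain ⟨s, hs⟩ : ∃ s, s = L * (L + 2) := ⟨_, rfl⟩
  have hs48 : 48 ≤ s := by rw [hs]; nlinarith
  have hsp : s ≤ p := by rw [hs]; nlinarith [Nat.pow_le_pow_left hL6 2]
  have hps : p ≤ s * (s + 2) := by
    have : (L + 1) ^ 4 = s * (s + 2) + 1 := by rw [hs]; ring
    omega
  obtain ⟨K, hK⟩ : ∃ K, K = (q / 3 + 1) / L := ⟨_, rfl⟩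
  have hKL : K * L ≤ q / 3 + 1 := by rw [hK]; exact Nat.div_mul_le_self _ _
  have hKL' : q / 3 + 1 + 1 ≤ K * L + L := by
    have := Nat.lt_div_mul_add (a := q / 3 + 1) (b := L) (by omega)
    rw [hK]
    omega
  have hK0 : 0 < K := by
    rw [hK]
    refine Nat.div_pos ?_ (by omega)
    have : L ≤ s := by rw [hs]; nlinarith
    omega
  obtain ⟨A, hA⟩ : ∃ A, A = L * (K - 1) / s + 1 := ⟨_, rfl⟩
  have hAs : L * (K - 1) < A * s := by
    rw [hA, mul_comm _ s]
    exact Nat.lt_mul_div_succ _ (by omega)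
  have hAs' : (A - 1) * s ≤ L * (K - 1) := by rw [hA]; exact Nat.div_mul_le_self _ _
  have hAs'' : (A - 1) * (L + 2) ≤ K - 1 := by
    rw [hs] at hAs'
    exact Nat.le_of_mul_le_mul_left (by linarith) (show 0 < L by omega)
  have hA1 : 1 ≤ A := by rw [hA]; exact Nat.le_add_left _ _
  have hm0 : 0 < m := by have := S.m_mod_three; omega
  have h := S.interpolation_inequality (by omega) hK0 (by omega) (by omega) (by omega) hsp
    (by omega) hAs
  refine absurd h (not_le.2 (interpolation_parameters_bound (p := p) (q := q) ?_ ?_ ?_ ?_ ?_ ?_ ?_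
    ?_ ?_))
  · exact_mod_cast hL6
  · exact_mod_cast hs
  · exact_mod_cast hL
  · exact_mod_cast hps
  · exact_mod_cast hq.le
  · have : q + 3 ≤ 3 * K * L + 3 * L := by
      rw [mul_assoc]
      omega
    exact_mod_cast this
  · rw [← Nat.cast_one, ← Nat.cast_sub hA1, ← Nat.cast_sub hK0]
    exact_mod_cast hAs''
  · exact_mod_cast hA1
  · rw [← Real.log_pow, ← Real.log_pow]
    refine Real.log_le_log (by positivity) ?_
    exact_mod_cast (Nat.le_add_right _ _).trans S.eq.le

theorem pow_add_two_pow_ne_pow {x y n p : ℕ} (hx : Odd x) (hy : Odd y) (hp : Odd p) (hp1 : 1 < p) :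
    y ^ p + 2 ^ n ≠ x ^ p := by
  intro h
  have hlt : y < x := lt_of_pow_lt_pow_left₀ p (by positivity)
    (h ▸ Nat.lt_add_of_pos_right (by positivity))
  have hgeom : (∑ i ∈ range p, x ^ i * y ^ (p - 1 - i)) * (x - y) = 2 ^ n := by
    zify [hlt.le]
    rw [(Commute.all (x : ℤ) y).geom_sum₂_mul, sub_eq_iff_eq_add']
    exact_mod_cast h.symm
  have hodd : Odd (∑ i ∈ range p, x ^ i * y ^ (p - 1 - i)) := by
    rw [Finset.odd_sum_iff_odd_card_odd, Finset.filter_true_of_mem fun i _ => hx.pow.mul hy.pow,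
      card_range]
    exact hp
  have hge : p ≤ ∑ i ∈ range p, x ^ i * y ^ (p - 1 - i) := by
    have hxp := hx.pos
    have hyp := hy.pos
    simpa using card_nsmul_le_sum (range p) (fun i => x ^ i * y ^ (p - 1 - i)) 1
      fun i _ => Nat.one_le_iff_ne_zero.2 (by positivity)
  have hone := Nat.Coprime.eq_one_of_dvd (hodd.coprime_two_right.pow_right n) (Dvd.intro _ hgeom)
  omega

theorem odd_of_pow_add_two_pow_eq {m p n : ℕ} (hp : p ≠ 0) (hn : n ≠ 0)
    (h : m ^ p + 2 ^ n = 3 ^ n) : Odd m := by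
  have h1 : Odd (m ^ p + 2 ^ n) := h ▸ Odd.pow (by decide)
  rw [Nat.odd_add] at h1
  exact (Nat.odd_pow_iff hp).1 (h1.2 (Nat.even_pow.2 ⟨even_two, hn⟩))

theorem odd_exponent_of_pow_add_two_pow_eq {m p n : ℕ} (hp : Odd p) (hp1 : 1 < p) (hn : n ≠ 0)
    (h : m ^ p + 2 ^ n = 3 ^ n) : Odd n := by
  by_contra hodd
  obtain ⟨a, rfl⟩ := (Nat.not_odd_iff_even.1 hodd).two_dvd
  have ha : a ≠ 0 := by omega
  have hlt : 2 ^ a < 3 ^ a := Nat.pow_lt_pow_left (by norm_num) ha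
  obtain ⟨u, hu⟩ := Nat.exists_eq_add_of_lt hlt
  have hmul : (u + 1) * (3 ^ a + 2 ^ a) = m ^ p := by
    have h1 : m ^ p + (2 ^ a) ^ 2 = (3 ^ a) ^ 2 := by rw [← pow_mul', ← pow_mul']; exact h
    rw [hu] at h1 ⊢
    linarith
  have hodd3 : Odd (3 ^ a) := Odd.pow (by decide)
  have heven : Even (2 ^ a) := Nat.even_pow.2 ⟨even_two, ha⟩
  have hsum : Odd (3 ^ a + 2 ^ a) := hodd3.add_even heven
  have hdvd : 3 ^ a + 2 ^ a = (u + 1) + 2 ^ (a + 1) := by rw [hu, pow_succ]; ring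
  have hcop : Nat.Coprime (u + 1) (3 ^ a + 2 ^ a) := by
    rw [hdvd, Nat.coprime_self_add_right]
    rw [hdvd] at hsum
    refine Nat.Coprime.pow_right _ (Nat.Coprime.symm ?_)
    exact Nat.coprime_two_left.2 ((Nat.odd_add.1 hsum).2 (Nat.even_pow.2 ⟨even_two, by omega⟩))
  have hu1 : IsUnit (GCDMonoid.gcd (u + 1) (3 ^ a + 2 ^ a)) := by
    rw [Nat.isUnit_iff]; exact hcop
  have hu2 : IsUnit (GCDMonoid.gcd (3 ^ a + 2 ^ a) (u + 1)) := by
    rw [Nat.isUnit_iff]; exact hcop.symm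
  obtain ⟨y, hy⟩ := exists_eq_pow_of_mul_eq_pow hu1 hmul
  obtain ⟨x, hx⟩ := exists_eq_pow_of_mul_eq_pow hu2 (by rw [mul_comm]; exact hmul)
  rw [hx] at hsum hdvd
  rw [hy] at hdvd
  have hy' : Odd (y ^ p) := by
    rw [hdvd] at hsum
    exact (Nat.odd_add.1 hsum).2 (Nat.even_pow.2 ⟨even_two, by omega⟩)
  exact pow_add_two_pow_ne_pow ((Nat.odd_pow_iff (by omega)).1 hsum)
    ((Nat.odd_pow_iff (by omega)).1 hy') hp hp1 hdvd.symm

theorem coprime_of_pow_add_two_pow_eq {m p n : ℕ} (hp : p.Prime) (hp2 : Odd p) (hn : n ≠ 0)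
    (h : m ^ p + 2 ^ n = 3 ^ n) : Nat.Coprime p n := by
  refine (Nat.Prime.coprime_iff_not_dvd hp).2 fun ⟨t, ht⟩ => ?_
  refine pow_add_two_pow_ne_pow (x := 3 ^ t) (Odd.pow (by decide))
    (odd_of_pow_add_two_pow_eq hp.ne_zero hn h) hp2 hp.one_lt (h.trans ?_)
  rw [ht, mul_comm, pow_mul]

theorem mod_twentyfour_of_pow_add_two_pow_eq {m p n : ℕ} (hp : Odd p) (hp1 : 1 < p) (hn : Odd n)
    (hn1 : 1 < n) (h : m ^ p + 2 ^ n = 3 ^ n) : m % 24 = 19 := by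
  have key : ∀ {x k : ℕ}, Odd k → 1 < k → x ^ k ≡ (x % 24) ^ 3 [MOD 24] := by
    rintro x k ⟨j, rfl⟩ hk
    refine (((Nat.mod_modEq x 24).pow _).symm).trans ?_
    have hx := Nat.mod_lt x (show 24 > 0 by norm_num)
    generalize x % 24 = y at hx
    obtain ⟨i, rfl⟩ := Nat.exists_eq_succ_of_ne_zero (show j ≠ 0 by omega)
    have h5 : y ^ 5 ≡ y ^ 3 [MOD 24] := by
      have : ∀ y < 24, y ^ 5 % 24 = y ^ 3 % 24 := by decide
      exact this y hx
    induction i with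
    | zero => rfl
    | succ i ih =>
      have h1 := (ih (by omega)).mul_right (y ^ 2)
      rw [← pow_add, ← pow_add] at h1
      exact h1.trans h5
  have h1 := ((key (x := m) hp hp1).add (key (x := 2) hn hn1)).symm.trans
    ((congrArg (· % 24) h).trans (key (x := 3) hn hn1))
  have h2 : ∀ y < 24, (y ^ 3 + (2 % 24) ^ 3) % 24 = (3 % 24) ^ 3 % 24 → y = 19 := by decide
  exact h2 _ (Nat.mod_lt _ (by norm_num)) h1

theorem pow_modEq_pow_mod_twelve {N x : ℕ} (hx : x ^ 12 % N = 1 % N) (n : ℕ) :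
    x ^ n ≡ x ^ (n % 12) [MOD N] := by
  conv_lhs => rw [← Nat.div_add_mod n 12, pow_add, pow_mul]
  simpa using (Nat.ModEq.pow (n / 12) (show x ^ 12 ≡ 1 [MOD N] from hx)).mul_right (x ^ (n % 12))

theorem ninetyone_le_of_pow_add_two_pow_eq {m p n : ℕ} (hp : Odd p) (hp1 : 1 < p) (hn : Odd n)
    (hn1 : 3 < n) (h : m ^ p + 2 ^ n = 3 ^ n) : 91 ≤ m := by
  by_contra! hm
  have hm24 := mod_twentyfour_of_pow_add_two_pow_eq hp hp1 hn (by omega) h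
  have hcases : m = 19 ∨ m = 43 ∨ m = 67 := by omega
  have h455 : m ^ 12 % 455 = 1 % 455 ∧ m ^ 12 % 16 = 1 % 16 := by
    rcases hcases with rfl | rfl | rfl <;> decide
  have h1 : m ^ (p % 12) + 2 ^ (n % 12) ≡ 3 ^ (n % 12) [MOD 455] :=
    ((pow_modEq_pow_mod_twelve h455.1 p).symm.add
      (pow_modEq_pow_mod_twelve (by norm_num) n).symm).trans
      ((congrArg (· % 455) h).trans (pow_modEq_pow_mod_twelve (by norm_num) n))
  have h2 : m ^ (p % 12) ≡ 3 ^ (n % 12) [MOD 16] := by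
    have h3 : m ^ p ≡ m ^ p + 2 ^ n [MOD 16] := by
      have h4 : 2 ^ n ≡ 0 [MOD 16] := Nat.modEq_zero_iff_dvd.2 (pow_dvd_pow 2 (show 4 ≤ n by omega))
      simpa using (h4.add_left (m ^ p)).symm
    exact (pow_modEq_pow_mod_twelve h455.2 p).symm.trans (h3.trans
      ((congrArg (· % 16) h).trans (pow_modEq_pow_mod_twelve (by norm_num) n)))
  have h3 : ∀ x ∈ [19, 43, 67], ∀ i < 12, i % 2 = 1 → ∀ j < 12, j % 2 = 1 →
      (x ^ i + 2 ^ j) % 455 = 3 ^ j % 455 → x ^ i % 16 ≠ 3 ^ j % 16 := by decide +kernel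
  have hp2 := Nat.odd_iff.1 hp
  have hn2 := Nat.odd_iff.1 hn
  exact h3 m (by simpa using hcases) (p % 12) (Nat.mod_lt _ (by norm_num)) (by omega) (n % 12)
    (Nat.mod_lt _ (by norm_num)) (by omega) h1 h2

theorem pow_add_two_pow_ne_three_pow_of_odd {m p n : ℕ} (hp : p.Prime) (hp2 : Odd p) (hm : 2 ≤ m)
    (hn : 2 ≤ n) : m ^ p + 2 ^ n ≠ 3 ^ n := by
  intro h
  have hn2 := odd_exponent_of_pow_add_two_pow_eq hp2 hp.one_lt (by omega) h
  have hp3 : 3 ≤ p := by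
    have := hp.two_le
    have := Nat.odd_iff.1 hp2
    omega
  have hn3 : 3 < n := by
    by_contra! hn3
    have hn3 : n = 3 := by have := Nat.odd_iff.1 hn2; omega
    subst hn3
    have hm3 : 3 ≤ m := by
      have := Nat.odd_iff.1 (odd_of_pow_add_two_pow_eq hp.ne_zero (by norm_num) h)
      omega
    have h1 : 3 ^ 3 ≤ m ^ p :=
      (Nat.pow_le_pow_right (by norm_num) hp3).trans (Nat.pow_le_pow_left hm3 p)
    omega
  have hm91 := ninetyone_le_of_pow_add_two_pow_eq hp2 hp.one_lt hn2 hn3 h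
  have hlt : 4 * p < n := by
    have h1 : 3 ^ (4 * p) < 3 ^ n := by
      calc 3 ^ (4 * p) = 81 ^ p := by rw [pow_mul]; norm_num
        _ < m ^ p := Nat.pow_lt_pow_left (by omega) hp.ne_zero
        _ ≤ 3 ^ n := h ▸ Nat.le_add_right _ _
    exact (Nat.pow_lt_pow_iff_right (by norm_num)).1 h1
  have S : PowerSolution p n m :=
    ⟨hp, hp2, hn2, coprime_of_pow_add_two_pow_eq hp hp2 (by omega) h, by omega, h⟩
  exact (S.lt_of_four_mul_lt hlt).not_ge (S.le_of_mod_four (by omega) (S.p_mod_four hlt))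

theorem sq_add_two_pow_ne_three_pow {m n : ℕ} (hn : 2 ≤ n) : m ^ 2 + 2 ^ n ≠ 3 ^ n := by
  intro h
  rcases Nat.even_or_odd' n with ⟨a, rfl | rfl⟩
  · have h1 : 2 ^ (2 * a) ≡ 1 [MOD 3] := by
      rw [pow_mul]
      simpa using Nat.ModEq.pow a (show 2 ^ 2 ≡ 1 [MOD 3] by decide)
    have h2 : 3 ^ (2 * a) ≡ 0 [MOD 3] :=
      Nat.modEq_zero_iff_dvd.2 (dvd_pow_self 3 (by omega))
    have h3 := (((Nat.mod_modEq m 3).pow 2).add h1.symm).trans ((congrArg (· % 3) h).trans h2)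
    have h4 : ∀ i < 3, (i ^ 2 + 1) % 3 ≠ 0 % 3 := by decide
    exact h4 _ (Nat.mod_lt _ (by norm_num)) h3
  · have h1 : 2 ^ (2 * a + 1) ≡ 0 [MOD 4] :=
      Nat.modEq_zero_iff_dvd.2 (pow_dvd_pow 2 (show 2 ≤ 2 * a + 1 by omega))
    have h2 : 3 ^ (2 * a + 1) ≡ 3 [MOD 4] := by
      rw [pow_succ, pow_mul]
      simpa using (Nat.ModEq.pow a (show 3 ^ 2 ≡ 1 [MOD 4] by decide)).mul_right 3
    have h3 := (((Nat.mod_modEq m 4).pow 2).add h1.symm).trans ((congrArg (· % 4) h).trans h2)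
    have h4 : ∀ i < 4, (i ^ 2 + 0) % 4 ≠ 3 % 4 := by decide
    exact h4 _ (Nat.mod_lt _ (by norm_num)) h3

/-- For every `n ≥ 2`, the number `3 ^ n - 2 ^ n` is not a perfect power. -/
theorem three_pow_sub_two_pow_not_perfect_power (n : ℕ) (hn : 2 ≤ n) :
    ¬ ∃ (m k : ℕ), 2 ≤ m ∧ 2 ≤ k ∧ (3 : ℤ) ^ n - 2 ^ n = (m : ℤ) ^ k := by
  rintro ⟨m, k, hm, hk, h⟩
  have hp := Nat.minFac_prime (show k ≠ 1 by omega)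
  obtain ⟨d, hd⟩ := Nat.minFac_dvd k
  generalize k.minFac = p at hp hd
  have h1 : (m ^ d) ^ p + 2 ^ n = 3 ^ n := by
    rw [← pow_mul', ← hd]
    zify
    linarith
  rcases hp.eq_two_or_odd' with rfl | hodd
  · exact sq_add_two_pow_ne_three_pow hn h1
  · have hd0 : d ≠ 0 := by rintro rfl; omega
    exact pow_add_two_pow_ne_three_pow_of_odd hp hodd
      (hm.trans (Nat.le_self_pow hd0 m)) hn h1
end
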